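/- Let (R,m) be a Noetherian local ring that is a homomorphic image of a Cohen–Macaulay ring, and let M be a finitely generated R-module of dimension r ≥ 2. Let U = U_M(0) be the unmixed component of M and let Q be a parameter ideal for M. Then the following are equivalent: (1) e_1(Q,M) = 0; (2) M/U is a Cohen–Macaulay R-module and dim_R U ≤ r−2. -/

import Mathlib

open IsLocalRing

section Defs

variable (R : Type) [CommRing R]

/-- The length of a module, as the Krull dimension of its lattice of submodules. -/
noncomputable def mLength (M : Type) [AddCommGroup M] [Module R M] : WithBot ℕ∞ :=
  Order.krullDim (Submodule R M)

/-- The (Krull) dimension of a module. -/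
noncomputable def mDim (M : Type) [AddCommGroup M] [Module R M] : WithBot ℕ∞ :=
  ringKrullDim (R ⧸ Submodule.annihilator (⊤ : Submodule R M))

/-- `f` is eventually given by the Hilbert-type polynomial of degree `t` with
coefficients `s 0, …, s t` (written in the binomial basis with alternating signs). -/
def IsHilbPolyAt (f : ℕ → WithBot ℕ∞) (t : ℕ) (s : ℕ → ℤ) : Prop :=
  ∃ N : ℕ, ∀ n ≥ N, ∃ l : ℕ, f n = (l : ℕ∞) ∧
    (l : ℤ) = ∑ i ∈ Finset.range (t + 1), (-1 : ℤ) ^ i * s i * ((n + t - i).choose (t - i) : ℤ)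

/-- `s 0, …, s t` are the Hilbert coefficients `e_i(I, M)`, i.e.
`λ(M/I^{n+1}M) = ∑ (-1)^i e_i(I,M) C(n+t-i, t-i)` for `n ≫ 0`. -/
def HasHilbCoeffs (I : Ideal R) (M : Type) [AddCommGroup M] [Module R M]
    (t : ℕ) (s : ℕ → ℤ) : Prop :=
  IsHilbPolyAt (fun n => mLength R (M ⧸ (I ^ (n + 1) • (⊤ : Submodule R M)))) t s

/-- The unmixed component `U_M(0)` of `M`: the largest submodule of dimension `< dim M`. -/
noncomputable def unmixedComp (M : Type) [AddCommGroup M] [Module R M] : Submodule R M :=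
  sSup {N : Submodule R M | mDim R ↥N < mDim R M}

/-- `x` is a d-sequence on `M`. -/
def IsDSeq {r : ℕ} (x : Fin r → R) (M : Type) [AddCommGroup M] [Module R M] : Prop :=
  ∀ i j : Fin r, i ≤ j →
    Submodule.comap (LinearMap.lsmul R M (x i * x j))
        (Ideal.span (x '' {k | k < i}) • (⊤ : Submodule R M))
      = Submodule.comap (LinearMap.lsmul R M (x j))
        (Ideal.span (x '' {k | k < i}) • (⊤ : Submodule R M))

/-- `x` is a standard (d⁺-) system: all power sequences in any order are d-sequences. -/
def IsStandardSeq {r : ℕ} (x : Fin r → R) (M : Type) [AddCommGroup M] [Module R M] : Prop :=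
  ∀ n : Fin r → ℕ, (∀ k, 1 ≤ n k) → ∀ σ : Equiv.Perm (Fin r),
    IsDSeq R (fun k => x (σ k) ^ n (σ k)) M

/-- The integral closure of an ideal, as a set. -/
def intClos (Q : Ideal R) : Set R :=
  {x : R | ∃ n : ℕ, 0 < n ∧ ∃ a : ℕ → R, (∀ i, 1 ≤ i → i ≤ n → a i ∈ Q ^ i) ∧
    x ^ n + ∑ i ∈ Finset.Icc 1 n, a i * x ^ (n - i) = 0}

variable [IsLocalRing R]

/-- `h ∈ I` is superficial for `M` with respect to `I`. -/
def IsSuperficial (I : Ideal R) (M : Type) [AddCommGroup M] [Module R M] (h : R) : Prop :=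
  h ∈ I ∧ ∃ c N : ℕ, ∀ n ≥ N,
    Submodule.comap (LinearMap.lsmul R M h) (I ^ (n + 1) • (⊤ : Submodule R M))
        ⊓ (I ^ c • (⊤ : Submodule R M))
      = I ^ n • (⊤ : Submodule R M)

/-- `Q` is a parameter ideal for `M` (`r` the dimension of `M`):
generated by `r` elements of the maximal ideal with `M/QM` of finite length. -/
def IsParamIdeal (Q : Ideal R) (M : Type) [AddCommGroup M] [Module R M] (r : ℕ) : Prop :=
  Q ≤ maximalIdeal R ∧ (∃ x : Fin r → R, Q = Ideal.span (Set.range x)) ∧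
    IsFiniteLength R (M ⧸ Q • (⊤ : Submodule R M))

/-- Local cohomology `H^i_𝔪(M)` with support in the maximal ideal. -/
noncomputable def LC (i : ℕ) (M : Type) [AddCommGroup M] [Module R M] : ModuleCat R :=
  (localCohomology (maximalIdeal R) i).obj (ModuleCat.of R M)

/-- `M` is Cohen–Macaulay: there is a regular sequence on `M` in the maximal ideal
whose length equals `dim M`. -/
def IsCM (M : Type) [AddCommGroup M] [Module R M] : Prop :=
  ∃ rs : List R, (∀ x ∈ rs, x ∈ maximalIdeal R) ∧ RingTheory.Sequence.IsRegular M rs ∧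
    (rs.length : WithBot ℕ∞) = mDim R M

/-- `M` is unmixed: `dim R̂/p = dim M` for every associated prime `p` of the completion `M̂`. -/
def IsUnmixed (M : Type) [AddCommGroup M] [Module R M] : Prop :=
  ∀ p ∈ associatedPrimes (AdicCompletion (maximalIdeal R) R)
      (AdicCompletion (maximalIdeal R) M),
    ringKrullDim ((AdicCompletion (maximalIdeal R) R) ⧸ p) = mDim R M

/-- `M` is generalized Cohen–Macaulay: `H^i_𝔪(M)` has finite length for `i < r = dim M`. -/
def IsGenCM (M : Type) [AddCommGroup M] [Module R M] (r : ℕ) : Prop :=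
  ∀ i < r, IsFiniteLength R ↥(LC R i M)

/-- The set `Λ(M)` of first Hilbert coefficients of parameter ideals for `M`. -/
def Lambda (M : Type) [AddCommGroup M] [Module R M] (r : ℕ) : Set ℤ :=
  {a : ℤ | ∃ (Q : Ideal R) (e : ℕ → ℤ),
    IsParamIdeal R Q M r ∧ HasHilbCoeffs R Q M r e ∧ e 1 = a}

/-- A standard parameter ideal: one generated by a standard system of parameters. -/
def IsStandardParamIdeal (Q : Ideal R) (M : Type) [AddCommGroup M] [Module R M]
    (r : ℕ) : Prop :=
  IsParamIdeal R Q M r ∧ ∃ x : Fin r → R, Q = Ideal.span (Set.range x) ∧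
    IsStandardSeq R x M

/-- `M` is Buchsbaum: every parameter ideal for `M` is standard. -/
def IsBuchsbaum (M : Type) [AddCommGroup M] [Module R M] (r : ℕ) : Prop :=
  ∀ Q : Ideal R, IsParamIdeal R Q M r → IsStandardParamIdeal R Q M r

/-- `M` is a Vasconcelos module. -/
def IsVasconcelos (M : Type) [AddCommGroup M] [Module R M] : Prop :=
  mDim R M ≤ 0 ∨ (0 < mDim R M ∧ ∃ (r : ℕ) (Q : Ideal R) (e : ℕ → ℤ),
    mDim R M = (r : ℕ∞) ∧ IsParamIdeal R Q M r ∧ HasHilbCoeffs R Q M r e ∧ e 1 = 0)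

/-- A Gorenstein local ring: Noetherian, Cohen–Macaulay, with an irreducible parameter ideal. -/
def IsGorensteinLocalRing : Prop :=
  IsNoetherianRing R ∧ IsCM R R ∧ ∃ (r : ℕ) (Q : Ideal R),
    mDim R R = (r : ℕ∞) ∧ IsParamIdeal R Q R r ∧
    ∀ I J : Ideal R, Q = I ⊓ J → Q = I ∨ Q = J

/-- `E` is an injective envelope of the residue field `R/𝔪`. -/
def IsInjEnvResidue (E : Type) [AddCommGroup E] [Module R E] : Prop :=
  Module.Injective R E ∧ ∃ ι : (R ⧸ maximalIdeal R) →ₗ[R] E, Function.Injective ι ∧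
    ∀ N : Submodule R E, N ⊓ LinearMap.range ι = ⊥ → N = ⊥

end Defs

/-- A (not necessarily local) Cohen–Macaulay ring: Noetherian,
with all localizations at primes Cohen–Macaulay. -/
def IsCMRing (S : Type) [CommRing S] : Prop :=
  IsNoetherianRing S ∧ ∀ (p : Ideal S) [p.IsPrime],
    IsCM (Localization.AtPrime p) (Localization.AtPrime p)

/-- A (not necessarily local) Gorenstein ring. -/
def IsGorensteinRing (S : Type) [CommRing S] : Prop :=
  IsNoetherianRing S ∧ ∀ (p : Ideal S) [p.IsPrime],
    IsGorensteinLocalRing (Localization.AtPrime p)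

/-- `HDegRel R I E M v` : `v` is the homological degree `hdeg_I(M)` computed
with Matlis duals taken relative to `E`. -/
inductive HDegRel (R : Type) [CommRing R] [IsLocalRing R] (I : Ideal R)
    (E : Type) [AddCommGroup E] [Module R E] : ModuleCat R → ℕ → Prop where
  | base : ∀ (M : ModuleCat R) (l : ℕ), mDim R M ≤ 0 → mLength R M = (l : ℕ∞) →
      HDegRel R I E M l
  | step : ∀ (M : ModuleCat R) (r : ℕ), mDim R M = (r : ℕ∞) → 0 < r →
      ∀ (e : ℕ → ℤ) (e0 : ℕ), HasHilbCoeffs R I M r e → e 0 = (e0 : ℤ) →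
      ∀ v : ℕ → ℕ,
        (∀ j < r, HDegRel R I E (ModuleCat.of R ((LC R j M) →ₗ[R] E)) (v j)) →
      HDegRel R I E M (e0 + ∑ j ∈ Finset.range r, (r - 1).choose j * v j)

namespace HilbertFiber

open MvPolynomial

section Polynomials

/-- In a unique factorization domain, `a ∣ c` as soon as for each prime `p` there is a
multiplier `g` prime to `p` with `a ∣ g * c`. -/
theorem dvd_of_forall_prime {A : Type*} [CommRing A] [IsDomain A] [UniqueFactorizationMonoid A]
    {a : A} (ha : a ≠ 0) {c : A} (h : ∀ p : A, Prime p → ∃ g, ¬ p ∣ g ∧ a ∣ g * c) : a ∣ c := by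
  induction a using UniqueFactorizationMonoid.induction_on_prime generalizing c with
  | h₁ => exact absurd rfl ha
  | h₂ u hu => exact hu.dvd
  | h₃ a p ha0 hp ih =>
    obtain ⟨g, hg, hd⟩ := h p hp
    obtain ⟨c', rfl⟩ : p ∣ c :=
      (hp.dvd_or_dvd ((Dvd.intro _ rfl).trans hd)).resolve_left hg
    refine mul_dvd_mul_left p (ih ha0 fun p' hp' => ?_)
    obtain ⟨g', hg', hd'⟩ := h p' hp'
    refine ⟨g', hg', ?_⟩
    rw [mul_left_comm] at hd'
    exact (mul_dvd_mul_iff_left hp.ne_zero).1 hd'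

theorem homogeneousComponent_mul_of_isHomogeneous {σ K : Type*} [CommSemiring K]
    {f : MvPolynomial σ K} {d : ℕ} (hf : f.IsHomogeneous d) (g : MvPolynomial σ K) (j : ℕ) :
    homogeneousComponent (d + j) (f * g) = f * homogeneousComponent j g := by
  conv_lhs => rw [← sum_homogeneousComponent g, Finset.mul_sum, map_sum]
  have : ∀ i, homogeneousComponent (d + j) (f * homogeneousComponent i g) =
      if i = j then f * homogeneousComponent j g else 0 := by
    intro i
    rw [homogeneousComponent_of_mem (hf.mul (homogeneousComponent_isHomogeneous i g))]
    by_cases hij : i = j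
    · simp [hij]
    · simp [hij, Ne.symm hij]
  simp only [this, Finset.sum_ite_eq', Finset.mem_range]
  split_ifs with h
  · rfl
  · rw [homogeneousComponent_eq_zero, mul_zero]
    omega

theorem exists_isHomogeneous_map_eq {σ A B : Type*} [CommRing A] [CommRing B] (φ : A →+* B)
    (hφ : Function.Surjective φ) {d : ℕ} {g : MvPolynomial σ B} (hg : g.IsHomogeneous d) :
    ∃ f : MvPolynomial σ A, f.IsHomogeneous d ∧ map φ f = g := by
  obtain ⟨f, rfl⟩ := map_surjective φ hφ g
  refine ⟨homogeneousComponent d f, homogeneousComponent_isHomogeneous d f, ?_⟩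
  ext m
  rw [coeff_map, coeff_homogeneousComponent, coeff_map]
  split_ifs with h
  · rfl
  · rw [map_zero, ← coeff_map, hg.coeff_eq_zero h]

end Polynomials

section

variable {R : Type*} [CommRing R] {r : ℕ} (x : Fin r → R)

/-- The ideal generated by the elements `x i`. -/
abbrev gen : Ideal R := Ideal.span (Set.range x)

theorem eval_mem_gen_pow {d : ℕ} {f : MvPolynomial (Fin r) R} (hf : f.IsHomogeneous d) :
    eval x f ∈ gen x ^ d :=
  (Ideal.mem_span_pow_iff_exists_isHomogeneous x _).2 ⟨f, hf, rfl⟩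

variable {N : Type*} [AddCommGroup N] [Module R N]

theorem mem_pow_smul_sup_span {d : ℕ} {V : Submodule R N} {v w : N} :
    w ∈ gen x ^ d • (V ⊔ R ∙ v) ↔
      ∃ f : MvPolynomial (Fin r) R, f.IsHomogeneous d ∧ w - eval x f • v ∈ gen x ^ d • V := by
  rw [Submodule.smul_sup, Submodule.mem_sup]
  constructor
  · rintro ⟨a, ha, b, hb, rfl⟩
    obtain ⟨c, hc, rfl⟩ := Submodule.mem_smul_span_singleton.1 hb
    obtain ⟨f, hf, rfl⟩ := (Ideal.mem_span_pow_iff_exists_isHomogeneous x _).1 hc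
    exact ⟨f, hf, by simpa using ha⟩
  · rintro ⟨f, hf, h⟩
    exact ⟨_, h, eval x f • v, Submodule.smul_mem_smul (eval_mem_gen_pow x hf)
      (Submodule.mem_span_singleton_self v), by simp⟩

theorem eval_smul_mem {d e : ℕ} {f : MvPolynomial (Fin r) R} (hf : f.IsHomogeneous d)
    {V : Submodule R N} {w : N} (hw : w ∈ gen x ^ e • V) :
    eval x f • w ∈ gen x ^ (d + e) • V := by
  rw [pow_add, Submodule.mul_smul]
  exact Submodule.smul_mem_smul (eval_mem_gen_pow x hf) hw

/-- If `eval x f` sends `V` into `gen x ^ e • W`, it sends `gen x ^ d • V` into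
`gen x ^ (d + e) • W`. -/
theorem smul_mem_of_forall_smul_mem {d e : ℕ} {a : R} {V W : Submodule R N}
    (h : ∀ v ∈ V, a • v ∈ gen x ^ e • W) {w : N} (hw : w ∈ gen x ^ d • V) :
    a • w ∈ gen x ^ (d + e) • W := by
  refine Submodule.smul_induction_on hw (fun b hb v hv => ?_) (fun v w hv hw => ?_)
  · rw [pow_add, Submodule.mul_smul]
    rw [smul_comm a b v]
    exact Submodule.smul_mem_smul hb (h v hv)
  · rw [smul_add]
    exact add_mem hv hw

theorem pow_smul_le_pow_smul {d e : ℕ} (h : d ≤ e) (V : Submodule R N) :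
    gen x ^ e • V ≤ gen x ^ d • V :=
  Submodule.smul_mono_left (Ideal.pow_le_pow_right h)

variable [IsLocalRing R]

/-- Reduction of the coefficients modulo the maximal ideal. -/
noncomputable abbrev red (f : MvPolynomial (Fin r) R) : MvPolynomial (Fin r) (ResidueField R) :=
  map (residue R) f

theorem eval_smul_mem_of_red_eq_zero {d : ℕ} {f : MvPolynomial (Fin r) R}
    (hf : f.IsHomogeneous d) (h0 : red f = 0) {V : Submodule R N} {v : N}
    (hv : ∀ a ∈ maximalIdeal R, a • v ∈ V) : eval x f • v ∈ gen x ^ d • V := by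
  rw [eval_eq, Finset.sum_smul]
  refine Submodule.sum_mem _ fun m hm => ?_
  rw [mul_comm, mul_smul]
  refine Submodule.smul_mem_smul ?_ (hv _ ?_)
  · have := eval_mem_gen_pow x
      (isHomogeneous_monomial (1 : R) (show m.degree = d from ?_))
    · simpa [eval_monomial, Finsupp.prod] using this
    · by_contra hne
      exact (mem_support_iff.1 hm) (hf.coeff_eq_zero hne)
  · have := congrArg (coeff m) h0
    rwa [coeff_map, coeff_zero, residue_eq_zero_iff] at this

/-- No form with nonzero reduction maps `v` into the expected power of `V`. -/
def FreeStep (V : Submodule R N) (v : N) : Prop :=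
  ∀ d (f : MvPolynomial (Fin r) R), f.IsHomogeneous d → eval x f • v ∈ gen x ^ d • V → red f = 0

/-- A finite chain of simple extensions from `A`, all of them free in the sense of `FreeStep`. -/
inductive FreeChain (A : Submodule R N) : Submodule R N → Prop
  | refl : FreeChain A A
  | step (V : Submodule R N) (v : N) : FreeChain A V → v ∉ V →
      (∀ a ∈ maximalIdeal R, a • v ∈ V) → FreeStep x V v → FreeChain A (V ⊔ R ∙ v)

variable {x} in
theorem FreeChain.le {A B : Submodule R N} (h : FreeChain x A B) : A ≤ B := by
  induction h with
  | refl => exact le_rfl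
  | step V v _ _ _ _ ih => exact ih.trans le_sup_left

/-- A family of forms not all divisible (after reduction) by a common prime. -/
def Big (X : Set (ℕ × MvPolynomial (Fin r) R)) : Prop :=
  ∀ p : MvPolynomial (Fin r) (ResidueField R), Prime p →
    ∃ y ∈ X, y.2.IsHomogeneous y.1 ∧ ¬ p ∣ red y.2

theorem Big.exists_ne_zero (hr : 0 < r) {X : Set (ℕ × MvPolynomial (Fin r) R)} (hX : Big X) :
    ∃ y ∈ X, y.2.IsHomogeneous y.1 ∧ red y.2 ≠ 0 := by
  obtain ⟨y, hy, hh, hp⟩ := hX (MvPolynomial.X ⟨0, hr⟩) MvPolynomial.X_prime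
  exact ⟨y, hy, hh, fun h => hp (h ▸ dvd_zero _)⟩

/-- Pairwise products of members of two families of forms. -/
def prodFamily (X Y : Set (ℕ × MvPolynomial (Fin r) R)) : Set (ℕ × MvPolynomial (Fin r) R) :=
  {z | ∃ y₁ ∈ X, ∃ y₂ ∈ Y, y₁.2.IsHomogeneous y₁.1 ∧ y₂.2.IsHomogeneous y₂.1 ∧
    z = (y₁.1 + y₂.1, y₁.2 * y₂.2)}

theorem Big.prodFamily {X Y : Set (ℕ × MvPolynomial (Fin r) R)} (hX : Big X) (hY : Big Y) :
    Big (prodFamily X Y) := by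
  intro p hp
  obtain ⟨y₁, h₁, hh₁, hp₁⟩ := hX p hp
  obtain ⟨y₂, h₂, hh₂, hp₂⟩ := hY p hp
  refine ⟨_, ⟨y₁, h₁, y₂, h₂, hh₁, hh₂, rfl⟩, hh₁.mul hh₂, ?_⟩
  simp only [map_mul]
  exact fun h => (hp.dvd_or_dvd h).elim hp₁ hp₂

/-- Simultaneous division along one free simple step. -/
theorem division_step (hr : 0 < r) {V : Submodule R N} {u : N}
    (hm : ∀ a ∈ maximalIdeal R, a • u ∈ V) (hfree : FreeStep x V u)
    {X : Set (ℕ × MvPolynomial (Fin r) R)} (hX : Big X) (j : ℕ) (v : N)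
    (hv : ∀ y ∈ X, y.2.IsHomogeneous y.1 → eval x y.2 • v ∈ gen x ^ (y.1 + j) • (V ⊔ R ∙ u)) :
    ∃ e : MvPolynomial (Fin r) R, e.IsHomogeneous j ∧ ∀ y ∈ X, y.2.IsHomogeneous y.1 →
      eval x y.2 • (v - eval x e • u) ∈ gen x ^ (y.1 + j) • V := by
  have key : ∀ y ∈ X, y.2.IsHomogeneous y.1 → ∃ h : MvPolynomial (Fin r) R,
      h.IsHomogeneous (y.1 + j) ∧ eval x y.2 • v - eval x h • u ∈ gen x ^ (y.1 + j) • V :=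
    fun y hy hh => (mem_pow_smul_sup_span x).1 (hv y hy hh)
  choose! h hhom hmem using key
  have cross : ∀ y ∈ X, y.2.IsHomogeneous y.1 → ∀ z ∈ X, z.2.IsHomogeneous z.1 →
      red y.2 * red (h z) = red z.2 * red (h y) := by
    intro y hy hyh z hz hzh
    have h1 := eval_smul_mem x hyh (hmem z hz hzh)
    have h2 := eval_smul_mem x hzh (hmem y hy hyh)
    rw [← add_assoc] at h1 h2
    rw [add_comm z.1 y.1] at h2
    have h3 : eval x (y.2 * h z - z.2 * h y) • u ∈ gen x ^ (y.1 + z.1 + j) • V := by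
      convert sub_mem h2 h1 using 1
      simp only [map_sub, map_mul, smul_sub, sub_smul, mul_smul]
      rw [smul_comm (eval x z.2) (eval x y.2) v]
      abel
    have h4 := hfree _ _ (IsHomogeneous.sub
      (by simpa [add_assoc] using hyh.mul (hhom z hz hzh))
      (by simpa [add_assoc, add_left_comm] using hzh.mul (hhom y hy hyh))) h3
    simpa [sub_eq_zero] using h4
  obtain ⟨y₀, hy₀, hh₀, hne⟩ := hX.exists_ne_zero hr
  have hdvd : red y₀.2 ∣ red (h y₀) := by
    refine dvd_of_forall_prime hne fun p hp => ?_
    obtain ⟨z, hz, hzh, hpz⟩ := hX p hp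
    exact ⟨red z.2, hpz, Dvd.intro _ (cross y₀ hy₀ hh₀ z hz hzh)⟩
  obtain ⟨e', he'⟩ := hdvd
  have he'' : red (h y₀) = red y₀.2 * homogeneousComponent j e' := by
    rw [← homogeneousComponent_mul_of_isHomogeneous (hh₀.map (residue R)), ← he',
      homogeneousComponent_eq_self ((hhom y₀ hy₀ hh₀).map (residue R))]
  obtain ⟨e, heh, hee⟩ := exists_isHomogeneous_map_eq (residue R) residue_surjective
    (homogeneousComponent_isHomogeneous j e')
  refine ⟨e, heh, fun y hy hyh => ?_⟩
  have hzero : red (h y - y.2 * e) = 0 := by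
    have h5 := cross y₀ hy₀ hh₀ y hy hyh
    rw [he'', mul_left_comm, ← hee] at h5
    have := mul_left_cancel₀ hne h5
    rw [red, map_sub, map_mul, sub_eq_zero, ← red, this]
  have h6 := eval_smul_mem_of_red_eq_zero x ((hhom y hy hyh).sub (hyh.mul heh)) hzero hm
  convert add_mem (hmem y hy hyh) h6 using 1
  simp only [map_sub, map_mul, smul_sub, sub_smul, mul_smul]
  abel

/-- Simultaneous division along a free chain. -/
theorem FreeChain.division (hr : 0 < r) {A B : Submodule R N} (hAB : FreeChain x A B)
    {X : Set (ℕ × MvPolynomial (Fin r) R)} (hX : Big X) (j : ℕ) (v : N)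
    (hv : ∀ y ∈ X, y.2.IsHomogeneous y.1 → eval x y.2 • v ∈ gen x ^ (y.1 + j) • B) :
    ∃ E ∈ gen x ^ j • B, ∀ y ∈ X, y.2.IsHomogeneous y.1 →
      eval x y.2 • (v - E) ∈ gen x ^ (y.1 + j) • A := by
  induction hAB generalizing v with
  | refl => exact ⟨0, zero_mem _, by simpa using hv⟩
  | step V u hV hu hm hfree ih =>
    obtain ⟨e, heh, he⟩ := division_step x hr hm hfree hX j v hv
    obtain ⟨E, hE, hE'⟩ := ih _ he
    refine ⟨E + eval x e • u, add_mem (Submodule.smul_mono le_rfl le_sup_left hE)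
      (Submodule.smul_mem_smul (eval_mem_gen_pow x heh)
        (Submodule.mem_sup_right (Submodule.mem_span_singleton_self u))), fun y hy hyh => ?_⟩
    convert hE' y hy hyh using 2
    abel

/-- Forms with nonzero reduction are cancellable along free chains. -/
theorem FreeChain.colon {A B : Submodule R N} (hAB : FreeChain x A B) {d : ℕ}
    {f : MvPolynomial (Fin r) R} (hf : f.IsHomogeneous d) (hne : red f ≠ 0) {i : ℕ} {u : N}
    (hu : u ∈ gen x ^ i • B) (hfu : eval x f • u ∈ gen x ^ (d + i) • A) :
    u ∈ gen x ^ i • A := by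
  induction hAB with
  | refl => exact hu
  | step V v hV hv hm hfree ih =>
    refine ih ?_
    obtain ⟨h, hh, hmem⟩ := (mem_pow_smul_sup_span x).1 hu
    have h1 : eval x (f * h) • v ∈ gen x ^ (d + i) • V := by
      have h2 := eval_smul_mem x hf hmem
      convert sub_mem (Submodule.smul_mono le_rfl hV.le hfu) h2 using 1
      simp only [map_mul, smul_sub, mul_smul]
      abel
    have h3 := hfree _ _ (hf.mul hh) h1
    rw [red, map_mul] at h3
    have h4 := (mul_eq_zero.1 h3).resolve_left hne
    simpa using add_mem hmem (eval_smul_mem_of_red_eq_zero x hh h4 hm)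

/-- Forms with nonzero reduction are cancellable if `gen x • ⊤` and `⊤` are joined by a free
chain. -/
theorem FreeChain.mem_of_eval_smul_mem (h : FreeChain x (gen x • ⊤ : Submodule R N) ⊤) {d : ℕ}
    {f : MvPolynomial (Fin r) R} (hf : f.IsHomogeneous d) (hne : red f ≠ 0) {j : ℕ} {w : N}
    (hw : eval x f • w ∈ gen x ^ (d + j) • (⊤ : Submodule R N)) :
    w ∈ gen x ^ j • (⊤ : Submodule R N) := by
  induction j with
  | zero => simp
  | succ j ih =>
    have := h.colon x hf hne (ih (pow_smul_le_pow_smul x (by omega) _ hw))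
    rw [← Submodule.mul_smul, ← Submodule.mul_smul, ← pow_succ, ← pow_succ] at this
    exact this hw

/-- Build submodules from `A` upwards by simple extensions. -/
theorem exists_maximal_of_step [IsNoetherian R N] {A B : Submodule R N} {P : Submodule R N → Prop}
    (hA : ∃ k, maximalIdeal R ^ k • (⊤ : Submodule R N) ≤ A) (hAB : A ≤ B) (hP : P A)
    (hstep : ∀ V v, A ≤ V → P V → v ∈ B → v ∉ V → (∀ a ∈ maximalIdeal R, a • v ∈ V) →
      P (V ⊔ R ∙ v)) : P B := by
  classical
  obtain ⟨V, ⟨hAV, hVB, hPV⟩, hmax⟩ :=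
    (wellFounded_gt : WellFounded ((· > ·) : Submodule R N → _ → Prop)).has_min
      {V | A ≤ V ∧ V ≤ B ∧ P V} ⟨A, le_rfl, hAB, hP⟩
  by_cases hBV : B ≤ V
  · exact le_antisymm hVB hBV ▸ hPV
  exfalso
  have hex : ∃ k, maximalIdeal R ^ k • B ≤ V := by
    obtain ⟨k, hk⟩ := hA
    exact ⟨k, (Submodule.smul_mono le_rfl le_top).trans (hk.trans hAV)⟩
  have h0 : Nat.find hex ≠ 0 := fun h => hBV (by simpa [h] using Nat.find_spec hex)
  obtain ⟨k, hk⟩ := Nat.exists_eq_succ_of_ne_zero h0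
  have hlt : ¬ maximalIdeal R ^ k • B ≤ V := Nat.find_min hex (by omega)
  obtain ⟨v, hv, hvV⟩ := SetLike.not_le_iff_exists.1 hlt
  have hvB : v ∈ B := Submodule.smul_le_right hv
  have hm : ∀ a ∈ maximalIdeal R, a • v ∈ V := fun a ha => by
    have := Nat.find_spec hex
    rw [hk, Nat.succ_eq_add_one, pow_succ', Submodule.mul_smul] at this
    exact this (Submodule.smul_mem_smul ha hv)
  refine hmax (V ⊔ R ∙ v) ⟨hAV.trans le_sup_left, sup_le hVB ?_, hstep V v hAV hPV hvB hvV hm⟩ ?_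
  · rwa [Submodule.span_singleton_le_iff_mem]
  · refine lt_of_le_of_ne le_sup_left fun h => hvV ?_
    rw [h]
    exact Submodule.mem_sup_right (Submodule.mem_span_singleton_self v)

end

section

variable {R : Type*} [CommRing R] [IsLocalRing R] {r : ℕ} (x : Fin r → R)

/-- Multiplication by forms with nonzero reduction is injective up to a bounded shift of the
`gen x`-adic filtration. -/
def BoundedColon (N : Type*) [AddCommGroup N] [Module R N] : Prop :=
  ∃ C : ℕ, ∀ (d : ℕ) (f : MvPolynomial (Fin r) R), f.IsHomogeneous d → red f ≠ 0 →
    ∀ (j : ℕ) (w : N), eval x f • w ∈ gen x ^ (d + j) • (⊤ : Submodule R N) →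
      w ∈ gen x ^ (j - C) • (⊤ : Submodule R N)

variable (N : Type*) [AddCommGroup N] [Module R N]

/-- Elements that some form with nonzero reduction moves too deep into the filtration. -/
def deepPart : Submodule R N where
  carrier := {w | ∃ (d : ℕ) (f : MvPolynomial (Fin r) R), f.IsHomogeneous d ∧ red f ≠ 0 ∧
    eval x f • w ∈ gen x ^ (d + 1) • (⊤ : Submodule R N)}
  zero_mem' := ⟨0, 1, isHomogeneous_one _ _, by simp [red], by simp⟩
  add_mem' := by
    rintro u v ⟨d, f, hf, hfn, hu⟩ ⟨e, g, hg, hgn, hv⟩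
    refine ⟨d + e, f * g, hf.mul hg, by simp [red] at *; tauto, ?_⟩
    rw [smul_add]
    refine add_mem ?_ ?_
    · have := eval_smul_mem x hg hu
      rwa [smul_smul, ← map_mul, mul_comm g f, ← add_assoc, add_comm e d] at this
    · have := eval_smul_mem x hf hv
      rwa [smul_smul, ← map_mul, ← add_assoc] at this
  smul_mem' := by
    rintro a v ⟨d, f, hf, hfn, hu⟩
    exact ⟨d, f, hf, hfn, by rw [smul_comm]; exact Submodule.smul_mem _ _ hu⟩

variable {N}

theorem gen_smul_le_deepPart : gen x • (⊤ : Submodule R N) ≤ deepPart x N := fun w hw =>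
  ⟨0, 1, isHomogeneous_one _ _, by simp [red], by simpa using hw⟩

theorem exists_form_of_fg {W : Submodule R N} (hW : W.FG) (h : W ≤ deepPart x N) :
    ∃ (d : ℕ) (f : MvPolynomial (Fin r) R), f.IsHomogeneous d ∧ red f ≠ 0 ∧
      ∀ w ∈ W, eval x f • w ∈ gen x ^ (d + 1) • (⊤ : Submodule R N) := by
  induction W, hW using Submodule.fg_induction with
  | singleton v =>
    obtain ⟨d, f, hf, hn, hv⟩ := h (Submodule.mem_span_singleton_self v)
    refine ⟨d, f, hf, hn, fun w hw => ?_⟩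
    obtain ⟨a, rfl⟩ := Submodule.mem_span_singleton.1 hw
    rw [smul_comm]
    exact Submodule.smul_mem _ _ hv
  | sup W₁ W₂ _ _ ih₁ ih₂ =>
    obtain ⟨d, f, hf, hfn, h₁⟩ := ih₁ (le_sup_left.trans h)
    obtain ⟨e, g, hg, hgn, h₂⟩ := ih₂ (le_sup_right.trans h)
    refine ⟨d + e, f * g, hf.mul hg, by simp [red] at *; tauto, fun w hw => ?_⟩
    obtain ⟨u, hu, v, hv, rfl⟩ := Submodule.mem_sup.1 hw
    rw [smul_add]
    refine add_mem ?_ ?_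
    · have := eval_smul_mem x hg (h₁ u hu)
      rwa [smul_smul, ← map_mul, mul_comm g f, ← add_assoc, add_comm e d] at this
    · have := eval_smul_mem x hf (h₂ v hv)
      rwa [smul_smul, ← map_mul, ← add_assoc] at this

/-- Every simple step above `gen x • ⊤` that is not free carries a big family of forms. -/
def StepDichotomy (N : Type*) [AddCommGroup N] [Module R N] : Prop :=
  ∀ (V : Submodule R N) (v : N), gen x • ⊤ ≤ V → v ∉ V → (∀ a ∈ maximalIdeal R, a • v ∈ V) →
    ¬ FreeStep x V v →
    Big {y : ℕ × MvPolynomial (Fin r) R | eval x y.2 • v ∈ gen x ^ y.1 • V}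

variable [IsNoetherian R N]

theorem freeChain_deepPart_top (hr : 0 < r)
    (hfin : ∃ k, maximalIdeal R ^ k • (⊤ : Submodule R N) ≤ gen x • ⊤)
    (hdich : StepDichotomy x N) : FreeChain x (deepPart x N) ⊤ := by
  have hq := gen_smul_le_deepPart x (N := N)
  refine exists_maximal_of_step (P := FreeChain x (deepPart x N))
    (hfin.imp fun k hk => hk.trans hq) le_top .refl fun V v hWV hV _ hv hm => ?_
  refine hV.step V v hv hm (by_contra fun hnf => ?_)
  have hbig := hdich V v (hq.trans hWV) hv hm hnf
  obtain ⟨E, hE, hE'⟩ := hV.division x hr hbig 0 v (fun y hy _ => by simpa using hy)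
  obtain ⟨y, hy, hh, hne⟩ := hbig.exists_ne_zero hr
  obtain ⟨d, g, hg, hgn, hgW⟩ := exists_form_of_fg x
    (IsNoetherian.noetherian (deepPart x N)) le_rfl
  have h1 := smul_mem_of_forall_smul_mem x hgW (hE' y hy hh)
  have h2 : v - E ∈ deepPart x N := by
    refine ⟨y.1 + d, y.2 * g, hh.mul hg, by simp [red] at *; tauto, ?_⟩
    rwa [smul_smul, ← map_mul, mul_comm g, add_zero, ← add_assoc] at h1
  refine hv ?_
  have := add_mem (hWV h2) (by simpa using hE : E ∈ V)
  simpa using this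

theorem exists_big_of_deepPart
    (hfin : ∃ k, maximalIdeal R ^ k • (⊤ : Submodule R N) ≤ gen x • ⊤)
    (hdich : StepDichotomy x N) :
    ∃ X : Set (ℕ × MvPolynomial (Fin r) R), Big X ∧ ∀ y ∈ X, y.2.IsHomogeneous y.1 →
      ∀ w ∈ deepPart x N, eval x y.2 • w ∈ gen x ^ (y.1 + 1) • (⊤ : Submodule R N) := by
  refine exists_maximal_of_step (B := deepPart x N) (P := fun V : Submodule R N =>
    ∃ X : Set (ℕ × MvPolynomial (Fin r) R), Big X ∧ ∀ y ∈ X, y.2.IsHomogeneous y.1 →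
      ∀ w ∈ V, eval x y.2 • w ∈ gen x ^ (y.1 + 1) • (⊤ : Submodule R N))
    hfin (gen_smul_le_deepPart x) ⟨Set.univ, fun p hp => ?_, fun y _ hy w hw => ?_⟩ ?_
  · exact ⟨(0, 1), trivial, isHomogeneous_one _ _, by simpa using hp.not_dvd_one⟩
  · simpa [pow_add, Submodule.mul_smul] using eval_smul_mem x (e := 0) hy (by simpa using hw)
  · rintro V v hqV ⟨X, hX, hXV⟩ hvW hv hm
    have hnf : ¬ FreeStep x V v := by
      obtain ⟨d, f, hf, hfn, hfv⟩ := hvW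
      refine fun h => hfn (h d f hf ?_)
      rw [pow_succ, Submodule.mul_smul] at hfv
      exact Submodule.smul_mono le_rfl hqV hfv
    refine ⟨_, hX.prodFamily (hdich V v hqV hv hm hnf), ?_⟩
    rintro _ ⟨y, hy, z, hz, hyh, hzh, rfl⟩ - w hw
    obtain ⟨u, hu, c, hc, rfl⟩ := Submodule.mem_sup.1 hw
    obtain ⟨a, rfl⟩ := Submodule.mem_span_singleton.1 hc
    simp only [smul_add]
    refine add_mem ?_ ?_
    · have := eval_smul_mem x hzh (hXV y hy hyh u hu)
      rwa [smul_smul, ← map_mul, mul_comm z.2, ← add_assoc, add_comm z.1] at this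
    · rw [smul_comm]
      refine Submodule.smul_mem _ _ ?_
      have := smul_mem_of_forall_smul_mem x (hXV y hy hyh) hz
      rwa [smul_smul, ← map_mul, ← add_assoc, add_comm z.1] at this

/-- If all nonfree steps carry big families and the colon condition holds, then `gen x • ⊤` and
`⊤` are joined by a free chain. -/
theorem freeChain_of_stepDichotomy (hr : 0 < r)
    (hfin : ∃ k, maximalIdeal R ^ k • (⊤ : Submodule R N) ≤ gen x • ⊤)
    (hdich : StepDichotomy x N) (hbc : BoundedColon x N) :
    FreeChain x (gen x • ⊤ : Submodule R N) ⊤ := by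
  have hchain := freeChain_deepPart_top x hr hfin hdich
  obtain ⟨X, hX, hXW⟩ := exists_big_of_deepPart x hfin hdich
  have key : ∀ w ∈ deepPart x N, ∀ j : ℕ, ∃ w', w - w' ∈ gen x • (⊤ : Submodule R N) ∧
      ∃ Y : Set (ℕ × MvPolynomial (Fin r) R), Big Y ∧ ∀ y ∈ Y, y.2.IsHomogeneous y.1 →
        eval x y.2 • w' ∈ gen x ^ (y.1 + (j + 1)) • (⊤ : Submodule R N) := by
    intro w hw j
    induction j with
    | zero => exact ⟨w, by simp, X, hX, fun y hy hyh => hXW y hy hyh w hw⟩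
    | succ j ih =>
      obtain ⟨w', hw', Y, hY, hYw⟩ := ih
      obtain ⟨E, hE, hE'⟩ := hchain.division x hr hY (j + 1) w' hYw
      refine ⟨w' - E, ?_, prodFamily Y X, hY.prodFamily hX, ?_⟩
      · have : E ∈ gen x • (⊤ : Submodule R N) := by
          simpa using pow_smul_le_pow_smul x (d := 1) (by omega) _ hE
        convert add_mem hw' this using 1
        abel
      · rintro _ ⟨y, hy, z, hz, hyh, hzh, rfl⟩ -
        have := smul_mem_of_forall_smul_mem x (hXW z hz hzh) (hE' y hy hyh)
        rw [smul_smul, ← map_mul, mul_comm z.2] at this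
        convert this using 3
        simp only
        omega
  have hle : deepPart x N ≤ gen x • ⊤ := by
    intro w hw
    obtain ⟨C, hC⟩ := hbc
    obtain ⟨w', hw', Y, hY, hYw⟩ := key w hw C
    obtain ⟨y, hy, hyh, hne⟩ := hY.exists_ne_zero hr
    have := hC _ _ hyh hne (C + 1) w' (hYw y hy hyh)
    rw [Nat.add_sub_cancel_left, pow_one] at this
    simpa using add_mem hw' this
  rwa [le_antisymm hle (gen_smul_le_deepPart x)] at hchain

end

section Multichoose

theorem sum_multichoose (s n : ℕ) :
    ∑ d ∈ Finset.range (n + 1), s.multichoose d = (s + 1).multichoose n := by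
  induction n with
  | zero => simp
  | succ n ih => rw [Finset.sum_range_succ, ih, Nat.multichoose_succ_succ, add_comm]

theorem multichoose_le_pow (s n : ℕ) : (s + 1).multichoose n ≤ (n + 1) ^ s := by
  induction s generalizing n with
  | zero => simp
  | succ s ih =>
    rw [← sum_multichoose]
    calc _ ≤ ∑ d ∈ Finset.range (n + 1), (n + 1) ^ s := Finset.sum_le_sum fun d hd =>
            (ih d).trans (Nat.pow_le_pow_left (by simp at hd; omega) s)
      _ = _ := by simp [pow_succ']

theorem pow_le_factorial_mul_multichoose (s n : ℕ) :
    (n + 1) ^ s ≤ s.factorial * (s + 1).multichoose n := by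
  rw [Nat.multichoose_eq, show s + 1 + n - 1 = n + s by omega,
    Nat.choose_symm_of_eq_add (show n + s = n + s from rfl),
    ← Nat.ascFactorial_eq_factorial_mul_choose]
  exact Nat.pow_succ_le_ascFactorial (n + 1) s

theorem multichoose_mono (s : ℕ) {m n : ℕ} (h : m ≤ n) :
    (s + 1).multichoose m ≤ (s + 1).multichoose n := by
  rw [← sum_multichoose, ← sum_multichoose]
  exact Finset.sum_le_sum_of_subset (Finset.range_mono (by omega))

theorem sum_multichoose_shift (s d₀ n : ℕ) :
    ∑ d ∈ Finset.range (n + 1), (s + 1).multichoose d ≤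
      ∑ d ∈ Finset.range (n + 1), (if d₀ ≤ d then (s + 1).multichoose (d - d₀) else 0) +
        d₀ * (s + 1).multichoose n := by
  have h1 : ∀ d₀ m, ∑ d ∈ Finset.range m,
      (if d₀ ≤ d then (s + 1).multichoose (d - d₀) else 0) =
      ∑ d ∈ Finset.range (m - d₀), (s + 1).multichoose d := by
    intro d₀ m
    induction m with
    | zero => simp
    | succ m ih =>
      rw [Finset.sum_range_succ, ih]
      split_ifs with h
      · rw [Nat.succ_sub h, Finset.sum_range_succ]
      · rw [show m - d₀ = 0 by omega, show m + 1 - d₀ = 0 by omega]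
        simp
  rw [h1 d₀ (n + 1)]
  clear h1
  induction d₀ with
  | zero => simp
  | succ k ih =>
    refine ih.trans ?_
    by_cases hk : k ≤ n
    · rw [show n + 1 - k = (n + 1 - (k + 1)) + 1 by omega, Finset.sum_range_succ]
      have := multichoose_mono s (show n + 1 - (k + 1) ≤ n by omega)
      linarith
    · rw [show n + 1 - k = 0 by omega, show n + 1 - (k + 1) = 0 by omega]
      simp only [Finset.range_zero, Finset.sum_empty, zero_add]
      gcongr
      omega

end Multichoose

section FormSpace

variable (k : Type*) [Field k] {r : ℕ}

/-- Span of the monomials of degree `d` in the variables from `s`. -/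
noncomputable def formSpace (s : Finset (Fin r)) (d : ℕ) : Submodule k (MvPolynomial (Fin r) k) :=
  Submodule.span k ((fun m => monomial m (1 : k)) '' (s.finsuppAntidiag d : Set (Fin r →₀ ℕ)))

instance (s : Finset (Fin r)) (d : ℕ) : Module.Finite k (formSpace k s d) :=
  Module.Finite.span_of_finite k ((Finset.finite_toSet _).image _)

theorem finrank_formSpace (s : Finset (Fin r)) (d : ℕ) :
    Module.finrank k (formSpace k s d) = s.card.multichoose d := by
  classical
  have hli : LinearIndependent k (fun m : (Fin r →₀ ℕ) => monomial m (1 : k)) := by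
    simpa using (basisMonomials (Fin r) k).linearIndependent
  have h2 := hli.comp ((↑) : s.finsuppAntidiag d → (Fin r →₀ ℕ)) Subtype.val_injective
  have := finrank_span_eq_card h2
  rw [Fintype.card_coe, Finset.card_finsuppAntidiag_nat_eq_multichoose] at this
  rw [← this, formSpace, Set.image_eq_range]
  rfl

theorem formSpace_univ (d : ℕ) :
    formSpace k (Finset.univ : Finset (Fin r)) d = homogeneousSubmodule (Fin r) k d := by
  have hdeg : ∀ m : Fin r →₀ ℕ, m ∈ Finset.univ.finsuppAntidiag d ↔ m.degree = d := by
    intro m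
    simp [Finset.mem_finsuppAntidiag, Finsupp.degree_eq_sum]
  refine le_antisymm (Submodule.span_le.2 ?_) fun f hf => ?_
  · rintro _ ⟨m, hm, rfl⟩
    exact isHomogeneous_monomial _ ((hdeg m).1 hm)
  · rw [f.as_sum]
    refine Submodule.sum_mem _ fun m hm => ?_
    have : m.degree = d := by
      by_contra h
      exact (mem_support_iff.1 hm) (IsHomogeneous.coeff_eq_zero hf h)
    rw [← mul_one (coeff m f), ← smul_eq_mul, ← smul_monomial]
    exact Submodule.smul_mem _ _ (Submodule.subset_span ⟨m, (hdeg m).2 this, rfl⟩)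

theorem formSpace_mono {s t : Finset (Fin r)} (h : s ⊆ t) (d : ℕ) :
    formSpace k s d ≤ formSpace k t d :=
  Submodule.span_mono (Set.image_mono (by exact_mod_cast Finset.finsuppAntidiag_mono h d))

theorem degreeOf_eq_zero_of_mem_formSpace {s : Finset (Fin r)} {d : ℕ} {i : Fin r} (hi : i ∉ s)
    {f : MvPolynomial (Fin r) k} (hf : f ∈ formSpace k s d) : degreeOf i f = 0 := by
  classical
  induction hf using Submodule.span_induction with
  | mem f hf =>
    obtain ⟨m, hm, rfl⟩ := hf
    rw [degreeOf_monomial_eq m i one_ne_zero]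
    have := (Finset.mem_finsuppAntidiag.1 hm).2
    by_contra h
    exact hi (this (Finsupp.mem_support_iff.2 h))
  | zero => simp
  | add f g _ _ hf hg => exact Nat.le_zero.1 ((degreeOf_add_le i f g).trans (by simp [hf, hg]))
  | smul a f _ hf =>
    rw [smul_eq_C_mul]
    exact Nat.le_zero.1 ((degreeOf_C_mul_le f i a).trans hf.le)

theorem exists_degreeOf_ne_zero {p : MvPolynomial (Fin r) k} (hp : Prime p) :
    ∃ i, degreeOf i p ≠ 0 := by
  by_contra! h
  have : p = C (coeff 0 p) := by
    rw [← totalDegree_eq_zero_iff_eq_C, totalDegree_eq_zero_iff]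
    intro m hm i
    have := monomial_le_degreeOf i hm
    rw [h i] at this
    exact Nat.le_zero.1 this
  have h0 : coeff 0 p ≠ 0 := fun h0 => hp.ne_zero (by rw [this, h0, C_0])
  exact hp.not_isUnit (this ▸ (isUnit_iff_ne_zero.2 h0).map C)

end FormSpace

section Colength

variable {R : Type*} [CommRing R] {N : Type*} [AddCommGroup N] [Module R N]

/-- The colength of a submodule (with value `0` if infinite). -/
noncomputable def colen (A : Submodule R N) : ℕ := (Module.length R (N ⧸ A)).toNat

theorem length_quotient_anti {A B : Submodule R N} (h : A ≤ B) :
    Module.length R (N ⧸ B) ≤ Module.length R (N ⧸ A) :=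
  Module.length_le_of_surjective (Submodule.factor h) (Submodule.factor_surjective h)

theorem coe_colen {A : Submodule R N} (hA : Module.length R (N ⧸ A) ≠ ⊤) :
    (colen A : ℕ∞) = Module.length R (N ⧸ A) := ENat.natCast_toNat hA

theorem colen_anti {A B : Submodule R N} (h : A ≤ B) (hA : Module.length R (N ⧸ A) ≠ ⊤) :
    colen B ≤ colen A :=
  ENat.toNat_le_toNat (length_quotient_anti h) hA

@[simp] theorem colen_top : colen (⊤ : Submodule R N) = 0 := by
  simp [colen, Module.length_eq_zero]

end Colength

section

variable {R : Type*} [CommRing R] [IsLocalRing R] {r : ℕ} (x : Fin r → R)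
variable {N : Type*} [AddCommGroup N] [Module R N]

/-- Reductions of the forms of degree `d` that map `v` into `gen x ^ d • V`. -/
def initSpace (V : Submodule R N) (v : N) (d : ℕ) :
    Submodule (ResidueField R) (MvPolynomial (Fin r) (ResidueField R)) where
  carrier := {g | ∃ f : MvPolynomial (Fin r) R, f.IsHomogeneous d ∧ red f = g ∧
    eval x f • v ∈ gen x ^ d • V}
  zero_mem' := ⟨0, isHomogeneous_zero _ _ _, by simp [red], by simp⟩
  add_mem' := by
    rintro _ _ ⟨f, hf, rfl, hfv⟩ ⟨g, hg, rfl, hgv⟩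
    exact ⟨f + g, hf.add hg, by simp [red], by simpa [add_smul] using add_mem hfv hgv⟩
  smul_mem' := by
    rintro c _ ⟨f, hf, rfl, hfv⟩
    obtain ⟨a, rfl⟩ := residue_surjective c
    refine ⟨C a * f, hf.C_mul a, ?_, ?_⟩
    · simp [red, smul_eq_C_mul]
    · simpa [mul_smul] using Submodule.smul_mem _ a hfv

theorem initSpace_le (V : Submodule R N) (v : N) (d : ℕ) :
    initSpace x V v d ≤ formSpace (ResidueField R) Finset.univ d := by
  rw [formSpace_univ]
  rintro _ ⟨f, hf, rfl, -⟩
  exact hf.map _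

instance (V : Submodule R N) (v : N) (d : ℕ) :
    Module.Finite (ResidueField R) (initSpace x V v d) :=
  Submodule.finiteDimensional_of_le (initSpace_le x V v d)

theorem eval_smul_mem_iff {V : Submodule R N} {v : N} (hm : ∀ a ∈ maximalIdeal R, a • v ∈ V)
    {d : ℕ} {f : MvPolynomial (Fin r) R} (hf : f.IsHomogeneous d) :
    eval x f • v ∈ gen x ^ d • V ↔ red f ∈ initSpace x V v d := by
  refine ⟨fun h => ⟨f, hf, rfl, h⟩, ?_⟩
  rintro ⟨g, hg, hgf, hgv⟩
  have := eval_smul_mem_of_red_eq_zero x (hf.sub hg) (by simp [red] at *; simp [hgf]) hm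
  simpa [sub_smul] using add_mem this hgv

theorem freeStep_iff {V : Submodule R N} {v : N} :
    FreeStep x V v ↔ ∀ d, initSpace x V v d = ⊥ := by
  refine ⟨fun h d => (Submodule.eq_bot_iff _).2 ?_, fun h d f hf hfv => ?_⟩
  · rintro _ ⟨f, hf, rfl, hfv⟩
    exact h d f hf hfv
  · have : red f ∈ initSpace x V v d := ⟨f, hf, rfl, hfv⟩
    rwa [h d, Submodule.mem_bot] at this

theorem length_add_finrank_initSpace {V : Submodule R N} {v : N}
    (hm : ∀ a ∈ maximalIdeal R, a • v ∈ V) (d : ℕ) :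
    Module.length R (N ⧸ gen x ^ d • V) + Module.finrank (ResidueField R) (initSpace x V v d) =
      Module.length R (N ⧸ gen x ^ d • (V ⊔ R ∙ v)) + (r.multichoose d : ℕ) := by
  set k := ResidueField R
  set Hk : Submodule k (MvPolynomial (Fin r) k) := formSpace k Finset.univ d with hHk
  set K : Submodule k Hk := (initSpace x V v d).comap Hk.subtype with hK
  let ψ : homogeneousSubmodule (Fin r) R d →ₗ[R] (N ⧸ gen x ^ d • V) :=
    (gen x ^ d • V).mkQ ∘ₗ (LinearMap.toSpanSingleton R N v) ∘ₗ
      (aeval (R := R) x).toLinearMap ∘ₗ (homogeneousSubmodule (Fin r) R d).subtype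
  have hψ : ∀ f, ψ f = (gen x ^ d • V).mkQ (eval x f.1 • v) := fun f => by
    simp [ψ]
  let ρ : homogeneousSubmodule (Fin r) R d →ₗ[R] Hk :=
    { toFun := fun f => ⟨red f.1, by rw [hHk, formSpace_univ]; exact f.2.map _⟩
      map_add' := fun f g => by ext1; simp [red]
      map_smul' := fun a f => by
        ext1
        simp only [SetLike.val_smul, red, RingHom.id_apply]
        rw [smul_eq_C_mul, map_mul, map_C, ← smul_eq_C_mul]
        exact (algebraMap_smul k a (red f.1)) }
  let χ : homogeneousSubmodule (Fin r) R d →ₗ[R] Hk ⧸ K :=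
    (K.mkQ.restrictScalars R) ∘ₗ ρ
  have hχ : Function.Surjective χ := by
    refine (Submodule.mkQ_surjective K).comp fun g => ?_
    obtain ⟨f, hf, hfg⟩ := exists_isHomogeneous_map_eq (residue R) residue_surjective
      (show g.1 ∈ homogeneousSubmodule (Fin r) k d by
        rw [← formSpace_univ]
        exact g.2)
    exact ⟨⟨f, hf⟩, Subtype.ext hfg⟩
  have hker : LinearMap.ker ψ = LinearMap.ker χ := by
    ext f
    rw [LinearMap.mem_ker, LinearMap.mem_ker, hψ, Submodule.mkQ_apply,
      Submodule.Quotient.mk_eq_zero, eval_smul_mem_iff x hm f.2]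
    simp [χ, ρ, K]
  have h1 : Module.length R (N ⧸ gen x ^ d • V) = Module.length R (Hk ⧸ K) +
      Module.length R (N ⧸ gen x ^ d • (V ⊔ R ∙ v)) := by
    have hle : gen x ^ d • V ≤ gen x ^ d • (V ⊔ R ∙ v) := Submodule.smul_mono le_rfl le_sup_left
    have e : (Hk ⧸ K) ≃ₗ[R] LinearMap.range ψ :=
      (χ.quotKerEquivOfSurjective hχ).symm ≪≫ₗ Submodule.quotEquivOfEq _ _ hker.symm ≪≫ₗ
        ψ.quotKerEquivRange
    rw [e.length_eq]
    refine Module.length_eq_add_of_exact (LinearMap.range ψ).subtype (Submodule.factor hle)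
      (Submodule.subtype_injective _) (Submodule.factor_surjective hle) ?_
    rw [LinearMap.exact_iff, Submodule.range_subtype]
    ext y
    obtain ⟨w, rfl⟩ := Submodule.mkQ_surjective _ y
    rw [LinearMap.mem_ker, Submodule.factor_mk, Submodule.mkQ_apply, Submodule.mkQ_apply,
      Submodule.Quotient.mk_eq_zero, mem_pow_smul_sup_span]
    constructor
    · rintro ⟨f, hf, hfw⟩
      refine ⟨⟨f, hf⟩, ?_⟩
      rw [hψ, Submodule.mkQ_apply]
      exact ((Submodule.Quotient.eq _).2 hfw).symm
    · rintro ⟨f, hf⟩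
      rw [hψ, Submodule.mkQ_apply] at hf
      exact ⟨f.1, f.2, (Submodule.Quotient.eq _).1 hf.symm⟩
  have h2 : Module.length R (Hk ⧸ K) = Module.finrank k (Hk ⧸ K) := by
    rw [Module.length_eq_of_surjective (R := k) (S := R) (M := Hk ⧸ K) residue_surjective,
      Module.length_eq_finrank]
  have h3 : Module.finrank k (Hk ⧸ K) + Module.finrank k (initSpace x V v d) =
      r.multichoose d := by
    have h4 := Submodule.finrank_quotient_add_finrank K
    have h5 : Module.finrank k Hk = r.multichoose d := by
      rw [hHk, finrank_formSpace, Finset.card_univ, Fintype.card_fin]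
    rw [← h5, ← h4, LinearEquiv.finrank_eq (Submodule.comapSubtypeEquivOfLe (initSpace_le x V v d))]
  rw [h1, h2, add_comm (Nat.cast _), add_assoc, ← h3]
  push_cast
  rfl

theorem not_pow_succ_le (s n₀ K : ℕ) (h : ∀ n ≥ n₀, (n + 1) ^ (s + 1) ≤ K * (n + 1) ^ s) : False := by
  have := h (n₀ + K) (by omega)
  rw [pow_succ, mul_comm] at this
  have := Nat.le_of_mul_le_mul_right this (by positivity)
  omega

end

section

variable {R : Type*} [CommRing R] [IsLocalRing R] {N : Type*} [AddCommGroup N] [Module R N]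

theorem length_le_length_sup_add_one {V : Submodule R N} {v : N}
    (hm : ∀ a ∈ maximalIdeal R, a • v ∈ V) :
    Module.length R (N ⧸ V) ≤ Module.length R (N ⧸ (V ⊔ R ∙ v)) + 1 := by
  have h := length_add_finrank_initSpace (fun i : Fin 0 => i.elim0) hm 0
  rw [pow_zero, Ideal.one_eq_top, Submodule.top_smul, Submodule.top_smul] at h
  calc _ ≤ _ := le_self_add
    _ = _ := h
    _ = _ := by simp

theorem length_quotient_ne_top [IsNoetherian R N] {A : Submodule R N}
    (hA : ∃ k, maximalIdeal R ^ k • (⊤ : Submodule R N) ≤ A) :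
    Module.length R (N ⧸ A) ≠ ⊤ := by
  refine exists_maximal_of_step (B := ⊤)
    (P := fun V => Module.length R (N ⧸ V) ≠ ⊤ → Module.length R (N ⧸ A) ≠ ⊤) hA le_top id ?_ ?_
  · intro V v _ hV _ _ hm h
    refine hV (ne_top_of_le_ne_top ?_ (length_le_length_sup_add_one hm))
    simpa using h
  · rw [Module.length_eq_zero]
    simp

end

section

variable {R : Type*} [CommRing R] {r : ℕ} (x : Fin r → R)
variable {N : Type*} [AddCommGroup N] [Module R N]

/-- The number of composition factors between the filtrations `gen x ^ d • A` and
`gen x ^ d • B`, up to degree `n`. -/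
noncomputable def relCount (A B : Submodule R N) (n : ℕ) : ℤ :=
  ∑ d ∈ Finset.range (n + 1), ((colen (gen x ^ d • A) : ℤ) - colen (gen x ^ d • B))

theorem relCount_self (A : Submodule R N) (n : ℕ) : relCount x A A n = 0 := by
  simp [relCount]

theorem relCount_add (A B C : Submodule R N) (n : ℕ) :
    relCount x A B n + relCount x B C n = relCount x A C n := by
  simp [relCount]

theorem relCount_gen_top (n : ℕ) :
    relCount x (gen x • ⊤ : Submodule R N) ⊤ n =
      colen (gen x ^ (n + 1) • (⊤ : Submodule R N)) := by
  have : ∀ d : ℕ, gen x ^ d • gen x • (⊤ : Submodule R N) = gen x ^ (d + 1) • ⊤ := fun d => by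
    rw [pow_succ, Submodule.mul_smul]
  simp_rw [relCount, this]
  rw [Finset.sum_range_sub (fun d => (colen (gen x ^ d • (⊤ : Submodule R N)) : ℤ))]
  simp

variable [IsLocalRing R]

theorem freeStep_iff_finrank {V : Submodule R N} {v : N} :
    FreeStep x V v ↔ ∀ d, Module.finrank (ResidueField R) (initSpace x V v d) = 0 := by
  simp_rw [freeStep_iff, Submodule.finrank_eq_zero]

theorem mul_mem_initSpace {V : Submodule R N} {v : N} {d e : ℕ}
    {f g : MvPolynomial (Fin r) (ResidueField R)} (hf : f ∈ initSpace x V v d)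
    (hg : g.IsHomogeneous e) : f * g ∈ initSpace x V v (d + e) := by
  obtain ⟨F, hF, rfl, hFv⟩ := hf
  obtain ⟨G, hG, rfl⟩ := exists_isHomogeneous_map_eq (residue R) residue_surjective hg
  refine ⟨F * G, hF.mul hG, by simp [red], ?_⟩
  rw [mul_comm, map_mul, mul_smul, add_comm]
  exact eval_smul_mem x hG hFv

theorem multichoose_le_finrank_initSpace {V : Submodule R N} {v : N} {d : ℕ}
    {f : MvPolynomial (Fin r) (ResidueField R)} (hf : f ∈ initSpace x V v d) (h0 : f ≠ 0) (e : ℕ) :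
    r.multichoose e ≤ Module.finrank (ResidueField R) (initSpace x V v (d + e)) := by
  have h := finrank_formSpace (ResidueField R) (Finset.univ : Finset (Fin r)) e
  rw [Finset.card_univ, Fintype.card_fin] at h
  rw [← h]
  let φ : formSpace (ResidueField R) (Finset.univ : Finset (Fin r)) e →ₗ[ResidueField R]
      initSpace x V v (d + e) :=
    ((LinearMap.mulLeft (ResidueField R) f) ∘ₗ Submodule.subtype _).codRestrict _ fun g =>
      mul_mem_initSpace x hf (show g.1 ∈ homogeneousSubmodule _ _ e by
        rw [← formSpace_univ]
        exact g.2)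
  refine LinearMap.finrank_le_finrank_of_injective (f := φ) fun g g' hgg' => ?_
  have : f * g.1 = f * g'.1 := congrArg Subtype.val hgg'
  exact Subtype.ext (mul_left_cancel₀ h0 this)

theorem finrank_initSpace_add_le_of_not_big {s : ℕ} (x : Fin (s + 1) → R) {V : Submodule R N} {v : N}
    (h : ¬ Big {y : ℕ × MvPolynomial (Fin (s + 1)) R | eval x y.2 • v ∈ gen x ^ y.1 • V}) (d : ℕ) :
    Module.finrank (ResidueField R) (initSpace x V v d) + s.multichoose d ≤
      (s + 1).multichoose d := by
  classical
  simp only [Big, not_forall, not_exists, not_and, not_not] at h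
  obtain ⟨p, hp, hdvd⟩ := h
  obtain ⟨i, hi⟩ := exists_degreeOf_ne_zero _ hp
  have hdisj : initSpace x V v d ⊓ formSpace (ResidueField R) (Finset.univ.erase i) d = ⊥ := by
    refine (Submodule.eq_bot_iff _).2 ?_
    rintro _ ⟨⟨f, hf, rfl, hfv⟩, hg⟩
    by_contra h0
    obtain ⟨c, hc⟩ := hdvd (d, f) hfv hf
    have hd := degreeOf_eq_zero_of_mem_formSpace _ (Finset.notMem_erase i _) hg
    have hc0 : c ≠ 0 := by
      rintro rfl
      exact h0 (by simpa using hc)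
    change red f = _ at hc
    rw [hc, degreeOf_mul_eq hp.ne_zero hc0] at hd
    omega
  have h1 := Submodule.finrank_sup_add_finrank_inf_eq (initSpace x V v d)
    (formSpace (ResidueField R) (Finset.univ.erase i) d)
  rw [hdisj, finrank_bot, finrank_formSpace, Finset.card_erase_of_mem (Finset.mem_univ _),
    Finset.card_univ, Fintype.card_fin, add_zero, Nat.add_sub_cancel] at h1
  rw [← h1]
  have h2 := Submodule.finrank_mono (sup_le (initSpace_le x V v d)
    (formSpace_mono (ResidueField R) (Finset.erase_subset i Finset.univ) d))
  rwa [finrank_formSpace, Finset.card_univ, Fintype.card_fin] at h2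

theorem exists_pow_le_gen_pow (hfin : ∃ k, maximalIdeal R ^ k • (⊤ : Submodule R N) ≤ gen x • ⊤)
    (n : ℕ) : ∃ k, maximalIdeal R ^ k • (⊤ : Submodule R N) ≤ gen x ^ n • ⊤ := by
  obtain ⟨k, hk⟩ := hfin
  induction n with
  | zero => exact ⟨0, by simp⟩
  | succ n ih =>
    obtain ⟨l, hl⟩ := ih
    refine ⟨k + l, ?_⟩
    calc _ = maximalIdeal R ^ k • maximalIdeal R ^ l • (⊤ : Submodule R N) := by
          rw [pow_add, Submodule.mul_smul]
      _ ≤ maximalIdeal R ^ k • gen x ^ n • ⊤ := Submodule.smul_mono le_rfl hl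
      _ = gen x ^ n • maximalIdeal R ^ k • ⊤ := by
          rw [← Submodule.mul_smul, mul_comm, Submodule.mul_smul]
      _ ≤ gen x ^ n • gen x • ⊤ := Submodule.smul_mono le_rfl hk
      _ = _ := by rw [← Submodule.mul_smul, pow_succ]

theorem length_pow_smul_ne_top [IsNoetherian R N]
    (hfin : ∃ k, maximalIdeal R ^ k • (⊤ : Submodule R N) ≤ gen x • ⊤)
    {V : Submodule R N} (hV : gen x • ⊤ ≤ V) (n : ℕ) :
    Module.length R (N ⧸ gen x ^ n • V) ≠ ⊤ := by
  obtain ⟨k, hk⟩ := exists_pow_le_gen_pow x hfin (n + 1)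
  refine length_quotient_ne_top ⟨k, hk.trans ?_⟩
  rw [pow_succ, Submodule.mul_smul]
  exact Submodule.smul_mono le_rfl hV

variable [IsNoetherian R N]

theorem relCount_step (hfin : ∃ k, maximalIdeal R ^ k • (⊤ : Submodule R N) ≤ gen x • ⊤)
    {V : Submodule R N} {v : N} (hV : gen x • ⊤ ≤ V) (hm : ∀ a ∈ maximalIdeal R, a • v ∈ V)
    (n : ℕ) :
    relCount x V (V ⊔ R ∙ v) n + ∑ d ∈ Finset.range (n + 1),
      (Module.finrank (ResidueField R) (initSpace x V v d) : ℤ) = ((r + 1).multichoose n : ℕ) := by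
  rw [← sum_multichoose, Nat.cast_sum, relCount, ← Finset.sum_add_distrib]
  refine Finset.sum_congr rfl fun d _ => ?_
  have h := length_add_finrank_initSpace x hm d
  rw [← coe_colen (length_pow_smul_ne_top x hfin hV d),
    ← coe_colen (length_pow_smul_ne_top x hfin (hV.trans le_sup_left) d)] at h
  have h' : colen (gen x ^ d • V) + Module.finrank (ResidueField R) (initSpace x V v d) =
    colen (gen x ^ d • (V ⊔ R ∙ v)) + r.multichoose d := by exact_mod_cast h
  zify at h'
  linarith

theorem relCount_nonneg (hfin : ∃ k, maximalIdeal R ^ k • (⊤ : Submodule R N) ≤ gen x • ⊤)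
    {A B : Submodule R N} (hA : gen x • ⊤ ≤ A) (hAB : A ≤ B) (n : ℕ) : 0 ≤ relCount x A B n :=
  Finset.sum_nonneg fun d _ => sub_nonneg.2 (by
    exact_mod_cast colen_anti (Submodule.smul_mono le_rfl hAB) (length_pow_smul_ne_top x hfin hA d))

theorem relCount_step_le_of_not_freeStep {s : ℕ} (x : Fin (s + 1) → R)
    (hfin : ∃ k, maximalIdeal R ^ k • (⊤ : Submodule R N) ≤ gen x • ⊤)
    {V : Submodule R N} {v : N} (hV : gen x • ⊤ ≤ V) (hm : ∀ a ∈ maximalIdeal R, a • v ∈ V)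
    (h : ¬ FreeStep x V v) :
    ∃ K : ℕ, ∀ n, relCount x V (V ⊔ R ∙ v) n ≤ (K * (n + 1) ^ s : ℕ) := by
  rw [freeStep_iff] at h
  push Not at h
  obtain ⟨d₀, hd₀⟩ := h
  obtain ⟨f, hf, hf0⟩ := Submodule.exists_mem_ne_zero_of_ne_bot hd₀
  refine ⟨d₀, fun n => ?_⟩
  have h1 := relCount_step x hfin hV hm n
  have h2 : ∑ d ∈ Finset.range (n + 1), (if d₀ ≤ d then (s + 1).multichoose (d - d₀) else 0) ≤
      ∑ d ∈ Finset.range (n + 1), Module.finrank (ResidueField R) (initSpace x V v d) := by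
    refine Finset.sum_le_sum fun d _ => ?_
    split_ifs with hd
    · obtain ⟨e, rfl⟩ := Nat.exists_eq_add_of_le hd
      simpa using multichoose_le_finrank_initSpace x hf hf0 e
    · exact Nat.zero_le _
  have h3 := sum_multichoose_shift s d₀ n
  rw [sum_multichoose] at h3
  have h4 := Nat.mul_le_mul_left d₀ (multichoose_le_pow s n)
  zify at h1 h2 h3 h4 ⊢
  linarith

theorem multichoose_le_relCount_step {s : ℕ} (x : Fin (s + 1) → R)
    (hfin : ∃ k, maximalIdeal R ^ k • (⊤ : Submodule R N) ≤ gen x • ⊤)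
    {V : Submodule R N} {v : N} (hV : gen x • ⊤ ≤ V) (hm : ∀ a ∈ maximalIdeal R, a • v ∈ V)
    (h : ¬ Big {y : ℕ × MvPolynomial (Fin (s + 1)) R | eval x y.2 • v ∈ gen x ^ y.1 • V}) (n : ℕ) :
    ((s + 1).multichoose n : ℕ) ≤ relCount x V (V ⊔ R ∙ v) n := by
  have h1 := relCount_step x hfin hV hm n
  have h2 := Finset.sum_le_sum fun d (_ : d ∈ Finset.range (n + 1)) =>
    finrank_initSpace_add_le_of_not_big x h d
  rw [Finset.sum_add_distrib, sum_multichoose, sum_multichoose] at h2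
  zify at h1 h2 ⊢
  linarith

theorem exists_relCount_bounds {s : ℕ} (x : Fin (s + 1) → R)
    (hfin : ∃ k, maximalIdeal R ^ k • (⊤ : Submodule R N) ≤ gen x • ⊤)
    {A B : Submodule R N} (hA : gen x • ⊤ ≤ A) (hAB : A ≤ B) :
    ∃ b K : ℕ, ∀ n, (b * (s + 2).multichoose n : ℕ) ≤ relCount x A B n ∧
      relCount x A B n ≤ (b * (s + 2).multichoose n + K * (n + 1) ^ s : ℕ) := by
  obtain ⟨k, hk⟩ := hfin
  refine exists_maximal_of_step (P := fun V => ∃ b K : ℕ, ∀ n,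
    (b * (s + 2).multichoose n : ℕ) ≤ relCount x A V n ∧
      relCount x A V n ≤ (b * (s + 2).multichoose n + K * (n + 1) ^ s : ℕ))
    ⟨k, hk.trans hA⟩ hAB ⟨0, 0, fun n => by simp [relCount_self]⟩ ?_
  rintro V v hAV ⟨b, K, hb⟩ _ _ hm
  have hV := hA.trans hAV
  by_cases hfree : FreeStep x V v
  · refine ⟨b + 1, K, fun n => ?_⟩
    have h1 := relCount_step x ⟨k, hk⟩ hV hm n
    rw [freeStep_iff_finrank] at hfree
    simp only [hfree, Nat.cast_zero, Finset.sum_const_zero, add_zero] at h1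
    rw [← relCount_add x A V, h1, add_mul, one_mul]
    have := hb n
    push_cast at this ⊢
    constructor <;> linarith
  · obtain ⟨K', hK'⟩ := relCount_step_le_of_not_freeStep x ⟨k, hk⟩ hV hm hfree
    refine ⟨b, K + K', fun n => ?_⟩
    rw [← relCount_add x A V, add_mul]
    have h1 := hb n
    have h2 := hK' n
    have h3 := relCount_nonneg x ⟨k, hk⟩ hV (le_sup_left (b := R ∙ v)) n
    push_cast at h1 h2 ⊢
    constructor <;> linarith

theorem stepDichotomy_of_bounds {s : ℕ} (x : Fin (s + 2) → R)
    (hfin : ∃ k, maximalIdeal R ^ k • (⊤ : Submodule R N) ≤ gen x • ⊤) (e : ℤ) (n₀ K K' : ℕ)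
    (hle : ∀ n ≥ n₀, (colen (gen x ^ (n + 1) • (⊤ : Submodule R N)) : ℤ) ≤
      e * (s + 3).multichoose n + K * (n + 1) ^ s)
    (hge : ∀ n ≥ n₀, e * (s + 3).multichoose n ≤
      colen (gen x ^ (n + 1) • (⊤ : Submodule R N)) + K' * (n + 1) ^ (s + 1)) :
    StepDichotomy x N := by
  intro V v hV hv hm hnf
  by_contra hbig
  obtain ⟨b₁, K₁, h₁⟩ := exists_relCount_bounds x hfin le_rfl hV
  obtain ⟨b₂, K₂, h₂⟩ := exists_relCount_bounds x hfin (hV.trans le_sup_left)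
    (le_top : V ⊔ R ∙ v ≤ ⊤)
  obtain ⟨K₃, h₃⟩ := relCount_step_le_of_not_freeStep x hfin hV hm hnf
  have h₄ := multichoose_le_relCount_step x hfin hV hm hbig
  have htot : ∀ n, (colen (gen x ^ (n + 1) • (⊤ : Submodule R N)) : ℤ) =
      relCount x (gen x • ⊤) V n + relCount x V (V ⊔ R ∙ v) n + relCount x (V ⊔ R ∙ v) ⊤ n :=
    fun n => by rw [relCount_add, relCount_add, relCount_gen_top]
  have heb : e ≤ b₁ + b₂ := by
    by_contra! hlt
    refine not_pow_succ_le (s + 1) n₀ ((s + 2).factorial * (K' + K₁ + K₂ + K₃)) fun n hn => ?_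
    have g₁ := hge n hn
    rw [htot] at g₁
    have g₂ := (h₁ n).2
    have g₃ := (h₂ n).2
    have g₄ := h₃ n
    have g₅ := pow_le_factorial_mul_multichoose (s + 2) n
    have g₆ : ((s + 3).multichoose n : ℤ) ≤ (K' + K₁ + K₂ + K₃) * (n + 1) ^ (s + 1) := by
      push_cast at g₁ g₂ g₃ g₄
      have : (b₁ + b₂ + 1 : ℤ) * (s + 3).multichoose n ≤ e * (s + 3).multichoose n :=
        mul_le_mul_of_nonneg_right (by omega) (by positivity)
      nlinarith
    have g₇ : (s + 3).multichoose n ≤ (K' + K₁ + K₂ + K₃) * (n + 1) ^ (s + 1) := by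
      exact_mod_cast g₆
    calc _ ≤ _ := g₅
      _ ≤ _ := Nat.mul_le_mul_left _ g₇
      _ = _ := by ring
  refine not_pow_succ_le s n₀ ((s + 1).factorial * K) fun n hn => ?_
  have g₁ := hle n hn
  rw [htot] at g₁
  have g₂ := (h₁ n).1
  have g₃ := (h₂ n).1
  have g₄ := h₄ n
  have g₅ := pow_le_factorial_mul_multichoose (s + 1) n
  have g₆ : ((s + 2).multichoose n : ℤ) ≤ K * (n + 1) ^ s := by
    push_cast at g₁ g₂ g₃ g₄
    have : e * (s + 3).multichoose n ≤ (b₁ + b₂ : ℤ) * (s + 3).multichoose n :=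
      mul_le_mul_of_nonneg_right heb (by positivity)
    nlinarith
  have g₇ : (s + 2).multichoose n ≤ K * (n + 1) ^ s := by exact_mod_cast g₆
  calc _ ≤ _ := g₅
    _ ≤ _ := Nat.mul_le_mul_left _ g₇
    _ = _ := by ring

/-- The lengths of `N ⧸ gen x ^ (n + 1) • N` are as large as possible. -/
def ExactLength {r : ℕ} (x : Fin r → R) (N : Type*) [AddCommGroup N] [Module R N] : Prop :=
  ∀ n, colen (gen x ^ (n + 1) • (⊤ : Submodule R N)) =
    colen (gen x • (⊤ : Submodule R N)) * (r + 1).multichoose n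

theorem colen_sup_add_one (hfin : ∃ k, maximalIdeal R ^ k • (⊤ : Submodule R N) ≤ gen x • ⊤)
    {V : Submodule R N} {v : N} (hV : gen x • ⊤ ≤ V) (hv : v ∉ V)
    (hm : ∀ a ∈ maximalIdeal R, a • v ∈ V) : colen (V ⊔ R ∙ v) + 1 = colen V := by
  have h := relCount_step x hfin hV hm 0
  have h0 : initSpace x V v 0 = ⊥ := by
    refine (Submodule.eq_bot_iff _).2 ?_
    rintro _ ⟨f, hf, rfl, hfv⟩
    rw [← mem_homogeneousSubmodule, homogeneousSubmodule_zero, Submodule.mem_one] at hf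
    obtain ⟨a, rfl⟩ := hf
    have ha : a ∈ maximalIdeal R := by
      by_contra ha
      rw [mem_maximalIdeal, mem_nonunits_iff, not_not] at ha
      have : a • v ∈ V := by simpa using hfv
      exact hv ((Submodule.smul_mem_iff_of_isUnit _ ha).1 this)
    have : residue R a = 0 := (residue_eq_zero_iff a).2 ha
    simp [red, algebraMap_eq, this]
  simp [relCount, Submodule.finrank_eq_zero.2 h0] at h
  omega

theorem FreeChain.exactLength
    (hfin : ∃ k, maximalIdeal R ^ k • (⊤ : Submodule R N) ≤ gen x • ⊤)
    (h : FreeChain x (gen x • ⊤ : Submodule R N) ⊤) : ExactLength x N := by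
  intro n
  have key : ∀ B : Submodule R N, FreeChain x (gen x • ⊤ : Submodule R N) B →
      relCount x (gen x • ⊤) B n + colen B * ((r + 1).multichoose n : ℕ) =
        colen (gen x • ⊤ : Submodule R N) * ((r + 1).multichoose n : ℕ) := by
    intro B hB
    induction hB with
    | refl => simp [relCount_self]
    | step V v hc hv hm hfree ih =>
      have h1 := relCount_step x hfin hc.le hm n
      rw [freeStep_iff_finrank] at hfree
      simp only [hfree, Nat.cast_zero, Finset.sum_const_zero, add_zero] at h1
      rw [← relCount_add x _ V, h1, ← ih, ← colen_sup_add_one x hfin hc.le hv hm]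
      push_cast
      ring
  have := key _ h
  rw [relCount_gen_top] at this
  simp at this
  exact_mod_cast this

theorem ExactLength.freeChain
    (hfin : ∃ k, maximalIdeal R ^ k • (⊤ : Submodule R N) ≤ gen x • ⊤)
    (h : ExactLength x N) : FreeChain x (gen x • ⊤ : Submodule R N) ⊤ := by
  have key := exists_maximal_of_step (N := N) (B := ⊤) (P := fun V =>
    (∀ n, relCount x (gen x • ⊤) V n + colen V * ((r + 1).multichoose n : ℕ) ≤
        colen (gen x • ⊤ : Submodule R N) * ((r + 1).multichoose n : ℕ)) ∧
      ((∀ n, relCount x (gen x • ⊤) V n + colen V * ((r + 1).multichoose n : ℕ) =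
        colen (gen x • ⊤ : Submodule R N) * ((r + 1).multichoose n : ℕ)) →
        FreeChain x (gen x • ⊤ : Submodule R N) V)) hfin le_top
        ⟨fun n => by simp [relCount_self], fun _ => FreeChain.refl⟩ ?_
  · refine key.2 fun n => ?_
    rw [relCount_gen_top, h n]
    simp
  · rintro V v hV ⟨hle, heq⟩ _ hv hm
    have hstep : ∀ n, relCount x (gen x • ⊤) (V ⊔ R ∙ v) n +
        colen (V ⊔ R ∙ v) * ((r + 1).multichoose n : ℕ) +
        ∑ d ∈ Finset.range (n + 1),
          (Module.finrank (ResidueField R) (initSpace x V v d) : ℤ) =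
        relCount x (gen x • ⊤) V n + colen V * ((r + 1).multichoose n : ℕ) := fun n => by
      have := relCount_step x hfin hV hm n
      rw [← relCount_add x _ V, ← colen_sup_add_one x hfin hV hv hm]
      push_cast
      linarith
    have hnn : ∀ n, (0 : ℤ) ≤ ∑ d ∈ Finset.range (n + 1),
          (Module.finrank (ResidueField R) (initSpace x V v d) : ℤ) := fun n =>
      Finset.sum_nonneg fun _ _ => by positivity
    refine ⟨fun n => by linarith [hle n, hstep n, hnn n], fun he => ?_⟩
    refine FreeChain.step V v (heq fun n => ?_) hv hm ?_
    · exact le_antisymm (hle n) (by linarith [he n, hstep n, hnn n])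
    · rw [freeStep_iff_finrank]
      intro d
      have h0 : ∑ d ∈ Finset.range (d + 1),
          (Module.finrank (ResidueField R) (initSpace x V v d) : ℤ) = 0 :=
        le_antisymm (by linarith [he d, hstep d, hle d]) (hnn d)
      rw [Finset.sum_eq_zero_iff_of_nonneg fun _ _ => by positivity] at h0
      exact_mod_cast h0 d (by simp)

end

open RingTheory.Sequence
open scoped Pointwise

section

variable {R : Type*} [CommRing R] {N : Type*} [AddCommGroup N] [Module R N]

theorem mkQ_mem_smul_top_iff {A : Submodule R N} {I : Ideal R} {w : N} :
    A.mkQ w ∈ I • (⊤ : Submodule R (N ⧸ A)) ↔ w ∈ I • ⊤ ⊔ A := by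
  rw [← Submodule.range_mkQ A, ← Submodule.map_top, ← Submodule.map_smul'', ← Submodule.mem_comap,
    Submodule.comap_map_mkQ, sup_comm]

theorem sup_span_pow_smul_top_quotSMulTop (a : R) (J : Ideal R) (n : ℕ) :
    (Ideal.span {a} ⊔ J) ^ n • (⊤ : Submodule R (QuotSMulTop a N)) = J ^ n • ⊤ := by
  have h : ∀ W : Submodule R (QuotSMulTop a N), (Ideal.span {a} ⊔ J) • W = J • W := by
    intro W
    rw [Submodule.sup_smul, sup_eq_right, Submodule.ideal_span_singleton_smul]
    rintro _ ⟨w, -, rfl⟩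
    obtain ⟨w, rfl⟩ := Submodule.mkQ_surjective _ w
    have : (a • ⊤ : Submodule R N).mkQ (a • w) = 0 := by
      rw [Submodule.mkQ_apply, Submodule.Quotient.mk_eq_zero]
      exact Submodule.smul_mem_pointwise_smul _ _ _ trivial
    rw [map_smul] at this
    change a • (a • ⊤ : Submodule R N).mkQ w ∈ _
    rw [this]
    exact zero_mem _
  induction n with
  | zero => simp
  | succ n ih => rw [pow_succ', pow_succ', Submodule.mul_smul, Submodule.mul_smul, ih, h]

variable {a : R} {I : Ideal R}

theorem length_quotient_pow_succ_aux (n : ℕ) :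
    ∃ φ : N →ₗ[R] N ⧸ I ^ (n + 1) • (⊤ : Submodule R N),
      (∀ w, φ w = 0 ↔ a • w ∈ I ^ (n + 1) • (⊤ : Submodule R N)) ∧
      Module.length R (N ⧸ I ^ (n + 1) • (⊤ : Submodule R N)) =
        Module.length R (N ⧸ LinearMap.ker φ) +
          Module.length R (QuotSMulTop a N ⧸ I ^ (n + 1) • (⊤ : Submodule R (QuotSMulTop a N))) := by
  set A : Submodule R N := I ^ (n + 1) • ⊤
  set A' : Submodule R (QuotSMulTop a N) := I ^ (n + 1) • ⊤
  set π := (a • ⊤ : Submodule R N).mkQ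
  let φ : N →ₗ[R] N ⧸ A := A.mkQ ∘ₗ LinearMap.lsmul R N a
  have hle : A ≤ A'.comap π := fun w hw => by
    rw [Submodule.mem_comap, mkQ_mem_smul_top_iff]
    exact Submodule.mem_sup_left hw
  refine ⟨φ, fun w => Submodule.Quotient.mk_eq_zero A, ?_⟩
  rw [φ.quotKerEquivRange.length_eq]
  refine Module.length_eq_add_of_exact (LinearMap.range φ).subtype (Submodule.mapQ A A' π hle)
    (Submodule.subtype_injective _) ?_ ?_
  · intro y
    obtain ⟨y, rfl⟩ := A'.mkQ_surjective y
    obtain ⟨w, rfl⟩ := Submodule.mkQ_surjective _ y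
    exact ⟨A.mkQ w, rfl⟩
  · rw [LinearMap.exact_iff, Submodule.range_subtype]
    ext y
    obtain ⟨w, rfl⟩ := A.mkQ_surjective y
    rw [LinearMap.mem_ker]
    change Submodule.Quotient.mk (π w) = 0 ↔ _
    rw [Submodule.Quotient.mk_eq_zero, mkQ_mem_smul_top_iff, Submodule.mem_sup]
    constructor
    · rintro ⟨u, hu, _, ⟨z, -, rfl⟩, rfl⟩
      refine ⟨z, ?_⟩
      change A.mkQ (a • z) = A.mkQ (u + a • z)
      rw [map_add, (Submodule.Quotient.mk_eq_zero A).2 hu |> (A.mkQ_apply u).trans, zero_add]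
    · rintro ⟨z, hz⟩
      refine ⟨w - a • z, (Submodule.Quotient.eq A).1 hz.symm, a • z,
        Submodule.smul_mem_pointwise_smul _ _ _ trivial, by simp⟩

theorem length_quotient_pow_succ_le (ha : a ∈ I) (n : ℕ) :
    Module.length R (N ⧸ I ^ (n + 1) • (⊤ : Submodule R N)) ≤
      Module.length R (N ⧸ I ^ n • (⊤ : Submodule R N)) +
        Module.length R (QuotSMulTop a N ⧸ I ^ (n + 1) • (⊤ : Submodule R (QuotSMulTop a N))) := by
  obtain ⟨φ, hφ, h⟩ := length_quotient_pow_succ_aux (N := N) (a := a) (I := I) n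
  rw [h]
  refine add_le_add_left (length_quotient_anti fun w hw => ?_) _
  rw [LinearMap.mem_ker, hφ, pow_succ', Submodule.mul_smul]
  exact Submodule.smul_mem_smul ha hw

theorem length_quotient_pow_succ_eq (ha : a ∈ I) (n : ℕ)
    (hreg : ∀ w : N, a • w ∈ I ^ (n + 1) • (⊤ : Submodule R N) → w ∈ I ^ n • (⊤ : Submodule R N)) :
    Module.length R (N ⧸ I ^ (n + 1) • (⊤ : Submodule R N)) =
      Module.length R (N ⧸ I ^ n • (⊤ : Submodule R N)) +
        Module.length R (QuotSMulTop a N ⧸ I ^ (n + 1) • (⊤ : Submodule R (QuotSMulTop a N))) := by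
  obtain ⟨φ, hφ, h⟩ := length_quotient_pow_succ_aux (N := N) (a := a) (I := I) n
  have : LinearMap.ker φ = I ^ n • ⊤ := by
    ext w
    rw [LinearMap.mem_ker, hφ]
    refine ⟨hreg w, fun hw => ?_⟩
    rw [pow_succ', Submodule.mul_smul]
    exact Submodule.smul_mem_smul ha hw
  rw [h, this]

theorem sup_pow_succ_le (B J : Ideal R) (n : ℕ) :
    (B ⊔ J) ^ (n + 1) ≤ B * (B ⊔ J) ^ n ⊔ J ^ (n + 1) := by
  induction n with
  | zero => simp
  | succ n ih =>
    rw [pow_succ, Ideal.mul_sup]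
    refine sup_le (le_sup_of_le_left (by rw [mul_comm])) ?_
    calc _ ≤ (B * (B ⊔ J) ^ n ⊔ J ^ (n + 1)) * J := Ideal.mul_mono_left ih
      _ = B * ((B ⊔ J) ^ n * J) ⊔ J ^ (n + 2) := by rw [Ideal.sup_mul, mul_assoc, ← pow_succ]
      _ ≤ _ := by
        refine sup_le_sup_right ?_ _
        rw [pow_succ (B ⊔ J)]
        exact Ideal.mul_mono_right (Ideal.mul_mono_right le_sup_right)

theorem mem_sup_span_pow_smul {b : R} {J : Ideal R} {n : ℕ} {w : N}
    (hw : w ∈ (Ideal.span {b} ⊔ J) ^ (n + 1) • (⊤ : Submodule R N)) :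
    ∃ u ∈ (Ideal.span {b} ⊔ J) ^ n • (⊤ : Submodule R N), w - b • u ∈ J ^ (n + 1) • (⊤ : Submodule R N) := by
  have := Submodule.smul_mono_left (sup_pow_succ_le _ _ _) hw
  rw [Submodule.sup_smul, Submodule.mul_smul, Submodule.ideal_span_singleton_smul,
    Submodule.mem_sup] at this
  obtain ⟨_, ⟨u, hu, rfl⟩, z, hz, rfl⟩ := this
  exact ⟨u, hu, by simpa using hz⟩

end

section

variable {R : Type*} [CommRing R] [IsLocalRing R] [IsNoetherianRing R]

theorem mem_pow_smul_of_isRegular_cons {a : R} {rs : List R} {N : Type*} [AddCommGroup N]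
    [Module R N] [Module.Finite R N] (h : IsRegular N (a :: rs)) (n : ℕ) (w : N)
    (hw : a • w ∈ Ideal.ofList rs ^ n • (⊤ : Submodule R N)) :
    w ∈ Ideal.ofList rs ^ n • (⊤ : Submodule R N) := by
  induction rs generalizing N a n with
  | nil =>
    rcases n with _ | n
    · simp
    · have h1 := ((isRegular_cons_iff _ _ _).1 h).1
      rw [Ideal.ofList_nil, pow_succ, Ideal.mul_bot, Submodule.bot_smul, Submodule.mem_bot] at hw ⊢
      exact h1 (by simpa using hw)
  | cons b rs ih =>
    rw [Ideal.ofList_cons] at hw ⊢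
    have hb : IsRegular N (b :: rs) := by
      have h1 : IsRegular N ((b :: rs) ++ [a]) :=
        IsLocalRing.isRegular_of_perm h (List.perm_append_singleton a (b :: rs)).symm
      have : Nontrivial N := h1.nontrivial
      rw [IsLocalRing.isRegular_iff_isWeaklyRegular_of_subset_maximalIdeal]
      · exact ((isWeaklyRegular_append_iff N _ _).1 h1.toIsWeaklyRegular).1
      · intro c hc
        refine IsLocalRing.le_maximalIdeal ?_ (Ideal.subset_span (s := {r | r ∈ b :: rs ++ [a]})
          (List.mem_append_left _ hc))
        intro ht
        exact h1.top_ne_smul (by rw [Ideal.ofList, ht, Submodule.top_smul])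
    have hab : IsRegular (QuotSMulTop b N) (a :: rs) :=
      ((isRegular_cons_iff _ _ _).1 (IsLocalRing.isRegular_of_perm h (List.Perm.swap b a rs))).2
    induction n generalizing w with
    | zero => simp
    | succ n ihn =>
      obtain ⟨u, hu, hwu⟩ := mem_sup_span_pow_smul hw
      have h1 := ih hab (n + 1) ((b • ⊤ : Submodule R N).mkQ w) (by
        rw [← map_smul, mkQ_mem_smul_top_iff, Submodule.mem_sup]
        exact ⟨_, hwu, b • u, Submodule.smul_mem_pointwise_smul _ _ _ trivial, by simp⟩)
      rw [mkQ_mem_smul_top_iff, Submodule.mem_sup] at h1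
      obtain ⟨t, ht, _, ⟨w', -, rfl⟩, rfl⟩ := h1
      have h2 := ih hb (n + 1) (a • w' - u) (by
        have : b • (a • w' - u) = a • (t + b • w') - b • u - a • t := by
          rw [smul_sub, smul_add, smul_comm b a]
          abel
        rw [this]
        exact sub_mem hwu (Submodule.smul_mem _ _ ht))
      have hle : ∀ k, Ideal.ofList rs ^ k • (⊤ : Submodule R N) ≤
          (Ideal.span {b} ⊔ Ideal.ofList rs) ^ k • ⊤ := fun k =>
        Submodule.smul_mono_left (Ideal.pow_right_mono le_sup_right k)
      have h3 := ihn w' (by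
        have : a • w' = (a • w' - u) + u := by abel
        rw [this]
        refine add_mem (hle n ?_) hu
        exact Submodule.smul_mono_left (Ideal.pow_le_pow_right (Nat.le_succ n)) h2)
      refine add_mem (hle _ ht) ?_
      rw [pow_succ', Submodule.mul_smul]
      exact Submodule.smul_mem_smul (Submodule.mem_sup_left (Ideal.mem_span_singleton_self b)) h3

theorem gen_eq_ofList {R : Type*} [CommRing R] {r : ℕ} (x : Fin r → R) :
    gen x = Ideal.ofList (List.ofFn x) := by
  rw [gen, Ideal.ofList]
  congr 1
  ext
  simp

theorem gen_cons {R : Type*} [CommRing R] {r : ℕ} (a : R) (x : Fin r → R) :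
    gen (Fin.cons a x : Fin (r + 1) → R) = Ideal.span {a} ⊔ gen x := by
  rw [gen_eq_ofList, gen_eq_ofList, List.ofFn_cons, Ideal.ofList_cons]

theorem hfin_quotSMulTop {R : Type*} [CommRing R] {r : ℕ} {a : R} {x : Fin r → R} {N : Type*} [AddCommGroup N]
    [Module R N] [IsLocalRing R]
    (hfin : ∃ k, maximalIdeal R ^ k • (⊤ : Submodule R N) ≤
      gen (Fin.cons a x : Fin (r + 1) → R) • ⊤) :
    ∃ k, maximalIdeal R ^ k • (⊤ : Submodule R (QuotSMulTop a N)) ≤ gen x • ⊤ := by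
  obtain ⟨k, hk⟩ := hfin
  refine ⟨k, ?_⟩
  have h1 := sup_span_pow_smul_top_quotSMulTop (N := N) a (gen x) 1
  rw [pow_one, pow_one, ← gen_cons] at h1
  rw [← h1]
  have h2 := Submodule.map_mono (f := (a • ⊤ : Submodule R N).mkQ) hk
  rwa [Submodule.map_smul'', Submodule.map_smul'', Submodule.map_top, Submodule.range_mkQ] at h2

theorem colen_gen_cons_pow_succ {r : ℕ} {a : R} {x : Fin r → R} {N : Type*} [AddCommGroup N]
    [Module R N] [Module.Finite R N]
    (hfin : ∃ k, maximalIdeal R ^ k • (⊤ : Submodule R N) ≤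
      gen (Fin.cons a x : Fin (r + 1) → R) • ⊤) (n : ℕ)
    (hreg : ∀ w : N, a • w ∈ gen (Fin.cons a x : Fin (r + 1) → R) ^ (n + 1) • (⊤ : Submodule R N) →
      w ∈ gen (Fin.cons a x : Fin (r + 1) → R) ^ n • (⊤ : Submodule R N)) :
    colen (gen (Fin.cons a x : Fin (r + 1) → R) ^ (n + 1) • (⊤ : Submodule R N)) =
      colen (gen (Fin.cons a x : Fin (r + 1) → R) ^ n • (⊤ : Submodule R N)) +
        colen (gen x ^ (n + 1) • (⊤ : Submodule R (QuotSMulTop a N))) := by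
  have ha : a ∈ gen (Fin.cons a x : Fin (r + 1) → R) := Ideal.subset_span ⟨0, rfl⟩
  have h := length_quotient_pow_succ_eq ha n hreg
  have h1 := length_pow_smul_ne_top _ hfin le_top (n + 1)
  have h2 := length_pow_smul_ne_top _ hfin le_top n
  have h3 := ne_top_of_le_ne_top h1 (le_of_le_of_eq le_add_self h.symm)
  rw [← coe_colen h1, ← coe_colen h2, ← coe_colen h3] at h
  rw [gen_cons, sup_span_pow_smul_top_quotSMulTop] at h
  rw [gen_cons]
  exact_mod_cast h

theorem ExactLength.isWeaklyRegular {r : ℕ} {x : Fin r → R} (hx : ∀ i, x i ∈ maximalIdeal R)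
    {N : Type*} [AddCommGroup N] [Module R N] [Module.Finite R N]
    (hfin : ∃ k, maximalIdeal R ^ k • (⊤ : Submodule R N) ≤ gen x • ⊤)
    (h : ExactLength x N) : IsWeaklyRegular N (List.ofFn x) := by
  induction r generalizing N with
  | zero => simp
  | succ r ih =>
    obtain ⟨a, x, rfl⟩ : ∃ a x', x = Fin.cons a x' := ⟨x 0, Fin.tail x, (Fin.cons_self_tail x).symm⟩
    have hreg : ∀ (n : ℕ) (w : N),
        a • w ∈ gen (Fin.cons a x : Fin (r + 1) → R) ^ (n + 1) • (⊤ : Submodule R N) →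
        w ∈ gen (Fin.cons a x : Fin (r + 1) → R) ^ n • (⊤ : Submodule R N) := fun n w hw => by
      refine (h.freeChain _ hfin).mem_of_eval_smul_mem _ (isHomogeneous_X R 0)
        (by simp [red]) ?_
      rw [eval_X, Fin.cons_zero]
      exact (add_comm 1 n) ▸ hw
    have hle : gen (Fin.cons a x : Fin (r + 1) → R) ≤ maximalIdeal R :=
      Ideal.span_le.2 (by rintro _ ⟨i, rfl⟩; exact hx i)
    rw [List.ofFn_cons, isWeaklyRegular_cons_iff]
    refine ⟨isSMulRegular_iff_right_eq_zero_of_smul.2 fun w hw => ?_, ?_⟩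
    · have h1 := Ideal.iInf_pow_smul_eq_bot_of_isLocalRing (M := N) _
        (ne_top_of_le_ne_top (Ideal.IsPrime.ne_top') hle)
      rw [← Submodule.mem_bot R, ← h1, Submodule.mem_iInf]
      exact fun n => hreg n w (by rw [hw]; exact zero_mem _)
    · have hc := fun n => colen_gen_cons_pow_succ hfin n (hreg n)
      refine ih (fun i => by simpa using hx i.succ) (hfin_quotSMulTop hfin) ?_
      have h0 : colen (gen x • (⊤ : Submodule R (QuotSMulTop a N))) =
          colen (gen (Fin.cons a x : Fin (r + 1) → R) • (⊤ : Submodule R N)) := by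
        have := hc 0
        simp at this
        exact this.symm
      rintro (_ | n)
      · simp
      · rw [h0]
        have h1 := hc (n + 1)
        rw [h (n + 1), h n, Nat.multichoose_succ_succ, mul_add, add_comm] at h1
        exact (Nat.add_left_cancel h1).symm

theorem exactLength_of_isRegular {r : ℕ} {x : Fin r → R}
    {N : Type*} [AddCommGroup N] [Module R N] [Module.Finite R N]
    (hfin : ∃ k, maximalIdeal R ^ k • (⊤ : Submodule R N) ≤ gen x • ⊤)
    (h : IsRegular N (List.ofFn x)) : ExactLength x N := by
  induction r generalizing N with
  | zero =>
    intro n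
    have : gen x = ⊥ := by simp [gen]
    simp [this]
  | succ r ih =>
    obtain ⟨a, x, rfl⟩ : ∃ a x', x = Fin.cons a x' := ⟨x 0, Fin.tail x, (Fin.cons_self_tail x).symm⟩
    rw [List.ofFn_cons] at h
    have hreg : ∀ (n : ℕ) (w : N),
        a • w ∈ gen (Fin.cons a x : Fin (r + 1) → R) ^ (n + 1) • (⊤ : Submodule R N) →
        w ∈ gen (Fin.cons a x : Fin (r + 1) → R) ^ n • (⊤ : Submodule R N) := fun n w hw => by
      rw [gen_cons] at hw ⊢
      obtain ⟨u, hu, hwu⟩ := mem_sup_span_pow_smul hw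
      rw [← smul_sub, gen_eq_ofList] at hwu
      have := mem_pow_smul_of_isRegular_cons h (n + 1) _ hwu
      rw [← gen_eq_ofList] at this
      have h2 := Submodule.smul_mono (Ideal.pow_right_mono (le_sup_right (a := Ideal.span {a})) n)
        le_rfl (Submodule.smul_mono_left (Ideal.pow_le_pow_right (Nat.le_succ n)) this)
      simpa using add_mem h2 hu
    have hc := fun n => colen_gen_cons_pow_succ hfin n (hreg n)
    have hi := ih (hfin_quotSMulTop hfin) ((isRegular_cons_iff _ _ _).1 h).2
    have h0 : colen (gen x • (⊤ : Submodule R (QuotSMulTop a N))) =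
        colen (gen (Fin.cons a x : Fin (r + 1) → R) • (⊤ : Submodule R N)) := by
      have := hc 0
      simp at this
      exact this.symm
    intro n
    induction n with
    | zero => simp
    | succ n ihn =>
      rw [hc, ihn, hi, h0, Nat.multichoose_succ_succ (r + 1), mul_add, add_comm]

end

section

universe u

/-- `N` admits a regular sequence of length `t` in the maximal ideal. -/
def HasDepth (R : Type*) [CommRing R] [IsLocalRing R] (N : Type*) [AddCommGroup N] [Module R N]
    (t : ℕ) : Prop :=
  ∃ rs : List R, rs.length = t ∧ (∀ r ∈ rs, r ∈ maximalIdeal R) ∧ IsRegular N rs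

lemma ringKrullDim_quotient_succ_le_of_lt {R : Type*} [CommRing R] {p q : Ideal R} [p.IsPrime]
    (h : p < q) : ringKrullDim (R ⧸ q) + 1 ≤ ringKrullDim (R ⧸ p) := by
  obtain ⟨z, hzq, hzp⟩ := SetLike.exists_of_lt h
  have hz : (Ideal.Quotient.mk p z) ∈ nonZeroDivisors (R ⧸ p) :=
    mem_nonZeroDivisors_of_ne_zero (by rwa [Ne, Ideal.Quotient.eq_zero_iff_mem])
  refine le_trans ?_ (ringKrullDim_quotient_succ_le_of_nonZeroDivisor hz)
  gcongr
  refine ringKrullDim_le_of_surjective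
    (Ideal.Quotient.lift (Ideal.span {Ideal.Quotient.mk p z}) (Ideal.Quotient.factor h.le) ?_) ?_
  · intro a ha
    rw [Ideal.mem_span_singleton] at ha
    obtain ⟨b, rfl⟩ := ha
    rw [map_mul, Ideal.Quotient.factor_mk, Ideal.Quotient.eq_zero_iff_mem.mpr hzq, zero_mul]
  · apply Ideal.Quotient.lift_surjective_of_surjective
    exact Ideal.Quotient.factor_surjective h.le

variable {R : Type*} [CommRing R] [IsLocalRing R] [IsNoetherianRing R]
  {N : Type*} [AddCommGroup N] [Module R N]

lemma exists_mem_associatedPrimes_quotSMulTop [Module.Finite R N] {z : R} (hz : z ∈ maximalIdeal R)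
    (hreg : IsSMulRegular N z) {p : Ideal R} (hp : p ∈ associatedPrimes R N) :
    ∃ q ∈ associatedPrimes R (QuotSMulTop z N), p < q := by
  have hpp : p.IsPrime := hp.1
  obtain ⟨_, w, hw⟩ := isAssociatedPrime_iff.mp hp
  have hpw : ∀ a, a ∈ p ↔ a • w = 0 := fun a => by rw [hw]; simp [Submodule.mem_colon_singleton]
  have hw0 : w ≠ 0 := by
    rintro rfl
    exact hpp.ne_top ((Ideal.eq_top_iff_one _).mpr ((hpw 1).mpr (smul_zero _)))
  have hzp : z ∉ p := fun h => hw0 (by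
    have := (hpw z).mp h
    exact isSMulRegular_iff_right_eq_zero_of_smul.mp hreg w this)
  let K : Submodule R N := Submodule.torsionBySet R N p
  have hK : ∃ u ∈ K, u ∉ (z • ⊤ : Submodule R N) := by
    by_contra! hcon
    have h1 : K ≤ Ideal.span {z} • K := by
      intro u hu
      obtain ⟨n, -, rfl⟩ := hcon u hu
      have hn : n ∈ K := by
        rw [Submodule.mem_torsionBySet_iff] at hu ⊢
        intro a
        apply isSMulRegular_iff_right_eq_zero_of_smul.mp hreg
        have := hu a
        change (a : R) • z • n = 0 at this
        rwa [smul_comm] at this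
      exact Submodule.smul_mem_smul (Ideal.mem_span_singleton_self z) hn
    have h2 : K = ⊥ := Submodule.eq_bot_of_le_smul_of_le_jacobson_bot (Ideal.span {z}) K
      (IsNoetherian.noetherian K) h1 (by
        rw [IsLocalRing.jacobson_eq_maximalIdeal _ bot_ne_top]
        simpa using hz)
    have : w ∈ K := by
      rw [Submodule.mem_torsionBySet_iff]
      exact fun a => (hpw a).mp a.2
    rw [h2] at this
    exact hw0 this
  obtain ⟨u, huK, hu⟩ := hK
  let ub : QuotSMulTop z N := Submodule.Quotient.mk u
  have hub : ub ≠ 0 := by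
    rwa [Ne, Submodule.Quotient.mk_eq_zero]
  obtain ⟨q, hq, hle⟩ := exists_le_isAssociatedPrime_of_isNoetherianRing R ub hub
  have hpq : p ≤ q := by
    intro a ha
    apply hle
    rw [Submodule.mem_colon_singleton, Submodule.mem_bot, ← Submodule.Quotient.mk_smul,
      (Submodule.mem_torsionBySet_iff _ _).mp huK ⟨a, ha⟩, Submodule.Quotient.mk_zero]
  have hzq : z ∈ q := by
    apply hle
    rw [Submodule.mem_colon_singleton, Submodule.mem_bot, ← Submodule.Quotient.mk_smul,
      Submodule.Quotient.mk_eq_zero]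
    exact Submodule.smul_mem_pointwise_smul _ _ _ trivial
  exact ⟨q, hq, lt_of_le_of_ne hpq (fun h => hzp (h ▸ hzq))⟩

lemma le_ringKrullDim_quotient_of_isRegular (rs : List R) :
    ∀ {N : Type*} [AddCommGroup N] [Module R N] [Module.Finite R N],
    (∀ r ∈ rs, r ∈ maximalIdeal R) → IsRegular N rs →
    ∀ p ∈ associatedPrimes R N, (rs.length : WithBot ℕ∞) ≤ ringKrullDim (R ⧸ p) := by
  induction rs with
  | nil =>
    intro N _ _ _ _ _ p hp
    have := hp.1
    have : Nontrivial (R ⧸ p) := Ideal.Quotient.nontrivial_iff.mpr hp.1.ne_top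
    simpa using ringKrullDim_nonneg_of_nontrivial
  | cons z rs ih =>
    intro N _ _ _ hrs hreg p hp
    rw [isRegular_cons_iff] at hreg
    have := hp.1
    obtain ⟨q, hq, hlt⟩ := exists_mem_associatedPrimes_quotSMulTop (hrs z (by simp)) hreg.1 hp
    have h1 := ih (fun r hr => hrs r (by simp [hr])) hreg.2 q hq
    refine le_trans ?_ (ringKrullDim_quotient_succ_le_of_lt hlt)
    push_cast [List.length_cons]
    gcongr

lemma HasDepth.le_ringKrullDim [Module.Finite R N] {t : ℕ} (h : HasDepth R N t) {p : Ideal R}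
    (hp : p ∈ associatedPrimes R N) : (t : WithBot ℕ∞) ≤ ringKrullDim (R ⧸ p) := by
  obtain ⟨rs, rfl, h1, h2⟩ := h
  exact le_ringKrullDim_quotient_of_isRegular rs h1 h2 p hp

lemma HasDepth.nontrivial {R : Type*} [CommRing R] [IsLocalRing R] {N : Type*} [AddCommGroup N]
    [Module R N] {t : ℕ} (h : HasDepth R N t) : Nontrivial N := by
  obtain ⟨rs, -, -, h2⟩ := h
  exact h2.nontrivial

end

section

universe u

open CategoryTheory Abelian Limits

variable {R : Type u} [CommRing R] [IsLocalRing R] [IsNoetherianRing R]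
  {N : Type u} [AddCommGroup N] [Module R N] [Module.Finite R N]

lemma maximalIdeal_smul_top_lt {R : Type*} [CommRing R] [IsLocalRing R] {N : Type*}
    [AddCommGroup N] [Module R N] [Module.Finite R N] [Nontrivial N] :
    maximalIdeal R • (⊤ : Submodule R N) < ⊤ := by
  refine lt_top_iff_ne_top.mpr fun h => ?_
  have := Submodule.eq_bot_of_le_smul_of_le_jacobson_bot (maximalIdeal R) (⊤ : Submodule R N)
      (Module.finite_def.mp inferInstance) h.ge (by
        rw [IsLocalRing.jacobson_eq_maximalIdeal _ bot_ne_top])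
  exact absurd this.symm bot_ne_top

lemma HasDepth.quotSMulTop {t : ℕ} (h : HasDepth R N (t + 1)) {z : R} (hz : z ∈ maximalIdeal R)
    (hreg : IsSMulRegular N z) : HasDepth R (QuotSMulTop z N) t := by
  have := h.nontrivial
  have := nontrivial_quotSMulTop_of_mem_maximalIdeal N hz
  have h1 := ((ModuleCat.exists_isRegular_tfae (maximalIdeal R) (t + 1) (ModuleCat.of R N)
    maximalIdeal_smul_top_lt).out 3 1).mp h
  refine ((ModuleCat.exists_isRegular_tfae (maximalIdeal R) t (ModuleCat.of R (QuotSMulTop z N))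
    maximalIdeal_smul_top_lt).out 3 1).mpr ?_
  intro i hi
  have zero1 := AddCommGrpCat.isZero_of_iff_subsingleton.mpr (h1 i (by omega))
  have zero2 := AddCommGrpCat.isZero_of_iff_subsingleton.mpr (h1 (i + 1) (by omega))
  have hreg' : IsSMulRegular (ModuleCat.of R N) z := hreg
  exact AddCommGrpCat.subsingleton_of_isZero <| ShortComplex.Exact.isZero_of_both_zeros
    ((Ext.covariant_sequence_exact₃' _ hreg'.smulShortComplex_shortExact) i (i + 1) rfl)
    (zero1.eq_zero_of_src _) (zero2.eq_zero_of_tgt _)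


lemma ringKrullDim_quotient_le_supportDim {R : Type*} [CommRing R] {N : Type*} [AddCommGroup N]
    [Module R N] [Module.Finite R N] {p : Ideal R} (h : Module.annihilator R N ≤ p) :
    ringKrullDim (R ⧸ p) ≤ Module.supportDim R N := by
  rw [Module.supportDim_eq_ringKrullDim_quotient_annihilator]
  exact ringKrullDim_le_of_surjective _ (Ideal.Quotient.factor_surjective h)

lemma supportDim_le_of_hfin {r : ℕ} {x : Fin r → R} (hx : ∀ i, x i ∈ maximalIdeal R)
    (hfin : ∃ k, maximalIdeal R ^ k • (⊤ : Submodule R N) ≤ gen x • ⊤) :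
    Module.supportDim R N ≤ r := by
  induction r generalizing N with
  | zero =>
    obtain ⟨k, hk⟩ := hfin
    have h0 : gen x = ⊥ := by simp [gen]
    rw [h0, Submodule.bot_smul, le_bot_iff] at hk
    have : Subsingleton (Module.support R N) := by
      have : ∀ p ∈ Module.support R N, p.asIdeal = maximalIdeal R := by
        intro p hp
        rw [Module.mem_support_iff_of_finite] at hp
        refine ((maximalIdeal.isMaximal R).eq_of_le p.2.ne_top
          (p.2.le_of_pow_le (n := k) (le_trans ?_ hp))).symm
        intro a ha
        rw [Module.mem_annihilator]
        intro n
        have := Submodule.smul_mem_smul ha (Submodule.mem_top (x := n) (R := R))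
        rwa [hk] at this
      refine ⟨fun p q => Subtype.ext (PrimeSpectrum.ext ?_)⟩
      rw [this _ p.2, this _ q.2]
    simpa [Module.supportDim] using Order.krullDim_nonpos_of_subsingleton
  | succ r ih =>
    obtain ⟨a, x, rfl⟩ : ∃ a x', x = Fin.cons a x' := ⟨x 0, Fin.tail x, (Fin.cons_self_tail x).symm⟩
    have := ih (N := QuotSMulTop a N) (fun i => by simpa using hx i.succ) (hfin_quotSMulTop hfin)
    refine (Module.supportDim_le_supportDim_quotSMulTop_succ (by simpa using hx 0)).trans ?_
    push_cast
    gcongr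

lemma isRegular_of_hasDepth {t : ℕ} {x : Fin t → R} (hx : ∀ i, x i ∈ maximalIdeal R)
    (hfin : ∃ k, maximalIdeal R ^ k • (⊤ : Submodule R N) ≤ gen x • ⊤) (h : HasDepth R N t) :
    IsRegular N (List.ofFn x) := by
  induction t generalizing N with
  | zero =>
    have := h.nontrivial
    simpa using IsRegular.nil R N
  | succ t ih =>
    obtain ⟨a, x, rfl⟩ : ∃ a x', x = Fin.cons a x' := ⟨x 0, Fin.tail x, (Fin.cons_self_tail x).symm⟩
    have ha : a ∈ maximalIdeal R := by simpa using hx 0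
    have hx' : ∀ i, x i ∈ maximalIdeal R := fun i => by simpa using hx i.succ
    have hfin' := hfin_quotSMulTop hfin
    have hreg : IsSMulRegular N a := by
      by_contra hcon
      have : a ∈ ({r | IsSMulRegular N r}ᶜ : Set R) := hcon
      rw [← biUnion_associatedPrimes_eq_compl_regular] at this
      simp only [Set.mem_iUnion, SetLike.mem_coe] at this
      obtain ⟨p, hp, hap⟩ := this
      have h1 := h.le_ringKrullDim hp
      have h2 : ringKrullDim (R ⧸ p) ≤ t := by
        refine le_trans ?_ (supportDim_le_of_hfin hx' hfin')
        refine ringKrullDim_quotient_le_supportDim ?_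
        have hpp := hp.1
        rw [← Module.mem_support_iff_of_finite (p := ⟨p, hp.1⟩), Module.support_quotSMulTop]
        refine ⟨?_, by simpa using hap⟩
        rw [Module.mem_support_iff_of_finite]
        exact Submodule.annihilator_top (R := R) (M := N) ▸ IsAssociatedPrime.annihilator_le hp
      have := h1.trans h2
      norm_cast at this
      omega
    rw [List.ofFn_cons, isRegular_cons_iff]
    exact ⟨hreg, ih hx' hfin' (h.quotSMulTop ha hreg)⟩

end

section

variable {R : Type*} [CommRing R]

lemma map_pow_smul_top_le {N N' : Type*} [AddCommGroup N] [Module R N] [AddCommGroup N']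
    [Module R N'] (g : N →ₗ[R] N') (I : Ideal R) {w : N} (hw : w ∈ I • (⊤ : Submodule R N)) :
    g w ∈ I • (⊤ : Submodule R N') := by
  have := Submodule.mem_map_of_mem (f := g) hw
  rw [Submodule.map_smul''] at this
  exact Submodule.smul_mono le_rfl le_top this

/-- A form of the Artin–Rees lemma for injective maps. -/
lemma exists_mem_pow_smul_of_injective [IsNoetherianRing R] {L N : Type*} [AddCommGroup L]
    [Module R L] [AddCommGroup N] [Module R N] [Module.Finite R N] (I : Ideal R) (g : L →ₗ[R] N)
    (hg : Function.Injective g) :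
    ∃ c : ℕ, ∀ n w, g w ∈ I ^ (n + c) • (⊤ : Submodule R N) →
      w ∈ I ^ n • (⊤ : Submodule R L) := by
  obtain ⟨c, hc⟩ := Ideal.exists_pow_inf_eq_pow_smul I (LinearMap.range g)
  refine ⟨c, fun n w hw => ?_⟩
  have h1 : g w ∈ I ^ (n + c) • ⊤ ⊓ LinearMap.range g := ⟨hw, w, rfl⟩
  rw [hc (n + c) (by omega), Nat.add_sub_cancel] at h1
  have h2 : g w ∈ I ^ n • LinearMap.range g := Submodule.smul_mono le_rfl inf_le_right h1
  rw [LinearMap.range_eq_map, ← Submodule.map_smul''] at h2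
  obtain ⟨w', hw', h⟩ := h2
  rwa [← hg h]

variable [IsLocalRing R] {r : ℕ} {x : Fin r → R}

lemma BoundedColon.of_subsingleton {N : Type*} [AddCommGroup N] [Module R N] [Subsingleton N] :
    BoundedColon x N :=
  ⟨0, fun _ _ _ _ _ w _ => by rw [Subsingleton.elim w 0]; exact zero_mem _⟩

variable [IsNoetherianRing R]

lemma BoundedColon.of_injective {L N : Type*} [AddCommGroup L] [Module R L] [AddCommGroup N]
    [Module R N] [Module.Finite R N] (g : L →ₗ[R] N) (hg : Function.Injective g)
    (h : BoundedColon x N) : BoundedColon x L := by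
  obtain ⟨C, hC⟩ := h
  obtain ⟨c, hc⟩ := exists_mem_pow_smul_of_injective (gen x) g hg
  refine ⟨C + c, fun d f hf hne j w hw => ?_⟩
  by_cases hj : j ≤ C + c
  · simp [Nat.sub_eq_zero_of_le hj]
  have h1 := map_pow_smul_top_le g _ hw
  rw [map_smul] at h1
  have h2 := hC d f hf hne j _ h1
  exact hc _ _ (by convert h2 using 3; omega)

lemma BoundedColon.of_quotient {N : Type*} [AddCommGroup N] [Module R N] [Module.Finite R N]
    (L : Submodule R N) (hL : BoundedColon x L) (hQ : BoundedColon x (N ⧸ L)) :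
    BoundedColon x N := by
  obtain ⟨A, hA⟩ := hL
  obtain ⟨B, hB⟩ := hQ
  obtain ⟨c, hc⟩ := exists_mem_pow_smul_of_injective (gen x) L.subtype L.injective_subtype
  refine ⟨A + B + c, fun d f hf hne j w hw => ?_⟩
  by_cases hj : j ≤ A + B + c
  · simp [Nat.sub_eq_zero_of_le hj]
  have h1 := map_pow_smul_top_le L.mkQ _ hw
  rw [map_smul] at h1
  have h2 := hB d f hf hne j _ h1
  rw [mkQ_mem_smul_top_iff, Submodule.mem_sup] at h2
  obtain ⟨w', hw', a, ha, rfl⟩ := h2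
  have h3 : eval x f • a ∈ gen x ^ (d + (j - B)) • (⊤ : Submodule R N) := by
    have h4 := eval_smul_mem x hf hw'
    have h5 := pow_smul_le_pow_smul x (show d + (j - B) ≤ d + j by omega) _ hw
    rw [smul_add] at h5
    simpa using sub_mem h5 h4
  have h6 := hc (d + (j - B - c)) (eval x f • ⟨a, ha⟩) (by
    rw [show d + (j - B - c) + c = d + (j - B) by omega]
    exact h3)
  have h7 := map_pow_smul_top_le L.subtype _ (hA d f hf hne _ _ h6)
  refine add_mem (pow_smul_le_pow_smul x (by omega) _ hw') ?_
  rw [show j - (A + B + c) = j - B - c - A by omega]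
  exact h7

end

section

universe u

variable {R : Type u} [CommRing R] [IsLocalRing R] [IsNoetherianRing R]
  {N : Type u} [AddCommGroup N] [Module R N] [Module.Finite R N] {r : ℕ} {x : Fin r → R}

lemma exists_pow_le_gen_sup (hfin : ∃ k, maximalIdeal R ^ k • (⊤ : Submodule R N) ≤ gen x • ⊤)
    {p : Ideal R} (hp : Module.annihilator R N ≤ p) :
    ∃ k, maximalIdeal R ^ k ≤ gen x ⊔ p := by
  apply Ideal.exists_pow_le_of_le_radical_of_fg _ (IsNoetherian.noetherian _)
  rw [Ideal.radical_eq_sInf]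
  refine le_sInf ?_
  rintro P ⟨hP, hPp⟩
  obtain ⟨k, hk⟩ := hfin
  have h1 : (⟨P, hPp⟩ : PrimeSpectrum R) ∈
      Module.support R (N ⧸ (gen x • ⊤ : Submodule R N)) := by
    rw [Module.support_quotient]
    refine ⟨?_, le_sup_left.trans hP⟩
    rw [Module.mem_support_iff_of_finite]
    exact hp.trans (le_sup_right.trans hP)
  rw [Module.mem_support_iff_of_finite] at h1
  refine hPp.le_of_pow_le (n := k) (le_trans ?_ h1)
  intro a ha
  rw [Module.mem_annihilator]
  intro n
  obtain ⟨n, rfl⟩ := Submodule.mkQ_surjective _ n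
  rw [← map_smul, Submodule.mkQ_apply, Submodule.Quotient.mk_eq_zero]
  exact hk (Submodule.smul_mem_smul ha trivial)

/-- Elements killed by `p` modulo `L` that are fractions of multiples of `w`. -/
def primePart {R : Type*} [CommRing R] {N : Type*} [AddCommGroup N] [Module R N] (L : Submodule R N) (p : Ideal R) [hp : p.IsPrime] (w : N) : Submodule R N where
  carrier := {u | (∀ a ∈ p, a • u ∈ L) ∧ ∃ s ∉ p, s • u ∈ L ⊔ R ∙ w}
  zero_mem' := ⟨by simp, 1, (Ideal.ne_top_iff_one p).mp hp.ne_top, by simp⟩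
  add_mem' := by
    rintro u v ⟨hu, s, hs, hsu⟩ ⟨hv, t, ht, htv⟩
    refine ⟨fun a ha => by rw [smul_add]; exact add_mem (hu a ha) (hv a ha), s * t,
      hp.mul_notMem hs ht, ?_⟩
    rw [smul_add]
    refine add_mem ?_ ?_
    · rw [mul_comm, mul_smul]
      exact Submodule.smul_mem _ _ hsu
    · rw [mul_smul]
      exact Submodule.smul_mem _ _ htv
  smul_mem' := by
    rintro b u ⟨hu, s, hs, hsu⟩
    refine ⟨fun a ha => by rw [smul_comm]; exact Submodule.smul_mem _ _ (hu a ha), s, hs, ?_⟩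
    rw [smul_comm]
    exact Submodule.smul_mem _ _ hsu

lemma exists_smul_mem_of_mem_primePart {R : Type*} [CommRing R] [IsNoetherianRing R]
    {N : Type*} [AddCommGroup N] [Module R N] [Module.Finite R N] (L : Submodule R N) (p : Ideal R) [hp : p.IsPrime] (w : N) :
    ∃ s ∉ p, ∀ u ∈ primePart L p w, s • u ∈ L ⊔ R ∙ w := by
  have key : ∀ A : Submodule R N, A.FG → A ≤ primePart L p w →
      ∃ s ∉ p, ∀ u ∈ A, s • u ∈ L ⊔ R ∙ w := by
    intro A hA
    induction A, hA using Submodule.fg_induction with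
    | singleton v =>
      intro h
      obtain ⟨-, s, hs, hsv⟩ := h (Submodule.mem_span_singleton_self v)
      refine ⟨s, hs, fun u hu => ?_⟩
      obtain ⟨b, rfl⟩ := Submodule.mem_span_singleton.mp hu
      rw [smul_comm]
      exact Submodule.smul_mem _ _ hsv
    | sup A B _ _ ihA ihB =>
      intro h
      obtain ⟨s, hs, hsA⟩ := ihA (le_sup_left.trans h)
      obtain ⟨t, ht, htB⟩ := ihB (le_sup_right.trans h)
      refine ⟨s * t, hp.mul_notMem hs ht, fun u hu => ?_⟩
      obtain ⟨a, ha, b, hb, rfl⟩ := Submodule.mem_sup.mp hu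
      rw [smul_add]
      refine add_mem ?_ ?_
      · rw [mul_comm, mul_smul]
        exact Submodule.smul_mem _ _ (hsA a ha)
      · rw [mul_smul]
        exact Submodule.smul_mem _ _ (htB b hb)
  exact key _ (IsNoetherian.noetherian _) le_rfl

lemma ringKrullDim_quotient_anti {R : Type*} [CommRing R] {I J : Ideal R} (h : I ≤ J) :
    ringKrullDim (R ⧸ J) ≤ ringKrullDim (R ⧸ I) :=
  ringKrullDim_le_of_surjective _ (Ideal.Quotient.factor_surjective h)

lemma boundedColon_quotient (hx : ∀ i, x i ∈ maximalIdeal R)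
    (hfin : ∃ k, maximalIdeal R ^ k • (⊤ : Submodule R N) ≤ gen x • ⊤)
    (hbase : ∀ p : Ideal R, p.IsPrime → ringKrullDim (R ⧸ p) = r →
      (∃ k, maximalIdeal R ^ k ≤ gen x ⊔ p) → BoundedColon x (R ⧸ p)) (L : Submodule R N)
    (hL : ∀ u ∉ L, (r : WithBot ℕ∞) ≤ ringKrullDim (R ⧸ L.colon {u})) :
    BoundedColon x (N ⧸ L) := by
  induction L using WellFoundedGT.induction with
  | _ L ih =>
  by_cases htop : L = ⊤
  · subst htop
    exact BoundedColon.of_subsingleton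
  have : Nontrivial (N ⧸ L) := Submodule.Quotient.nontrivial_iff.mpr htop
  obtain ⟨p, hp⟩ := associatedPrimes.nonempty R (N ⧸ L)
  have hpp : p.IsPrime := hp.1
  obtain ⟨-, wb, hw⟩ := isAssociatedPrime_iff.mp hp
  obtain ⟨w, rfl⟩ := Submodule.mkQ_surjective _ wb
  have hpw : ∀ a, a ∈ p ↔ a • w ∈ L := fun a => by
    rw [hw, Submodule.mem_colon_singleton, Submodule.mem_bot, ← map_smul, Submodule.mkQ_apply,
      Submodule.Quotient.mk_eq_zero]
  have hpc : L.colon {w} = p := by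
    ext a
    rw [hpw, Submodule.mem_colon_singleton]
  have hwL : w ∉ L := fun h => hpp.ne_top ((Ideal.eq_top_iff_one _).mpr ((hpw 1).mpr (by simpa)))
  have hann : Module.annihilator R N ≤ p := fun a ha => by
    rw [hpw, Module.mem_annihilator.mp ha]
    exact zero_mem _
  have hdim : ringKrullDim (R ⧸ p) = r :=
    le_antisymm ((ringKrullDim_quotient_le_supportDim hann).trans (supportDim_le_of_hfin hx hfin))
      (hpc ▸ hL w hwL)
  have hwL' : w ∈ primePart L p w := by
    refine ⟨fun a ha => (hpw a).mp ha, 1, (Ideal.ne_top_iff_one p).mp hpp.ne_top, ?_⟩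
    rw [one_smul]
    exact Submodule.mem_sup_right (Submodule.mem_span_singleton_self w)
  have hLL' : L < primePart L p w := by
    refine lt_of_le_of_ne (fun u hu => ⟨fun a _ => L.smul_mem a hu, 1,
      (Ideal.ne_top_iff_one p).mp hpp.ne_top, Submodule.mem_sup_left (L.smul_mem 1 hu)⟩) ?_
    intro h
    exact hwL (h ▸ hwL')
  have hBCQ : BoundedColon x (N ⧸ primePart L p w) := by
    refine ih _ hLL' fun u hu => ?_
    by_cases hA : ∃ c ∈ p, c • u ∉ L
    · obtain ⟨c, hc, hcu⟩ := hA
      refine (hL _ hcu).trans (ringKrullDim_quotient_anti fun b hb => ?_)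
      rw [Submodule.mem_colon_singleton] at hb ⊢
      rw [smul_comm]
      exact hb.1 c hc
    · push Not at hA
      rw [← hdim]
      refine ringKrullDim_quotient_anti fun s hs => ?_
      rw [Submodule.mem_colon_singleton] at hs
      by_contra hsp
      obtain ⟨-, t, ht, htu⟩ := hs
      exact hu ⟨hA, t * s, hpp.mul_notMem ht hsp, by rwa [mul_smul]⟩
  have hBCp := hbase p hpp hdim (exists_pow_le_gen_sup hfin hann)
  have htor : Ideal.torsionOf R (N ⧸ L) (L.mkQ w) = p := by
    ext a
    rw [Ideal.mem_torsionOf_iff, hpw, ← map_smul, Submodule.mkQ_apply,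
      Submodule.Quotient.mk_eq_zero]
  have hBCw : BoundedColon x (R ∙ (L.mkQ w)) := by
    rw [← htor] at hBCp
    exact hBCp.of_injective
      (Ideal.quotTorsionOfEquivSpanSingleton R (N ⧸ L) (L.mkQ w)).symm.toLinearMap
      (LinearEquiv.injective _)
  refine BoundedColon.of_quotient ((primePart L p w).map L.mkQ) ?_ ?_
  · obtain ⟨s, hs, hsL⟩ := exists_smul_mem_of_mem_primePart L p w
    have hmap : ∀ v ∈ (primePart L p w).map L.mkQ, s • v ∈ R ∙ (L.mkQ w) := by
      rintro _ ⟨u, hu, rfl⟩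
      obtain ⟨l, hl, v, hv, h⟩ := Submodule.mem_sup.mp (hsL u hu)
      obtain ⟨b, rfl⟩ := Submodule.mem_span_singleton.mp hv
      have hl0 : L.mkQ l = 0 := (Submodule.Quotient.mk_eq_zero L).mpr hl
      rw [← map_smul, ← h, map_add, hl0, zero_add, map_smul]
      exact Submodule.smul_mem _ _ (Submodule.mem_span_singleton_self _)
    refine hBCw.of_injective ((LinearMap.lsmul R (N ⧸ L) s).restrict hmap) ?_
    rw [← LinearMap.ker_eq_bot, LinearMap.ker_eq_bot']
    rintro ⟨_, u, hu, rfl⟩ h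
    have hsu : s • u ∈ L := by
      have := congrArg Subtype.val h
      change s • L.mkQ u = 0 at this
      rwa [← map_smul, Submodule.mkQ_apply, Submodule.Quotient.mk_eq_zero] at this
    ext
    change L.mkQ u = 0
    rw [Submodule.mkQ_apply, Submodule.Quotient.mk_eq_zero]
    by_contra huL
    have hlt : p < L.colon {u} := by
      refine lt_of_le_of_ne (fun a ha => Submodule.mem_colon_singleton.mpr (hu.1 a ha)) ?_
      rintro rfl
      exact hs (Submodule.mem_colon_singleton.mpr hsu)
    have h1 := ringKrullDim_quotient_succ_le_of_lt hlt
    have h2 := (add_le_add_left (hL u huL) 1).trans h1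
    rw [hdim] at h2
    norm_cast at h2
    omega
  · exact hBCQ.of_injective
      (Submodule.quotientQuotientEquivQuotient L (primePart L p w) hLL'.le).toLinearMap
      (LinearEquiv.injective _)

end

section

variable {S : Type*} [CommRing S]

/-- Prime avoidance for cosets of an ideal, for pairwise incomparable primes. -/
lemma exists_add_notMem_of_antichain {A : Set (Ideal S)} (hfin : A.Finite)
    (hprime : ∀ Q ∈ A, Q.IsPrime) (hanti : ∀ Q ∈ A, ∀ Q' ∈ A, Q ≤ Q' → Q = Q') (I : Ideal S) (a : S)
    (hle : ∀ Q ∈ A, ¬ (I ≤ Q ∧ a ∈ Q)) : ∃ c ∈ I, ∀ Q ∈ A, a + c ∉ Q := by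
  classical
  let G : Finset (Ideal S) := hfin.toFinset.filter (fun Q => a ∉ Q)
  let B : Set (Ideal S) := {Q ∈ A | a ∈ Q}
  have hB : B.Finite := hfin.subset (fun Q h => h.1)
  have hne : ¬ ((I ⊓ G.inf id : Ideal S) : Set S) ⊆ ⋃ Q ∈ B, (Q : Set S) := by
    rw [Ideal.subset_union_prime_finite hB ⊥ ⊥ (fun Q hQ _ _ => hprime Q hQ.1) (f := fun Q => Q)]
    rintro ⟨Q, hQ, h⟩
    have hQp := hprime Q hQ.1
    rcases hQp.inf_le.mp h with h | h
    · exact hle Q hQ.1 ⟨h, hQ.2⟩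
    · obtain ⟨Q', hQ', h'⟩ := hQp.inf_le'.mp h
      simp only [G, Finset.mem_filter, Set.Finite.mem_toFinset] at hQ'
      have := hanti Q' hQ'.1 Q hQ.1 h'
      exact hQ'.2 (this ▸ hQ.2)
  obtain ⟨c, hc, hcB⟩ := Set.not_subset.mp hne
  refine ⟨c, hc.1, fun Q hQ h => ?_⟩
  by_cases ha : a ∈ Q
  · refine hcB (Set.mem_biUnion (show Q ∈ B from ⟨hQ, ha⟩) ?_)
    simpa using Q.sub_mem h ha
  · have hcQ : c ∈ Q := by
      have : G.inf id ≤ Q := Finset.inf_le (f := id) (by simp [G, hQ, ha])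
      exact this hc.2
    exact ha (by simpa using Q.sub_mem h hcQ)

end

section

variable {R S : Type*} [CommRing R] [CommRing S] [Algebra S R]
  {N : Type*} [AddCommGroup N] [Module R N] [Module S N] [IsScalarTower S R N] {r : ℕ}
  {x : Fin r → R} {y : Fin r → S}

lemma gen_smul_restrictScalars (hsurj : Function.Surjective (algebraMap S R))
    (hxy : ∀ i (n : N), y i • n = x i • n) (V : Submodule R N) :
    gen y • V.restrictScalars S = (gen x • V).restrictScalars S := by
  apply le_antisymm
  · rw [Submodule.smul_le]
    intro a ha n hn
    rw [Submodule.restrictScalars_mem] at hn ⊢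
    induction ha using Submodule.span_induction with
    | mem _ h =>
      obtain ⟨i, rfl⟩ := h
      rw [hxy]
      exact Submodule.smul_mem_smul (Ideal.subset_span ⟨i, rfl⟩) hn
    | zero => rw [zero_smul]; exact zero_mem _
    | add a b _ _ ha hb => rw [add_smul]; exact add_mem ha hb
    | smul s a _ ha =>
      rw [smul_assoc]
      exact ((gen x • V).restrictScalars S).smul_mem s ha
  · intro w hw
    rw [Submodule.restrictScalars_mem] at hw
    induction hw using Submodule.smul_induction_on' with
    | smul a ha n hn =>
      induction ha using Submodule.span_induction with
      | mem _ h =>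
        obtain ⟨i, rfl⟩ := h
        rw [← hxy]
        exact Submodule.smul_mem_smul (Ideal.subset_span ⟨i, rfl⟩) hn
      | zero => rw [zero_smul]; exact zero_mem _
      | add a b _ _ ha hb => rw [add_smul]; exact add_mem ha hb
      | smul c a _ ha =>
        obtain ⟨s, rfl⟩ := hsurj c
        rw [smul_assoc, algebraMap_smul]
        exact Submodule.smul_mem _ _ ha
    | add a _ b _ ha hb => exact add_mem ha hb

lemma gen_pow_smul_restrictScalars (hsurj : Function.Surjective (algebraMap S R))
    (hxy : ∀ i (n : N), y i • n = x i • n) (n : ℕ) :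
    gen y ^ n • (⊤ : Submodule S N) = (gen x ^ n • (⊤ : Submodule R N)).restrictScalars S := by
  induction n with
  | zero => simp
  | succ n ih =>
    rw [pow_succ', pow_succ', Submodule.mul_smul, Submodule.mul_smul, ih,
      gen_smul_restrictScalars hsurj hxy]

lemma BoundedColon.of_surjective_algebraMap [IsLocalRing R] [IsLocalRing S]
    (hsurj : Function.Surjective (algebraMap S R))
    (hxy : ∀ i (n : N), y i • n = x i • n)
    (h : BoundedColon y N) : BoundedColon x N := by
  obtain ⟨C, hC⟩ := h
  have := hsurj.isLocalHom
  refine ⟨C, fun d f hf hne j w hw => ?_⟩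
  obtain ⟨g, hg, rfl⟩ := exists_isHomogeneous_map_eq (algebraMap S R) hsurj hf
  have hact : ∀ (g : MvPolynomial (Fin r) S) (w : N),
      eval y g • w = eval x (map (algebraMap S R) g) • w := by
    intro g
    induction g using MvPolynomial.induction_on with
    | C a => intro w; simp
    | add p q hp hq => intro w; simp only [map_add, add_smul, hp, hq]
    | mul_X p i hp =>
      intro w
      simp only [map_mul, eval_X, map_X, mul_smul, hxy, hp]
  have hred : red g ≠ 0 := by
    intro h0
    apply hne
    have h1 : (residue R).comp (algebraMap S R) =
        (ResidueField.map (algebraMap S R)).comp (residue S) := (ResidueField.map_comp_residue _).symm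
    rw [red, map_map, h1, ← map_map, show map (residue S) g = 0 from h0, map_zero]
  have h1 := hC d g hg hred j w (by
    rw [gen_pow_smul_restrictScalars hsurj hxy, hact]
    exact hw)
  rw [gen_pow_smul_restrictScalars hsurj hxy] at h1
  exact h1

end

section

universe u

variable {S : Type u} [CommRing S] [IsLocalRing S] [IsNoetherianRing S]

lemma supportDim_quotSMulTop_le {N : Type u} [AddCommGroup N] [Module S N]
    [Module.Finite S N] {z : S} (hreg : IsSMulRegular N z) (hz : z ∈ maximalIdeal S) {t : ℕ}
    (hdim : Module.supportDim S N ≤ (t + 1 : ℕ)) : Module.supportDim S (QuotSMulTop z N) ≤ t := by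
  rw [← Module.supportDim_quotSMulTop_succ_eq_supportDim hreg hz] at hdim
  generalize Module.supportDim S (QuotSMulTop z N) = d at hdim
  induction d with
  | bot => exact bot_le
  | coe d =>
    norm_cast at hdim ⊢
    push_cast at hdim
    exact (ENat.add_le_add_iff_right (by simp)).mp hdim

lemma exists_isSMulRegular_of_notMem_associatedPrimes {N : Type u} [AddCommGroup N] [Module S N]
    [Module.Finite S N] {P : Ideal S} [hP : P.IsPrime] {t : ℕ} (hd : HasDepth S N t)
    (hdim : Module.supportDim S N ≤ t) (hann : Module.annihilator S N ≤ P)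
    (hmem : P ∉ associatedPrimes S N) : ∃ z ∈ P, IsSMulRegular N z := by
  have hne : ¬ (P : Set S) ⊆ ⋃ Q ∈ associatedPrimes S N, (Q : Set S) := by
    rw [Ideal.subset_union_prime_finite (associatedPrimes.finite S N) ⊥ ⊥ (fun Q hQ _ _ => hQ.1)
      (f := fun Q => Q)]
    rintro ⟨Q, hQ, h⟩
    have hlt : P < Q := lt_of_le_of_ne h (fun h => hmem (h ▸ hQ))
    have h1 := ringKrullDim_quotient_succ_le_of_lt hlt
    have h2 := (add_le_add_left (hd.le_ringKrullDim hQ) 1).trans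
      (h1.trans ((ringKrullDim_quotient_le_supportDim hann).trans hdim))
    norm_cast at h2
    omega
  obtain ⟨z, hzP, hz⟩ := Set.not_subset.mp hne
  rw [biUnion_associatedPrimes_eq_compl_regular] at hz
  exact ⟨z, hzP, by simpa using hz⟩

lemma exists_mem_associatedPrimes_of_hasDepth {P : Ideal S} [hP : P.IsPrime] (t : ℕ) :
    ∀ (N : Type u) [AddCommGroup N] [Module S N] [Module.Finite S N], HasDepth S N t →
      Module.supportDim S N ≤ t → Module.annihilator S N ≤ P →
    ∃ (d : ℕ) (N' : Type u) (_ : AddCommGroup N') (_ : Module S N') (_ : Module.Finite S N'),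
      HasDepth S N' d ∧ Module.supportDim S N' ≤ d ∧ P ∈ associatedPrimes S N' := by
  induction t with
  | zero =>
    intro N _ _ _ hd hdim hann
    refine ⟨0, N, _, _, ‹_›, hd, hdim, ?_⟩
    by_contra hmem
    obtain ⟨z, hzP, hreg⟩ := exists_isSMulRegular_of_notMem_associatedPrimes hd hdim hann hmem
    have hzm : z ∈ maximalIdeal S := le_maximalIdeal hP.ne_top hzP
    have := hd.nontrivial
    have := nontrivial_quotSMulTop_of_mem_maximalIdeal N hzm
    rw [← Module.supportDim_quotSMulTop_succ_eq_supportDim hreg hzm] at hdim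
    have h1 : 0 ≤ Module.supportDim S (QuotSMulTop z N) := by
      rw [Module.supportDim_eq_ringKrullDim_quotient_annihilator]
      have : Nontrivial (S ⧸ Module.annihilator S (QuotSMulTop z N)) :=
        Ideal.Quotient.nontrivial_iff.mpr (by
          rwa [Ne, Module.annihilator_eq_top_iff, not_subsingleton_iff_nontrivial])
      exact ringKrullDim_nonneg_of_nontrivial
    have h2 := (add_le_add_left h1 1).trans hdim
    norm_num at h2
  | succ t ih =>
    intro N _ _ _ hd hdim hann
    by_cases hmem : P ∈ associatedPrimes S N
    · exact ⟨t + 1, N, _, _, ‹_›, hd, hdim, hmem⟩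
    obtain ⟨z, hzP, hreg⟩ := exists_isSMulRegular_of_notMem_associatedPrimes hd hdim hann hmem
    have hzm : z ∈ maximalIdeal S := le_maximalIdeal hP.ne_top hzP
    refine ih (QuotSMulTop z N) (hd.quotSMulTop hzm hreg) ?_ ?_
    · exact supportDim_quotSMulTop_le hreg hzm hdim
    · rw [← Module.mem_support_iff_of_finite (p := ⟨P, hP⟩)] at hann ⊢
      rw [Module.support_quotSMulTop]
      exact ⟨hann, by simpa using hzP⟩

lemma exists_sub_mem_isRegular (I : Ideal S) (hI : I ≤ maximalIdeal S) {r : ℕ} :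
    ∀ (y₀ : Fin r → S) (N : Type u) [AddCommGroup N] [Module S N] [Module.Finite S N],
      (∀ i, y₀ i ∈ maximalIdeal S) → HasDepth S N r → Module.supportDim S N ≤ r →
      (∃ k, maximalIdeal S ^ k ≤ gen y₀ ⊔ I ⊔ Module.annihilator S N) →
      ∃ y : Fin r → S, (∀ i, y i - y₀ i ∈ I) ∧ IsRegular N (List.ofFn y) := by
  induction r with
  | zero =>
    intro y₀ N _ _ _ _ hd _ _
    have := hd.nontrivial
    exact ⟨y₀, by simp, by simpa using IsRegular.nil S N⟩
  | succ r ih =>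
    intro y₀ N _ _ _ hy₀ hd hdim hk
    obtain ⟨k, hk⟩ := hk
    obtain ⟨a, y₀, rfl⟩ : ∃ a y', y₀ = Fin.cons a y' :=
      ⟨y₀ 0, Fin.tail y₀, (Fin.cons_self_tail y₀).symm⟩
    have ha : a ∈ maximalIdeal S := by simpa using hy₀ 0
    have hy₀' : ∀ i, y₀ i ∈ maximalIdeal S := fun i => by simpa using hy₀ i.succ
    rw [gen_cons] at hk
    have hannle : ∀ Q ∈ associatedPrimes S N, Module.annihilator S N ≤ Q := fun Q hQ =>
      Submodule.annihilator_top (R := S) (M := N) ▸ IsAssociatedPrime.annihilator_le hQ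
    obtain ⟨c, hcI, hc⟩ := exists_add_notMem_of_antichain (associatedPrimes.finite S N)
      (fun Q hQ => hQ.1) (by
        intro Q hQ Q' hQ' hle
        by_contra hne
        have := hQ.1
        have h1 := ringKrullDim_quotient_succ_le_of_lt (lt_of_le_of_ne hle hne)
        have h2 := (add_le_add_left (hd.le_ringKrullDim hQ') 1).trans
          (h1.trans ((ringKrullDim_quotient_le_supportDim (hannle Q hQ)).trans hdim))
        norm_cast at h2
        omega) I a (by
        rintro Q hQ ⟨hIQ, haQ⟩
        have h1 : maximalIdeal S ^ k ≤ gen y₀ ⊔ Q := by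
          refine hk.trans (sup_le (sup_le (sup_le ?_ le_sup_left) ?_) ?_)
          · exact le_sup_of_le_right ((Ideal.span_singleton_le_iff_mem _).mpr haQ)
          · exact le_sup_of_le_right hIQ
          · exact le_sup_of_le_right (hannle Q hQ)
        have h2 : Module.supportDim S (S ⧸ Q) ≤ r := by
          refine supportDim_le_of_hfin hy₀' ⟨k, ?_⟩
          rw [Submodule.smul_le]
          intro b hb n _
          obtain ⟨n, rfl⟩ := Submodule.mkQ_surjective _ n
          rw [← map_smul, mkQ_mem_smul_top_iff]
          simpa using Ideal.mul_mem_right n _ (h1 hb)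
        rw [Module.supportDim_quotient_eq_ringKrullDim] at h2
        have h3 := (hd.le_ringKrullDim hQ).trans h2
        norm_cast at h3
        omega)
    have hreg : IsSMulRegular N (a + c) := by
      by_contra hcon
      have : a + c ∈ ({r | IsSMulRegular N r}ᶜ : Set S) := hcon
      rw [← biUnion_associatedPrimes_eq_compl_regular] at this
      simp only [Set.mem_iUnion, SetLike.mem_coe] at this
      obtain ⟨p, hp, hap⟩ := this
      exact hc p hp hap
    have hacm : a + c ∈ maximalIdeal S := add_mem ha (hI hcI)
    obtain ⟨y, hy, hyreg⟩ := ih y₀ (QuotSMulTop (a + c) N) hy₀' (hd.quotSMulTop hacm hreg)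
      (supportDim_quotSMulTop_le hreg hacm hdim) (by
        refine ⟨k, hk.trans (sup_le (sup_le (sup_le ?_ ?_) ?_) ?_)⟩
        · rw [Ideal.span_singleton_le_iff_mem]
          have h1 : a + c ∈ Module.annihilator S (QuotSMulTop (a + c) N) := by
            rw [Module.mem_annihilator]
            intro n
            obtain ⟨n, rfl⟩ := Submodule.mkQ_surjective _ n
            rw [← map_smul, Submodule.mkQ_apply, Submodule.Quotient.mk_eq_zero]
            exact Submodule.smul_mem_pointwise_smul _ _ _ trivial
          have h2 := sub_mem (Submodule.mem_sup_right (S := gen y₀ ⊔ I) h1)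
            (Submodule.mem_sup_left (Submodule.mem_sup_right hcI))
          simpa using h2
        · exact le_sup_of_le_left le_sup_left
        · exact le_sup_of_le_left le_sup_right
        · exact le_sup_of_le_right
            (LinearMap.annihilator_le_of_surjective _ (Submodule.mkQ_surjective _)))
    refine ⟨Fin.cons (a + c) y, ?_, ?_⟩
    · intro i
      refine Fin.cases ?_ (fun i => ?_) i
      · simpa using hcI
      · simpa using hy i
    · rw [List.ofFn_cons, isRegular_cons_iff]
      exact ⟨hreg, hyreg⟩

end

section

universe u

variable {S : Type u} [CommRing S] [IsLocalRing S] [IsNoetherianRing S]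

lemma exists_pow_le_annihilator_of_supportDim_le_zero {N : Type*} [AddCommGroup N] [Module S N]
    [Module.Finite S N] (h : Module.supportDim S N ≤ 0) :
    ∃ k, maximalIdeal S ^ k ≤ Module.annihilator S N := by
  apply Ideal.exists_pow_le_of_le_radical_of_fg _ (IsNoetherian.noetherian _)
  rw [Ideal.radical_eq_sInf]
  refine le_sInf ?_
  rintro P ⟨hP, hPp⟩
  by_contra hne
  have hlt : P < maximalIdeal S :=
    lt_of_le_of_ne (le_maximalIdeal hPp.ne_top) (fun h => hne h.ge)
  have h1 := ringKrullDim_quotient_succ_le_of_lt hlt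
  have h0 : 0 ≤ ringKrullDim (S ⧸ maximalIdeal S) := ringKrullDim_nonneg_of_nontrivial
  have h2 := ((add_le_add_left h0 1).trans h1).trans
    ((ringKrullDim_quotient_le_supportDim (N := N) hP).trans h)
  norm_num at h2

lemma exists_pow_smul_le_of_isRegular {N : Type*} [AddCommGroup N] [Module S N]
    [Module.Finite S N] {r : ℕ} {y : Fin r → S} (h : IsRegular N (List.ofFn y))
    (hdim : Module.supportDim S N ≤ r) :
    ∃ k, maximalIdeal S ^ k • (⊤ : Submodule S N) ≤ gen y • ⊤ := by
  have h1 := Module.supportDim_add_length_eq_supportDim_of_isRegular _ h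
  rw [List.length_ofFn, ← gen_eq_ofList] at h1
  have h2 : Module.supportDim S (N ⧸ (gen y • ⊤ : Submodule S N)) ≤ 0 := by
    rw [← h1] at hdim
    generalize Module.supportDim S (N ⧸ (gen y • ⊤ : Submodule S N)) = d at hdim
    induction d with
    | bot => exact bot_le
    | coe d =>
      norm_cast at hdim ⊢
      exact (ENat.add_le_add_iff_right (k := (r : ℕ∞)) (by simp)).mp (by simpa using hdim)
  obtain ⟨k, hk⟩ := exists_pow_le_annihilator_of_supportDim_le_zero h2
  refine ⟨k, Submodule.smul_le.mpr fun a ha n _ => ?_⟩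
  have := Module.mem_annihilator.mp (hk ha) (Submodule.mkQ _ n)
  rwa [← map_smul, Submodule.mkQ_apply, Submodule.Quotient.mk_eq_zero] at this

lemma BoundedColon.of_isRegular {N : Type*} [AddCommGroup N] [Module S N]
    [Module.Finite S N] {r : ℕ} {y : Fin r → S} (h : IsRegular N (List.ofFn y))
    (hdim : Module.supportDim S N ≤ r) : BoundedColon y N := by
  have hfin := exists_pow_smul_le_of_isRegular h hdim
  have hchain := (exactLength_of_isRegular hfin h).freeChain _ hfin
  exact ⟨0, fun d f hf hne j w hw => hchain.mem_of_eval_smul_mem _ hf hne hw⟩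

variable {R : Type u} [CommRing R] [IsLocalRing R] [Algebra S R]

lemma boundedColon_quotient_prime (hsurj : Function.Surjective (algebraMap S R)) {t : ℕ}
    (hS : HasDepth S S t) (hdim : ringKrullDim S ≤ t) {r : ℕ} {x : Fin r → R}
    (hx : ∀ i, x i ∈ maximalIdeal R) (p : Ideal R) [hp : p.IsPrime]
    (hpdim : ringKrullDim (R ⧸ p) = r) (hk : ∃ k, maximalIdeal R ^ k ≤ gen x ⊔ p) :
    BoundedColon x (R ⧸ p) := by
  have := hsurj.isLocalHom
  let P : Ideal S := p.comap (algebraMap S R)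
  have hP : P.IsPrime := Ideal.IsPrime.comap _
  let q : S →ₐ[S] R ⧸ p := (Ideal.Quotient.mkₐ S p).comp (Algebra.ofId S R)
  have hq : Function.Surjective q := (Ideal.Quotient.mk_surjective (I := p)).comp hsurj
  have hker : RingHom.ker q = P := by
    ext a
    rw [RingHom.mem_ker]
    change Ideal.Quotient.mk p (algebraMap S R a) = 0 ↔ _
    rw [Ideal.Quotient.eq_zero_iff_mem]
    rfl
  let E : (S ⧸ P) ≃ₗ[S] R ⧸ p :=
    ((Ideal.quotientEquivAlgOfEq S hker.symm).trans
      (Ideal.quotientKerAlgEquivOfSurjective hq)).toLinearEquiv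
  have hPdim : ringKrullDim (S ⧸ P) = r := by
    rw [← hpdim]
    exact ringKrullDim_eq_of_ringEquiv ((Ideal.quotientEquivAlgOfEq S hker.symm).trans
      (Ideal.quotientKerAlgEquivOfSurjective hq)).toRingEquiv
  obtain ⟨d, N, _, _, _, hNd, hNdim, hPN⟩ := exists_mem_associatedPrimes_of_hasDepth (P := P) t S hS
    (by rwa [Module.supportDim_self_eq_ringKrullDim])
    (by rw [Module.annihilator_eq_bot.mpr inferInstance]; exact bot_le)
  have hdr : d = r := by
    have h1 := hNd.le_ringKrullDim hPN
    have h2 := (ringKrullDim_quotient_le_supportDim (N := N) (p := P)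
      (Submodule.annihilator_top (R := S) (M := N) ▸ IsAssociatedPrime.annihilator_le hPN)).trans
      hNdim
    rw [hPdim] at h1 h2
    exact le_antisymm (by exact_mod_cast h1) (by exact_mod_cast h2)
  subst hdr
  choose y₀ hy₀ using fun i => hsurj (x i)
  have hy₀m : ∀ i, y₀ i ∈ maximalIdeal S := fun i => by
    have h1 : (maximalIdeal R).comap (algebraMap S R) = maximalIdeal S :=
      ((IsLocalRing.local_hom_TFAE (algebraMap S R)).out 0 4).mp ‹_›
    rw [← h1, Ideal.mem_comap, hy₀]
    exact hx i
  obtain ⟨y, hy, hyreg⟩ := exists_sub_mem_isRegular P (le_maximalIdeal hP.ne_top) y₀ N hy₀m hNd hNdim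
    (by
      obtain ⟨k, hk⟩ := hk
      refine ⟨k, le_sup_of_le_left fun s hs => ?_⟩
      have h1 : algebraMap S R s ∈ maximalIdeal R ^ k := by
        have h2 := Ideal.mem_map_of_mem (algebraMap S R) hs
        rw [Ideal.map_pow] at h2
        refine Ideal.pow_right_mono ?_ k h2
        exact ((IsLocalRing.local_hom_TFAE (algebraMap S R)).out 0 2).mp ‹_›
      have h3 : gen x = (gen y₀).map (algebraMap S R) := by
        rw [gen, gen, Ideal.map_span, ← Set.range_comp]
        congr 2
        funext i
        exact (hy₀ i).symm
      obtain ⟨u, hu, v, hv, huv⟩ := Submodule.mem_sup.mp (hk h1)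
      rw [h3, Ideal.mem_map_iff_of_surjective _ hsurj] at hu
      obtain ⟨u, hu, rfl⟩ := hu
      refine Submodule.mem_sup.mpr ⟨u, hu, s - u, ?_, by simp⟩
      change algebraMap S R (s - u) ∈ p
      rw [map_sub, ← huv]
      simpa using hv)
  obtain ⟨-, g, hg⟩ := (isAssociatedPrime_iff_exists_injective_linearMap _ _).mp hPN
  have hBC : BoundedColon y (R ⧸ p) :=
    (BoundedColon.of_isRegular hyreg hNdim).of_injective (g ∘ₗ E.symm.toLinearMap)
      (hg.comp E.symm.injective)
  refine BoundedColon.of_surjective_algebraMap hsurj (fun i n => ?_) hBC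
  rw [← algebraMap_smul R (y i) n, ← sub_eq_zero, ← sub_smul]
  obtain ⟨n, rfl⟩ := Ideal.Quotient.mk_surjective n
  have h1 : algebraMap S R (y i) - x i ∈ p := by
    have := hy i
    rw [← hy₀ i, ← map_sub]
    exact this
  change Ideal.Quotient.mk p ((algebraMap S R (y i) - x i) * n) = 0
  rw [Ideal.Quotient.eq_zero_iff_mem]
  exact Ideal.mul_mem_right _ _ h1

end

section

lemma exists_isLocalRing_hasDepth {R : Type} [CommRing R] [IsLocalRing R]
    (hCM : ∃ (S : Type) (_ : CommRing S),
      IsCMRing S ∧ ∃ f : S →+* R, Function.Surjective f) :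
    ∃ (S : Type) (_ : CommRing S) (_ : IsLocalRing S) (_ : IsNoetherianRing S)
      (_ : Algebra S R) (t : ℕ), Function.Surjective (algebraMap S R) ∧ HasDepth S S t ∧
      ringKrullDim S ≤ t := by
  obtain ⟨S, _, ⟨hN, hloc⟩, f, hf⟩ := hCM
  let p : Ideal S := (maximalIdeal R).comap f
  have hp : p.IsPrime := Ideal.IsPrime.comap _
  have hunit : ∀ s : p.primeCompl, IsUnit (f s) := fun s => by
    have : f s ∉ maximalIdeal R := s.2
    simpa using this
  let g : Localization.AtPrime p →+* R := IsLocalization.lift hunit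
  have hg : Function.Surjective g := fun a => by
    obtain ⟨s, rfl⟩ := hf a
    exact ⟨algebraMap S _ s, IsLocalization.lift_eq hunit s⟩
  obtain ⟨rs, hrs, hreg, hlen⟩ := hloc p
  refine ⟨Localization.AtPrime p, inferInstance, inferInstance,
    IsLocalization.isNoetherianRing p.primeCompl _ hN, g.toAlgebra, rs.length, hg,
    ⟨rs, rfl, hrs, hreg⟩, ?_⟩
  rw [hlen, mDim, Submodule.annihilator_top,
    ← Module.supportDim_eq_ringKrullDim_quotient_annihilator,
    Module.supportDim_self_eq_ringKrullDim]

/-- Multiplication by forms with nonzero reduction shifts the filtration by a bounded amount, on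
modules all of whose nonzero cyclic submodules have maximal dimension. -/
lemma boundedColon_of_isCMRing {R : Type} [CommRing R] [IsLocalRing R] [IsNoetherianRing R]
    (hCM : ∃ (S : Type) (_ : CommRing S),
      IsCMRing S ∧ ∃ f : S →+* R, Function.Surjective f)
    {N : Type} [AddCommGroup N] [Module R N] [Module.Finite R N] {r : ℕ} {x : Fin r → R}
    (hx : ∀ i, x i ∈ maximalIdeal R)
    (hfin : ∃ k, maximalIdeal R ^ k • (⊤ : Submodule R N) ≤ gen x • ⊤)
    (L : Submodule R N)
    (hL : ∀ u ∉ L, (r : WithBot ℕ∞) ≤ ringKrullDim (R ⧸ L.colon {u})) :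
    BoundedColon x (N ⧸ L) := by
  obtain ⟨S, _, _, _, _, t, hsurj, hd, hdim⟩ := exists_isLocalRing_hasDepth hCM
  exact boundedColon_quotient hx hfin
    (fun p hp hpd hk => boundedColon_quotient_prime hsurj hd hdim hx p hpd hk) L hL

end

section

universe u

variable {R : Type u} [CommRing R] [IsLocalRing R] [IsNoetherianRing R]

/-- The Hilbert–Samuel function grows at most like a polynomial of degree the dimension. -/
theorem exists_length_quotient_pow_succ_le {q : Ideal R} (t : ℕ) (U : Type u) [AddCommGroup U]
    [Module R U] [Module.Finite R U] (hdim : Module.supportDim R U ≤ t)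
    (hq : ∃ k, maximalIdeal R ^ k ≤ q ⊔ Module.annihilator R U) :
    ∃ K : ℕ, ∀ n, Module.length R (U ⧸ q ^ (n + 1) • (⊤ : Submodule R U)) ≤
      ((K * (t + 1).multichoose n : ℕ) : ℕ∞) := by
  induction t generalizing U with
  | zero =>
    obtain ⟨k, hk⟩ := exists_pow_le_annihilator_of_supportDim_le_zero (by simpa using hdim)
    have hfin : Module.length R (U ⧸ (⊥ : Submodule R U)) ≠ ⊤ := by
      refine length_quotient_ne_top ⟨k, Submodule.smul_le.mpr fun a ha n _ => ?_⟩
      rw [Submodule.mem_bot]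
      exact Module.mem_annihilator.mp (hk ha) n
    refine ⟨colen (⊥ : Submodule R U), fun n => (length_quotient_anti bot_le).trans ?_⟩
    rw [← coe_colen hfin]
    simp
  | succ t ih =>
    obtain ⟨k, hk⟩ := hq
    have hmin := (Module.annihilator R U).finite_minimalPrimes_of_isNoetherianRing
    by_cases h0 : maximalIdeal R ∈ (Module.annihilator R U).minimalPrimes
    · have hd : Module.supportDim R U ≤ (t : ℕ) := by
        refine le_trans ?_ (Nat.cast_nonneg t)
        rw [Module.supportDim_eq_ringKrullDim_quotient_annihilator, ringKrullDim_quotient,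
          Order.krullDim_nonpos_iff_forall_isMax]
        intro P Q hPQ
        have h1 : maximalIdeal R ≤ P.1.asIdeal :=
          h0.2 ⟨P.1.2, P.2⟩ (le_maximalIdeal P.1.2.ne_top)
        change Q.1.asIdeal ≤ P.1.asIdeal
        exact (le_maximalIdeal Q.1.2.ne_top).trans h1
      obtain ⟨K, hK⟩ := ih U hd ⟨k, hk⟩
      refine ⟨K, fun n => (hK n).trans ?_⟩
      norm_cast
      refine Nat.mul_le_mul_left _ ?_
      rw [← sum_multichoose (t + 1)]
      exact Finset.single_le_sum (f := fun d => (t + 1).multichoose d) (by simp) (by simp)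
    obtain ⟨a, ha, hap⟩ : ∃ a ∈ q, ∀ p ∈ (Module.annihilator R U).minimalPrimes, a ∉ p := by
      by_contra! hcon
      have hsub : (q : Set R) ⊆ ⋃ p ∈ (Module.annihilator R U).minimalPrimes, (p : Set R) := by
        intro a ha
        obtain ⟨p, hp, hap⟩ := hcon a ha
        exact Set.mem_biUnion hp hap
      obtain ⟨p, hp, hqp⟩ := (Ideal.subset_union_prime_finite hmin ⊥ ⊥
        (fun Q hQ _ _ => hQ.1.1) (f := fun Q => Q)).1 hsub
      refine h0 ?_
      have hpp : p.IsPrime := hp.1.1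
      have : maximalIdeal R ≤ p := hpp.le_of_pow_le (hk.trans (sup_le hqp hp.1.2))
      rwa [le_antisymm this (le_maximalIdeal hpp.ne_top)]
    have hd := (Module.supportDim_quotSMulTop_succ_le_of_notMem_minimalPrimes hap).trans hdim
    obtain ⟨K, hK⟩ := ih (QuotSMulTop a U)
      (ENat.WithBot.add_le_add_one_right_iff.1 (by simpa using hd))
      ⟨k, hk.trans (sup_le_sup_left
        (LinearMap.annihilator_le_of_surjective (a • ⊤ : Submodule R U).mkQ
          (Submodule.mkQ_surjective _)) _)⟩
    refine ⟨K, fun n => ?_⟩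
    rw [← sum_multichoose (t + 1), Finset.mul_sum, Nat.cast_sum]
    induction n with
    | zero =>
      refine (length_quotient_pow_succ_le ha 0).trans ?_
      have h1 : Module.length R (U ⧸ q ^ 0 • (⊤ : Submodule R U)) = 0 := by
        rw [Module.length_eq_zero_iff, pow_zero, Ideal.one_eq_top, Submodule.top_smul]
        infer_instance
      rw [h1, zero_add]
      simpa using hK 0
    | succ n ihn =>
      rw [Finset.sum_range_succ]
      exact (length_quotient_pow_succ_le ha (n + 1)).trans (add_le_add ihn (hK (n + 1)))

/-- A minimal prime of maximal dimension. -/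
theorem exists_associatedPrime_le_ringKrullDim {R : Type u} [CommRing R] [IsNoetherianRing R] {V : Type u} [AddCommGroup V] [Module R V]
    [Module.Finite R V] {t : ℕ} (h : t ≤ Module.supportDim R V) :
    ∃ p ∈ associatedPrimes R V, (t : WithBot ℕ∞) ≤ ringKrullDim (R ⧸ p) := by
  obtain ⟨l, rfl⟩ := Order.le_krullDim_iff.1 h
  have h1 : Module.annihilator R V ≤ l.head.1.asIdeal :=
    Module.mem_support_iff_of_finite.1 l.head.2
  have := l.head.1.2
  obtain ⟨p, hp, hpl⟩ := Ideal.exists_minimalPrimes_le h1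
  refine ⟨p, Module.associatedPrimes.minimalPrimes_annihilator_subset_associatedPrimes R V hp, ?_⟩
  rw [ringKrullDim_quotient, Order.le_krullDim_iff]
  refine ⟨⟨l.length, fun i => ⟨(l i).1, ?_⟩, fun i => l.step i⟩, rfl⟩
  exact hpl.trans (l.monotone (Fin.zero_le i))

/-- The Hilbert–Samuel function grows at least like a polynomial of degree the dimension. -/
theorem exists_multichoose_le_length_quotient {q : Ideal R} (hq : q ≤ maximalIdeal R) (t : ℕ)
    (V : Type u) [AddCommGroup V] [Module R V] [Module.Finite R V]
    (hdim : t ≤ Module.supportDim R V) :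
    ∃ a c : ℕ, ∀ n, (((t + 1).multichoose n : ℕ) : ℕ∞) ≤
      Module.length R (V ⧸ q ^ (a * n + c) • (⊤ : Submodule R V)) := by
  induction t generalizing V with
  | zero =>
    refine ⟨0, 1, fun n => ?_⟩
    have : Nontrivial V := by
      rw [← Module.supportDim_ne_bot_iff_nontrivial R V]
      rintro h
      simp [h] at hdim
    simp only [zero_add, Nat.multichoose_one, Nat.cast_one]
    rw [Order.one_le_iff_ne_zero, Ne, Module.length_eq_zero_iff, Submodule.Quotient.subsingleton_iff]
    intro h
    rw [zero_mul, zero_add, pow_one] at h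
    exact top_ne_bot (α := Submodule R V) (Submodule.eq_bot_of_le_smul_of_le_jacobson_bot q ⊤
      (Module.Finite.fg_top) h.ge (hq.trans (jacobson_eq_maximalIdeal ⊥ bot_ne_top).ge))
  | succ t ih =>
    obtain ⟨p, hp, hpd⟩ := exists_associatedPrime_le_ringKrullDim hdim
    have hpp : p.IsPrime := hp.1
    obtain ⟨g, hg⟩ := (isAssociatedPrime_iff_exists_injective_linearMap _ _).1 hp |>.2
    obtain ⟨c₁, hc₁⟩ := exists_mem_pow_smul_of_injective q g hg
    have hpm : p < maximalIdeal R := by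
      refine lt_of_le_of_ne (le_maximalIdeal hpp.ne_top) ?_
      rintro rfl
      have : ringKrullDim (R ⧸ maximalIdeal R) = 0 :=
        ringKrullDim_eq_zero_of_field (ResidueField R)
      rw [this] at hpd
      norm_cast at hpd
    obtain ⟨x, hxm, hxp⟩ := SetLike.exists_of_lt hpm
    have hreg : Function.Injective (LinearMap.lsmul R (R ⧸ p) x) := by
      rw [injective_iff_map_eq_zero]
      intro y hy
      obtain ⟨y, rfl⟩ := Ideal.Quotient.mk_surjective y
      have : Ideal.Quotient.mk p (x * y) = 0 := hy
      rw [Ideal.Quotient.eq_zero_iff_mem] at this ⊢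
      exact (hpp.mem_or_mem this).resolve_left hxp
    obtain ⟨c₂, hc₂⟩ := exists_mem_pow_smul_of_injective q _ hreg
    have hd : (t : WithBot ℕ∞) ≤ Module.supportDim R (QuotSMulTop x (R ⧸ p)) := by
      have h1 := Module.supportDim_le_supportDim_quotSMulTop_succ (M := R ⧸ p) hxm
      rw [Module.supportDim_quotient_eq_ringKrullDim] at h1
      have h2 := hpd.trans h1
      push_cast at h2
      exact ENat.WithBot.add_le_add_one_right_iff.1 h2
    obtain ⟨a, c, hac⟩ := ih _ hd
    have key : ∀ n, (((t + 1 + 1).multichoose n : ℕ) : ℕ∞) ≤ Module.length R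
        ((R ⧸ p) ⧸ q ^ ((a + c₂ + 1) * n + (c + 1)) • (⊤ : Submodule R (R ⧸ p))) := by
      intro n
      have hQ : ∀ n, (((t + 1).multichoose n : ℕ) : ℕ∞) ≤ Module.length R
        (QuotSMulTop x (R ⧸ p) ⧸ q ^ ((a + c₂ + 1) * n + c + 1) •
          (⊤ : Submodule R (QuotSMulTop x (R ⧸ p)))) := fun n =>
        (hac n).trans (length_quotient_anti (Submodule.smul_mono_left (Ideal.pow_le_pow_right (by
          nlinarith))))
      induction n with
      | zero =>
        obtain ⟨φ, hφ, h⟩ := length_quotient_pow_succ_aux (N := R ⧸ p) (a := x) (I := q)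
          ((a + c₂ + 1) * 0 + c)
        rw [← add_assoc, h]
        refine le_add_left ?_
        simpa using hQ 0
      | succ n ihn =>
        obtain ⟨φ, hφ, h⟩ := length_quotient_pow_succ_aux (N := R ⧸ p) (a := x) (I := q)
          ((a + c₂ + 1) * (n + 1) + c)
        rw [← add_assoc, h, Nat.multichoose_succ_succ, add_comm, Nat.cast_add]
        refine add_le_add (ihn.trans (length_quotient_anti fun w hw => ?_)) (hQ _)
        rw [LinearMap.mem_ker, hφ] at hw
        refine hc₂ _ _ (Submodule.smul_mono_left (Ideal.pow_le_pow_right ?_) hw)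
        nlinarith
    refine ⟨a + c₂ + 1, c + 1 + c₁, fun n => (key n).trans ?_⟩
    refine (length_quotient_anti (B := _) (A := (q ^ ((a + c₂ + 1) * n + (c + 1 + c₁)) • ⊤ :
      Submodule R V).comap g) fun w hw => hc₁ _ _ (by rwa [add_assoc])).trans ?_
    exact Module.length_le_of_injective (Submodule.mapQ _ _ g le_rfl)
      (by rw [← LinearMap.ker_eq_bot, Submodule.ker_mapQ]; exact Submodule.mkQ_map_self _)

/-- A submodule whose traces of the `q`-adic filtration have colength `O(n ^ s)` has dimension at
most `s`. -/
theorem supportDim_le_of_length_le {q : Ideal R} (hq : q ≤ maximalIdeal R) {M : Type u}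
    [AddCommGroup M] [Module R M] [Module.Finite R M] (U : Submodule R M) (s n₀ K : ℕ)
    (h : ∀ n ≥ n₀, Module.length R
      (U ⧸ (q ^ (n + 1) • (⊤ : Submodule R M)).comap U.subtype) ≤ ((K * (n + 1) ^ s : ℕ) : ℕ∞)) :
    Module.supportDim R U ≤ s := by
  by_contra hlt
  have hdim : ((s + 1 : ℕ) : WithBot ℕ∞) ≤ Module.supportDim R U := by
    rw [not_le] at hlt
    push_cast
    exact (ENat.WithBot.add_one_le_iff).2 hlt
  obtain ⟨a, c, hac⟩ := exists_multichoose_le_length_quotient hq (s + 1) U hdim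
  obtain ⟨d, hd⟩ := exists_mem_pow_smul_of_injective q U.subtype U.injective_subtype
  refine not_pow_succ_le s 0 ((s + 1).factorial * (K * (a + c + d + n₀ + 1) ^ s)) fun n _ => ?_
  have h1 := (hac n).trans (length_quotient_anti
    (A := (q ^ (a * n + c + d + n₀ + 1) • (⊤ : Submodule R M)).comap U.subtype) fun w hw =>
      hd (a * n + c) w (Submodule.smul_mono_left (Ideal.pow_le_pow_right (by omega)) hw))
  have h2 := h1.trans (h _ (by omega))
  norm_cast at h2
  calc _ ≤ _ := pow_le_factorial_mul_multichoose (s + 1) n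
    _ ≤ (s + 1).factorial * (K * (a * n + c + d + n₀ + 1) ^ s) := Nat.mul_le_mul_left _ h2
    _ ≤ (s + 1).factorial * (K * ((a + c + d + n₀ + 1) * (n + 1)) ^ s) := by
      gcongr
      nlinarith
    _ = _ := by rw [mul_pow]; ring

end

section

variable {R : Type} [CommRing R] {M : Type} [AddCommGroup M] [Module R M]

theorem mDim_eq_supportDim [Module.Finite R M] : mDim R M = Module.supportDim R M := by
  rw [mDim, Submodule.annihilator_top, Module.supportDim_eq_ringKrullDim_quotient_annihilator]

theorem supportDim_le_max_of_support_subset {A B : Type} [AddCommGroup A] [Module R A]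
    [AddCommGroup B] [Module R B]
    (h : Module.support R M ⊆ Module.support R A ∪ Module.support R B) :
    Module.supportDim R M ≤ max (Module.supportDim R A) (Module.supportDim R B) := by
  refine iSup_le fun l => ?_
  have aux : ∀ (C : Type) [AddCommGroup C] [Module R C], l.head.1 ∈ Module.support R C →
      ((l.length : ℕ∞) : WithBot ℕ∞) ≤ Module.supportDim R C := fun C _ _ hC =>
    Order.LTSeries.length_le_krullDim (α := Module.support R C)
      ⟨l.length, fun i => ⟨(l i).1, Module.mem_support_mono
        (l.monotone (Fin.zero_le i) : l.head ≤ l i) hC⟩, fun i => l.step i⟩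
  exact (h l.head.2).elim (fun hA => le_max_of_le_left (aux A hA))
    fun hB => le_max_of_le_right (aux B hB)

theorem support_sup_subset (A B : Submodule R M) :
    Module.support R ↥(A ⊔ B) ⊆ Module.support R A ∪ Module.support R B := by
  intro P hP
  by_contra hcon
  rw [Set.mem_union, not_or, Module.notMem_support_iff', Module.notMem_support_iff'] at hcon
  refine Module.notMem_support_iff'.2 ?_ hP
  rintro ⟨w, hw⟩
  obtain ⟨a, ha, b, hb, rfl⟩ := Submodule.mem_sup.1 hw
  obtain ⟨s, hs, hsa⟩ := hcon.1 ⟨a, ha⟩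
  obtain ⟨t, ht, htb⟩ := hcon.2 ⟨b, hb⟩
  refine ⟨s * t, P.2.mul_notMem hs ht, Subtype.ext ?_⟩
  have hsa' : s • a = 0 := congrArg Subtype.val hsa
  have htb' : t • b = 0 := congrArg Subtype.val htb
  change (s * t) • (a + b) = 0
  rw [smul_add, mul_smul s t b, htb', mul_comm, mul_smul, hsa', smul_zero, smul_zero, add_zero]

theorem support_sup_span_subset (U : Submodule R M) (u : M) :
    Module.support R ↥(U ⊔ R ∙ u) ⊆ Module.support R U ∪ Module.support R (R ⧸ U.colon {u}) := by
  intro P hP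
  by_contra hcon
  rw [Set.mem_union, not_or, Module.notMem_support_iff', Module.notMem_support_iff'] at hcon
  refine Module.notMem_support_iff'.2 ?_ hP
  rintro ⟨w, hw⟩
  obtain ⟨a, ha, b, hb, rfl⟩ := Submodule.mem_sup.1 hw
  obtain ⟨b, rfl⟩ := Submodule.mem_span_singleton.1 hb
  obtain ⟨t, ht, htu⟩ := hcon.2 (Ideal.Quotient.mk _ 1)
  have htu' : Ideal.Quotient.mk (U.colon {u}) (t * 1) = 0 := htu
  rw [Ideal.Quotient.eq_zero_iff_mem, mul_one, Submodule.mem_colon_singleton] at htu'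
  have hmem : t • (a + b • u) ∈ U := by
    rw [smul_add, smul_comm t b u]
    exact add_mem (U.smul_mem _ ha) (U.smul_mem _ htu')
  obtain ⟨s, hs, hsa⟩ := hcon.1 ⟨_, hmem⟩
  refine ⟨s * t, P.2.mul_notMem hs ht, Subtype.ext ?_⟩
  have hsa' : s • t • (a + b • u) = 0 := congrArg Subtype.val hsa
  change (s * t) • (a + b • u) = 0
  rw [mul_smul, hsa']

theorem support_subset_union_quotient (U : Submodule R M) :
    Module.support R M ⊆ Module.support R U ∪ Module.support R (M ⧸ U) := by
  rw [Module.support_of_exact (LinearMap.exact_subtype_mkQ U) U.injective_subtype U.mkQ_surjective]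

variable [IsNoetherianRing R] [Module.Finite R M]

theorem supportDim_unmixedComp_lt (h : ⊥ < Module.supportDim R M) :
    Module.supportDim R (unmixedComp R M) < Module.supportDim R M := by
  have := CompleteLattice.WellFoundedGT.isSupClosedCompact (Submodule R M) inferInstance
    {N : Submodule R M | mDim R N < mDim R M} ⟨⊥, ?_⟩ ?_
  · rw [← mDim_eq_supportDim, ← mDim_eq_supportDim]
    exact this
  · simpa [mDim_eq_supportDim, Module.supportDim_eq_bot_of_subsingleton] using h
  · intro A hA B hB
    simp only [Set.mem_ofPred_eq, mDim_eq_supportDim] at hA hB ⊢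
    exact (supportDim_le_max_of_support_subset (support_sup_subset A B)).trans_lt (max_lt hA hB)

theorem le_ringKrullDim_of_notMem_unmixedComp (h : ⊥ < Module.supportDim R M) {u : M}
    (hu : u ∉ unmixedComp R M) :
    Module.supportDim R M ≤ ringKrullDim (R ⧸ (unmixedComp R M).colon {u}) := by
  by_contra! hlt
  rw [← Module.supportDim_quotient_eq_ringKrullDim] at hlt
  have h1 : mDim R ↥(unmixedComp R M ⊔ R ∙ u) < mDim R M := by
    rw [mDim_eq_supportDim, mDim_eq_supportDim]
    exact (supportDim_le_max_of_support_subset (support_sup_span_subset _ u)).trans_lt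
      (max_lt (supportDim_unmixedComp_lt h) hlt)
  exact hu (le_sSup (α := Submodule R M) h1
    (Submodule.mem_sup_right (Submodule.mem_span_singleton_self u)))

theorem supportDim_quotient_unmixedComp (h : ⊥ < Module.supportDim R M) :
    Module.supportDim R (M ⧸ unmixedComp R M) = Module.supportDim R M := by
  refine le_antisymm (Module.supportDim_le_of_surjective _ (Submodule.mkQ_surjective _)) ?_
  have := supportDim_le_max_of_support_subset (support_subset_union_quotient (unmixedComp R M))
  exact (le_max_iff.1 this).resolve_left (supportDim_unmixedComp_lt h).not_ge

end

theorem exists_pow_smul_le_of_isFiniteLength {R M : Type*} [CommRing R] [IsLocalRing R]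
    [AddCommGroup M] [Module R M] {A : Submodule R M}
    (h : IsFiniteLength R (M ⧸ A)) : ∃ k, maximalIdeal R ^ k • (⊤ : Submodule R M) ≤ A := by
  obtain ⟨h1, h2⟩ := isFiniteLength_iff_isNoetherian_isArtinian.1 h
  obtain ⟨k, hk⟩ := IsArtinian.monotone_stabilizes
    (⟨fun k => OrderDual.toDual (maximalIdeal R ^ k • (⊤ : Submodule R (M ⧸ A))), fun a b hab =>
      Submodule.smul_mono_left (Ideal.pow_le_pow_right hab)⟩ : ℕ →o (Submodule R (M ⧸ A))ᵒᵈ)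
  have hk' : maximalIdeal R ^ k • (⊤ : Submodule R (M ⧸ A)) = maximalIdeal R ^ (k + 1) • ⊤ :=
    hk (k + 1) (by omega)
  have h0 : maximalIdeal R ^ k • (⊤ : Submodule R (M ⧸ A)) = ⊥ := by
    refine Submodule.eq_bot_of_le_smul_of_le_jacobson_bot (maximalIdeal R) _
      (IsNoetherian.noetherian _) ?_ (jacobson_eq_maximalIdeal ⊥ bot_ne_top).ge
    rw [← Submodule.mul_smul, ← pow_succ']
    exact hk'.le
  refine ⟨k, Submodule.smul_le.mpr fun a ha n _ => ?_⟩
  have : A.mkQ (a • n) ∈ (⊥ : Submodule R (M ⧸ A)) := by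
    rw [← h0, map_smul]
    exact Submodule.smul_mem_smul ha trivial
  rwa [Submodule.mem_bot, Submodule.mkQ_apply, Submodule.Quotient.mk_eq_zero] at this

section

variable {R : Type*} [CommRing R] {M : Type*} [AddCommGroup M] [Module R M]

theorem length_quotient_smul_top (U : Submodule R M) (I : Ideal R) :
    Module.length R (M ⧸ I • (⊤ : Submodule R M)) =
      Module.length R (U ⧸ (I • (⊤ : Submodule R M)).comap U.subtype) +
        Module.length R ((M ⧸ U) ⧸ I • (⊤ : Submodule R (M ⧸ U))) := by
  have hle : I • (⊤ : Submodule R M) ≤ (I • (⊤ : Submodule R (M ⧸ U))).comap U.mkQ :=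
    fun w hw => map_pow_smul_top_le _ _ hw
  refine Module.length_eq_add_of_exact (Submodule.mapQ _ _ U.subtype le_rfl)
    (Submodule.mapQ _ _ U.mkQ hle) ?_ ?_ ?_
  · rw [← LinearMap.ker_eq_bot, Submodule.ker_mapQ]
    exact Submodule.mkQ_map_self _
  · intro y
    obtain ⟨y, rfl⟩ := Submodule.mkQ_surjective _ y
    obtain ⟨w, rfl⟩ := Submodule.mkQ_surjective _ y
    exact ⟨Submodule.mkQ _ w, rfl⟩
  · rw [LinearMap.exact_iff]
    ext y
    obtain ⟨w, rfl⟩ := Submodule.mkQ_surjective _ y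
    rw [LinearMap.mem_ker, Submodule.mkQ_apply, Submodule.mapQ_apply, Submodule.Quotient.mk_eq_zero,
      mkQ_mem_smul_top_iff, Submodule.mem_sup]
    constructor
    · rintro ⟨a, ha, u, hu, rfl⟩
      refine ⟨Submodule.mkQ _ ⟨u, hu⟩, ?_⟩
      rw [Submodule.mkQ_apply, Submodule.mapQ_apply, Submodule.Quotient.eq]
      simpa using ha
    · rintro ⟨z, hz⟩
      obtain ⟨⟨u, hu⟩, rfl⟩ := Submodule.mkQ_surjective _ z
      rw [Submodule.mkQ_apply, Submodule.mapQ_apply, Submodule.Quotient.eq] at hz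
      exact ⟨w - u, by simpa using neg_mem hz, u, hu, by simp⟩

end

theorem multichoose_succ_eq (s n : ℕ) : (s + 1).multichoose n = (n + s).choose s := by
  rw [Nat.multichoose_eq, show s + 1 + n - 1 = n + s by omega, ← Nat.choose_symm_add]

theorem nonpos_of_mul_multichoose_le {a : ℤ} {s n₀ K : ℕ}
    (h : ∀ n ≥ n₀, a * (s + 2).multichoose n ≤ K * (n + 1) ^ s) : a ≤ 0 := by
  by_contra! ha
  refine not_pow_succ_le s n₀ ((s + 1).factorial * K) fun n hn => ?_
  refine (pow_le_factorial_mul_multichoose (s + 1) n).trans ?_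
  rw [mul_assoc]
  refine Nat.mul_le_mul_left _ ?_
  have h1 : ((s + 2).multichoose n : ℤ) ≤ a * (s + 2).multichoose n :=
    le_mul_of_one_le_left (by positivity) ha
  exact_mod_cast h1.trans (h n hn)

theorem eq_zero_of_abs_le {a b : ℤ} {s n₀ K : ℕ}
    (h : ∀ n ≥ n₀, |a * (s + 3).multichoose n + b * (s + 2).multichoose n| ≤ K * (n + 1) ^ s) :
    b = 0 := by
  have hmc : ∀ n, ((s + 2).multichoose n : ℤ) ≤ (n + 1) ^ (s + 1) := fun n => by
    exact_mod_cast multichoose_le_pow (s + 1) n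
  have hpow : ∀ n : ℕ, (K : ℤ) * (n + 1) ^ s ≤ K * (n + 1) ^ (s + 1) := fun n => by
    gcongr
    · linarith
    · omega
  have hb : ∀ n : ℕ, |b * (s + 2).multichoose n| ≤ |b| * (n + 1) ^ (s + 1) := fun n => by
    rw [abs_mul, Nat.abs_cast]
    exact mul_le_mul_of_nonneg_left (hmc n) (abs_nonneg b)
  have ha : a = 0 := by
    refine le_antisymm ?_ (neg_nonpos.1 ?_)
    · refine nonpos_of_mul_multichoose_le (s := s + 1) (n₀ := n₀) (K := K + b.natAbs) fun n hn => ?_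
      have h1 := (abs_le.1 (h n hn)).2
      have h2 := (abs_le.1 (hb n)).1
      push_cast [Int.natCast_natAbs]
      linarith [hpow n]
    · refine nonpos_of_mul_multichoose_le (s := s + 1) (n₀ := n₀) (K := K + b.natAbs) fun n hn => ?_
      have h1 := (abs_le.1 (h n hn)).1
      have h2 := (abs_le.1 (hb n)).2
      push_cast [Int.natCast_natAbs]
      linarith [hpow n]
  subst ha
  refine le_antisymm ?_ (neg_nonpos.1 ?_)
  · refine nonpos_of_mul_multichoose_le (s := s) (n₀ := n₀) (K := K) fun n hn => ?_
    linarith [(abs_le.1 (h n hn)).2]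
  · refine nonpos_of_mul_multichoose_le (s := s) (n₀ := n₀) (K := K) fun n hn => ?_
    linarith [(abs_le.1 (h n hn)).1]

/-- The part of a Hilbert polynomial of degree at most `s` is `O(n ^ s)`. -/
theorem exists_abs_sub_le (e : ℕ → ℤ) (s : ℕ) :
    ∃ K : ℕ, ∀ n : ℕ, |∑ i ∈ Finset.range (s + 2 + 1),
      (-1 : ℤ) ^ i * e i * ((n + (s + 2) - i).choose (s + 2 - i) : ℤ) -
        (e 0 * (s + 3).multichoose n - e 1 * (s + 2).multichoose n)| ≤ K * (n + 1) ^ s := by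
  refine ⟨∑ i ∈ Finset.range (s + 1), (e (i + 2)).natAbs, fun n => ?_⟩
  rw [Finset.sum_range_succ', Finset.sum_range_succ']
  have h0 := multichoose_succ_eq (s + 2) n
  have h1 : (s + 2).multichoose n = (n + (s + 2) - (0 + 1)).choose (s + 2 - (0 + 1)) :=
    multichoose_succ_eq (s + 1) n
  rw [h0, h1, Nat.sub_zero, Nat.sub_zero, show ∀ a b c d f : ℤ, a + (-1) ^ (0 + 1) * b * c + (-1) ^ 0 * d * f - (d * f - b * c) = a by
    intros; ring]
  refine (Finset.abs_sum_le_sum_abs _ _).trans ?_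
  rw [Nat.cast_sum, Finset.sum_mul]
  refine Finset.sum_le_sum fun i hi => ?_
  have hi' := Finset.mem_range.1 hi
  have h2 : (n + (s + 2) - (i + 1 + 1)).choose (s + 2 - (i + 1 + 1)) ≤ (n + 1) ^ s := by
    have h3 := multichoose_le_pow (s - i) n
    rw [multichoose_succ_eq] at h3
    refine le_trans (le_of_eq ?_) (h3.trans (Nat.pow_le_pow_right (by omega) (by omega)))
    congr 1 <;> omega
  rw [abs_mul, abs_mul, abs_pow, abs_neg, abs_one, one_pow, one_mul, Nat.abs_cast,
    Int.natCast_natAbs]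
  exact mul_le_mul_of_nonneg_left (by exact_mod_cast h2) (abs_nonneg _)

/-- Hilbert coefficients in terms of colengths, up to terms of degree at most `r - 2`. -/
theorem HasHilbCoeffs.exists_abs_colen_sub_le {R : Type} [CommRing R] {M : Type} [AddCommGroup M]
    [Module R M] {Q : Ideal R} {s : ℕ} {e : ℕ → ℤ} (he : HasHilbCoeffs R Q M (s + 2) e) :
    ∃ n₀ K : ℕ, ∀ n ≥ n₀, |(colen (Q ^ (n + 1) • (⊤ : Submodule R M)) : ℤ) -
      (e 0 * (s + 3).multichoose n - e 1 * (s + 2).multichoose n)| ≤ K * (n + 1) ^ s := by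
  obtain ⟨n₀, hn₀⟩ := he
  obtain ⟨K, hK⟩ := exists_abs_sub_le e s
  refine ⟨n₀, K, fun n hn => ?_⟩
  obtain ⟨l, hl, hsum⟩ := hn₀ n hn
  have : colen (Q ^ (n + 1) • (⊤ : Submodule R M)) = l := by
    simp only [mLength, ← Module.coe_length] at hl
    rw [colen, WithBot.coe_injective hl, ENat.toNat_natCast]
  rw [this, hsum]
  exact hK n

section

variable {R : Type} [CommRing R] [IsLocalRing R] [IsNoetherianRing R]
  {M : Type} [AddCommGroup M] [Module R M] [Module.Finite R M] {r : ℕ} {x : Fin r → R}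

theorem colen_eq_add (hfin : ∃ k, maximalIdeal R ^ k • (⊤ : Submodule R M) ≤ gen x • ⊤)
    (U : Submodule R M) (n : ℕ) :
    colen (gen x ^ n • (⊤ : Submodule R M)) =
      colen ((gen x ^ n • (⊤ : Submodule R M)).comap U.subtype) +
        colen (gen x ^ n • (⊤ : Submodule R (M ⧸ U))) := by
  have h := length_quotient_smul_top U (gen x ^ n)
  have hM := length_quotient_ne_top (exists_pow_le_gen_pow x hfin n)
  have hU := ne_top_of_le_ne_top hM (le_self_add.trans h.ge)
  have hN := ne_top_of_le_ne_top hM (le_add_self.trans h.ge)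
  rw [← coe_colen hM, ← coe_colen hU, ← coe_colen hN] at h
  exact_mod_cast h

theorem exists_colen_comap_le (hfin : ∃ k, maximalIdeal R ^ k • (⊤ : Submodule R M) ≤ gen x • ⊤)
    (U : Submodule R M) {t : ℕ} (hdim : Module.supportDim R U ≤ t) :
    ∃ K : ℕ, ∀ n, colen ((gen x ^ (n + 1) • (⊤ : Submodule R M)).comap U.subtype) ≤
      K * (n + 1) ^ t := by
  obtain ⟨K, hK⟩ := exists_length_quotient_pow_succ_le (q := gen x) t U hdim
    (exists_pow_le_gen_sup hfin
      (LinearMap.annihilator_le_of_injective U.subtype U.injective_subtype))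
  refine ⟨K, fun n => ?_⟩
  have h1 := (length_quotient_anti (A := gen x ^ (n + 1) • (⊤ : Submodule R U))
    (B := (gen x ^ (n + 1) • (⊤ : Submodule R M)).comap U.subtype)
    fun w hw => map_pow_smul_top_le U.subtype _ hw).trans (hK n)
  have h2 : colen ((gen x ^ (n + 1) • (⊤ : Submodule R M)).comap U.subtype) ≤
      K * (t + 1).multichoose n := by
    have h3 := ENat.toNat_le_toNat h1 (ENat.natCast_ne_top _)
    rwa [ENat.toNat_natCast] at h3
  exact h2.trans (Nat.mul_le_mul_left _ (multichoose_le_pow t n))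

theorem length_comap_eq_colen (hfin : ∃ k, maximalIdeal R ^ k • (⊤ : Submodule R M) ≤ gen x • ⊤)
    (U : Submodule R M) (n : ℕ) :
    Module.length R (U ⧸ (gen x ^ n • (⊤ : Submodule R M)).comap U.subtype) =
      (colen ((gen x ^ n • (⊤ : Submodule R M)).comap U.subtype) : ℕ∞) := by
  have h := length_quotient_smul_top U (gen x ^ n)
  have hM := length_quotient_ne_top (exists_pow_le_gen_pow x hfin n)
  exact (coe_colen (ne_top_of_le_ne_top hM (le_self_add.trans h.ge))).symm

theorem hfin_quotient {R M : Type*} [CommRing R] [IsLocalRing R] [AddCommGroup M] [Module R M]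
    {r : ℕ} {x : Fin r → R} (hfin : ∃ k, maximalIdeal R ^ k • (⊤ : Submodule R M) ≤ gen x • ⊤)
    (U : Submodule R M) : ∃ k, maximalIdeal R ^ k • (⊤ : Submodule R (M ⧸ U)) ≤ gen x • ⊤ := by
  obtain ⟨k, hk⟩ := hfin
  refine ⟨k, ?_⟩
  have h2 := Submodule.map_mono (f := U.mkQ) hk
  rwa [Submodule.map_smul'', Submodule.map_smul'', Submodule.map_top, Submodule.range_mkQ] at h2

end

section

variable {R : Type} [CommRing R] [IsLocalRing R] [IsNoetherianRing R]
  {M : Type} [AddCommGroup M] [Module R M] [Module.Finite R M] {s : ℕ} {x : Fin (s + 2) → R}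
  {e : ℕ → ℤ}

theorem isCM_and_mDim_le_of_eq_zero
    (hCM : ∃ (S : Type) (_ : CommRing S),
      IsCMRing S ∧ ∃ f : S →+* R, Function.Surjective f)
    (hdim : Module.supportDim R M = (s + 2 : ℕ)) (hx : ∀ i, x i ∈ maximalIdeal R)
    (hfin : ∃ k, maximalIdeal R ^ k • (⊤ : Submodule R M) ≤ gen x • ⊤)
    (he : HasHilbCoeffs R (gen x) M (s + 2) e) (he1 : e 1 = 0) :
    IsCM R (M ⧸ unmixedComp R M) ∧ mDim R ↥(unmixedComp R M) ≤ (s : ℕ) := by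
  have hbot : ⊥ < Module.supportDim R M := by rw [hdim]; exact WithBot.bot_lt_coe _
  have hUlt := supportDim_unmixedComp_lt hbot
  have hNdim := (supportDim_quotient_unmixedComp hbot).trans hdim
  have hL := fun u hu => le_ringKrullDim_of_notMem_unmixedComp (R := R) (M := M) hbot (u := u) hu
  simp only [hdim] at hL hUlt
  generalize unmixedComp R M = U at *
  have hNfin := hfin_quotient hfin U
  have hUle : Module.supportDim R U ≤ (s + 1 : ℕ) := by
    rw [show ((s + 2 : ℕ) : WithBot ℕ∞) = ((s + 1 : ℕ) : WithBot ℕ∞) + 1 by push_cast; ring] at hUlt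
    exact ENat.WithBot.lt_add_one_iff.1 hUlt
  obtain ⟨K₁, hK₁⟩ := exists_colen_comap_le hfin U hUle
  obtain ⟨n₀, K, hK⟩ := HasHilbCoeffs.exists_abs_colen_sub_le he
  simp only [he1, zero_mul, sub_zero, colen_eq_add hfin U] at hK
  have hK₁' : ∀ n : ℕ, (colen ((gen x ^ (n + 1) • (⊤ : Submodule R M)).comap U.subtype) : ℤ) ≤
      K₁ * (n + 1) ^ (s + 1) := fun n => by exact_mod_cast hK₁ n
  have hpow : ∀ n : ℕ, (K : ℤ) * (n + 1) ^ s ≤ K * (n + 1) ^ (s + 1) := fun n => by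
    gcongr
    · linarith
    · omega
  have hdich : StepDichotomy x (M ⧸ U) := by
    refine stepDichotomy_of_bounds x hNfin (e 0) n₀ K (K₁ + K) (fun n hn => ?_) (fun n hn => ?_)
    · have h1 := (abs_le.1 (hK n hn)).2
      push_cast at h1
      linarith [Int.natCast_nonneg
        (colen ((gen x ^ (n + 1) • (⊤ : Submodule R M)).comap U.subtype))]
    · have h1 := (abs_le.1 (hK n hn)).1
      push_cast at h1 ⊢
      linarith [hK₁' n, hpow n]
  have hbc := boundedColon_of_isCMRing hCM hx hfin U hL
  have hex := (freeChain_of_stepDichotomy x (by omega) hNfin hdich hbc).exactLength x hNfin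
  have he0 : e 0 - colen (gen x • (⊤ : Submodule R (M ⧸ U))) ≤ 0 := by
    refine nonpos_of_mul_multichoose_le (s := s + 1) (n₀ := n₀) (K := K₁ + K) fun n hn => ?_
    have h1 := (abs_le.1 (hK n hn)).1
    rw [hex n] at h1
    push_cast at h1 ⊢
    linarith [hK₁' n, hpow n]
  have hUs : Module.supportDim R U ≤ s := by
    refine supportDim_le_of_length_le (q := gen x) (Ideal.span_le.2 (by rintro _ ⟨i, rfl⟩; exact hx i))
      U s n₀ K fun n hn => ?_
    rw [length_comap_eq_colen hfin]
    have h1 := (abs_le.1 (hK n hn)).2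
    rw [hex n] at h1
    push_cast at h1
    have h2 : (e 0 - colen (gen x • (⊤ : Submodule R (M ⧸ U)))) * ((s + 3).multichoose n : ℤ) ≤ 0 :=
      mul_nonpos_of_nonpos_of_nonneg he0 (by positivity)
    have h3 : (colen ((gen x ^ (n + 1) • (⊤ : Submodule R M)).comap U.subtype) : ℤ) ≤
      K * (n + 1) ^ s := by linarith
    exact_mod_cast h3
  have hmem : ∀ y ∈ List.ofFn x, y ∈ maximalIdeal R := fun y hy => by
    obtain ⟨i, rfl⟩ := List.mem_ofFn.1 hy
    exact hx i
  refine ⟨⟨List.ofFn x, hmem, ?_, ?_⟩, ?_⟩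
  · have : Nontrivial (M ⧸ U) := by
      rw [← Module.supportDim_ne_bot_iff_nontrivial R, hNdim]
      exact WithBot.coe_ne_bot
    exact (IsLocalRing.isRegular_iff_isWeaklyRegular_of_subset_maximalIdeal
      hmem).2 (hex.isWeaklyRegular hx hNfin)
  · rw [mDim_eq_supportDim, hNdim, List.length_ofFn]
  · rw [mDim_eq_supportDim]
    exact hUs

theorem eq_zero_of_isCM_of_mDim_le
    (hdim : Module.supportDim R M = (s + 2 : ℕ)) (hx : ∀ i, x i ∈ maximalIdeal R)
    (hfin : ∃ k, maximalIdeal R ^ k • (⊤ : Submodule R M) ≤ gen x • ⊤)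
    (he : HasHilbCoeffs R (gen x) M (s + 2) e) (hN : IsCM R (M ⧸ unmixedComp R M))
    (hU : mDim R ↥(unmixedComp R M) ≤ (s : ℕ)) : e 1 = 0 := by
  have hbot : ⊥ < Module.supportDim R M := by rw [hdim]; exact WithBot.bot_lt_coe _
  have hNdim := (supportDim_quotient_unmixedComp hbot).trans hdim
  rw [mDim_eq_supportDim] at hU
  generalize unmixedComp R M = U at *
  have hNfin := hfin_quotient hfin U
  obtain ⟨rs, hrs, hreg, hlen⟩ := hN
  rw [mDim_eq_supportDim, hNdim] at hlen
  have hex := exactLength_of_isRegular hNfin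
    (isRegular_of_hasDepth hx hNfin ⟨rs, by exact_mod_cast hlen, hrs, hreg⟩)
  obtain ⟨K₁, hK₁⟩ := exists_colen_comap_le hfin U hU
  obtain ⟨n₀, K, hK⟩ := HasHilbCoeffs.exists_abs_colen_sub_le he
  refine eq_zero_of_abs_le (a := colen (gen x • (⊤ : Submodule R (M ⧸ U))) - e 0) (s := s)
    (n₀ := n₀) (K := K + K₁) fun n hn => ?_
  have h1 := hK n hn
  rw [colen_eq_add hfin U, hex n] at h1
  have h2 : (colen ((gen x ^ (n + 1) • (⊤ : Submodule R M)).comap U.subtype) : ℤ) ≤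
      K₁ * (n + 1) ^ s := by exact_mod_cast hK₁ n
  have h3 := Int.natCast_nonneg
    (colen ((gen x ^ (n + 1) • (⊤ : Submodule R M)).comap U.subtype))
  push_cast at h1 ⊢
  rw [abs_le] at h1 ⊢
  constructor <;> linarith [h1.1, h1.2]

end

end HilbertFiber

theorem statement7 (R : Type) [CommRing R] [IsLocalRing R] [IsNoetherianRing R]
    (hCM : ∃ (S : Type) (_ : CommRing S),
      IsCMRing S ∧ ∃ f : S →+* R, Function.Surjective f)
    (M : Type) [AddCommGroup M] [Module R M] [Module.Finite R M]
    (r : ℕ) (hr : mDim R M = (r : ℕ∞)) (hr2 : 2 ≤ r)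
    (Q : Ideal R) (hQ : IsParamIdeal R Q M r)
    (e : ℕ → ℤ) (he : HasHilbCoeffs R Q M r e) :
    e 1 = 0 ↔
      (IsCM R (M ⧸ unmixedComp R M) ∧
        mDim R ↥(unmixedComp R M) ≤ ((r - 2 : ℕ) : ℕ∞)) := by
  obtain ⟨s, rfl⟩ := Nat.exists_eq_add_of_le' hr2
  obtain ⟨hQm, ⟨x, rfl⟩, hlen⟩ := hQ
  have hx : ∀ i, x i ∈ maximalIdeal R := fun i => hQm (Ideal.subset_span ⟨i, rfl⟩)
  have hfin := HilbertFiber.exists_pow_smul_le_of_isFiniteLength hlen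
  have hdim : Module.supportDim R M = (s + 2 : ℕ) := by
    rw [← HilbertFiber.mDim_eq_supportDim, hr]
    rfl
  rw [Nat.add_sub_cancel]
  exact ⟨fun h => HilbertFiber.isCM_and_mDim_le_of_eq_zero hCM hdim hx hfin he h,
    fun h => HilbertFiber.eq_zero_of_isCM_of_mDim_le hdim hx hfin he h.1 h.2⟩
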